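/- arXiv:2408.12771 — 10 statements merged into one kernel-verified Lean document; each statement's English description precedes it below -/
import Mathlib

section
/- Let d, w be real numbers with d > 0, d ≠ 1, w > 0 and 1 − d·w² > 0, and set β₀ = (1/d)·√(1/d − w²). Consider the 3×3 real matrix J = ![![0, 0, 1], ![β₀, −d·β₀, 0], ![−1/d, 1, d·β₀]], which is the Jacobian matrix at the origin of the FitzHugh–Nagumo vector field (x,y,z) ↦ (z, b(x − d y), (x − a)(x − 1)x + y + c z) with parameters (a, b, c) = (−1/d, β₀, d·β₀). Then the characteristic polynomial of J equals X³ + w²·X; equivalently, the eigenvalues of J (over ℂ) are 0, i·w and −i·w. -/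
open Polynomial

/-- The Jacobian at the origin of the FitzHugh–Nagumo system with Family A
parameters `(a, b, c) = (-1/d, β₀, d·β₀)`, `β₀ = (1/d)·√(1/d - w²)`, has
characteristic polynomial `X³ + w²·X`; equivalently its complex eigenvalues are
`0`, `i·w` and `-i·w`. -/
theorem fhn_familyA_hopf_zero (d w : ℝ) (hd : 0 < d) (hd1 : d ≠ 1) (hw : 0 < w)
    (hdw : 0 < 1 - d * w ^ 2)
    (β₀ : ℝ) (hβ₀ : β₀ = (1 / d) * Real.sqrt (1 / d - w ^ 2))
    (J : Matrix (Fin 3) (Fin 3) ℝ)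
    (hJ : J = ![![0, 0, 1], ![β₀, -d * β₀, 0], ![-1 / d, 1, d * β₀]]) :
    J.charpoly = X ^ 3 + C (w ^ 2) * X ∧
      spectrum ℂ (J.map (Complex.ofReal)) =
        {0, Complex.I * w, -(Complex.I * w)} := by
  have hd0 : d ≠ 0 := hd.ne'
  have hnn : 0 ≤ 1 / d - w ^ 2 := by
    have h : 1 / d - w ^ 2 = (1 - d * w ^ 2) / d := by field_simp
    rw [h]
    positivity
  have hb : d ^ 2 * β₀ ^ 2 = 1 / d - w ^ 2 := by
    rw [hβ₀, mul_pow, Real.sq_sqrt hnn]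
    field_simp
  have hinv : d * (1 / d) = 1 := by field_simp
  have hchar : J.charpoly = X ^ 3 + C (w ^ 2) * X := by
    apply Polynomial.funext
    intro t
    have h00 : J 0 0 = 0 := by rw [hJ]; rfl
    have h01 : J 0 1 = 0 := by rw [hJ]; rfl
    have h02 : J 0 2 = 1 := by rw [hJ]; rfl
    have h10 : J 1 0 = β₀ := by rw [hJ]; rfl
    have h11 : J 1 1 = -d * β₀ := by rw [hJ]; rfl
    have h12 : J 1 2 = 0 := by rw [hJ]; rfl
    have h20 : J 2 0 = -(1 / d) := by rw [← neg_div, hJ]; rfl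
    have h21 : J 2 1 = 1 := by rw [hJ]; rfl
    have h22 : J 2 2 = d * β₀ := by rw [hJ]; rfl
    rw [Matrix.eval_charpoly, Matrix.det_fin_three]
    simp only [Matrix.sub_apply, h00, h01, h02, h10, h11, h12, h20, h21, h22,
      Matrix.scalar_apply, Matrix.diagonal_apply]
    simp only [eval_add, eval_pow, eval_X, eval_mul, eval_C]
    norm_num [Fin.ext_iff]
    simp only [one_div] at hb hinv
    linear_combination (-t) * hb + β₀ * hinv
  refine ⟨hchar, ?_⟩
  ext z
  have hm : (J.map Complex.ofReal).charpoly = J.charpoly.map Complex.ofRealHom :=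
    Matrix.charpoly_map J Complex.ofRealHom
  rw [Matrix.mem_spectrum_iff_isRoot_charpoly, hm, hchar]
  simp only [IsRoot, Polynomial.map_add, Polynomial.map_mul, Polynomial.map_pow, map_X, map_C,
    eval_add, eval_pow, eval_X, eval_mul, eval_C, Set.mem_insert_iff, Set.mem_singleton_iff,
    Complex.ofRealHom_eq_coe, Complex.ofReal_pow]
  have hf : z ^ 3 + (w : ℂ) ^ 2 * z = z * ((z - Complex.I * w) * (z + Complex.I * w)) := by
    linear_combination (z * (w : ℂ) ^ 2) * Complex.I_sq
  rw [hf, mul_eq_zero, mul_eq_zero, sub_eq_zero, add_eq_zero_iff_eq_neg]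
end

section
/- Let d, w, α₁, α₂, β₁, β₂, γ₁, γ₂ be real numbers with d > 0, d ≠ 1, w > 0, 1 − d·w² > 0, and set β₀ = (1/d)·√(1/d − w²) and l₀ = 2w⁴d(dβ₁ − γ₁)² + 2α₁²(dw² − 1). Assume l₀·(w²d − 1) > 0 and l₀ ≠ 0. For ε ∈ ℝ define the parameters a(ε) = −1/d + εα₁ + ε²α₂, b(ε) = β₀ + εβ₁ + ε²β₂, c(ε) = d·β₀ + εγ₁ + ε²γ₂. Then for every δ > 0 there exists ε₀ > 0 such that for all ε with 0 < |ε| < ε₀, the FitzHugh–Nagumo system ẋ = z, ẏ = b(ε)(x − d y), ż = (x − a(ε))(x − 1)x + y + c(ε) z admits a nonconstant periodic solution φ : ℝ → ℝ³ (i.e., φ is differentiable, satisfies the system at every time, and is T-periodic for some T > 0) whose image is contained in the open ball of radius δ centered at the origin. -/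
section
open Filter Topology

lemma abstract_bif {V P : Type*} [NormedAddCommGroup V] [NormedSpace ℝ V] [CompleteSpace V]
    [NormedAddCommGroup P] [NormedSpace ℝ P] [CompleteSpace P]
    (Γ : ℝ × V × P → V) (B : ℝ × V × P → P) (ι : P →L[ℝ] V) (p0 : P)
    (hΓ : ContDiff ℝ 1 Γ) (hB : ContDiff ℝ 1 B) (f' : P ≃L[ℝ] P)
    (hf : HasFDerivAt (fun p => B (0, ι p, p)) (f' : P →L[ℝ] P) p0)
    (h0 : B (0, ι p0, p0) = 0) (U : Set (V × P)) (hU : U ∈ 𝓝 (ι p0, p0)) :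
    ∀ᶠ ε in 𝓝 (0 : ℝ), ∃ v p, (v, p) ∈ U ∧ v = ι p + ε • Γ (ε, v, p) ∧ B (ε, v, p) = 0 := by
  set Φ : ℝ × (V × P) → V × P := fun x =>
    (x.2.1 - x.1 • Γ (x.1, ι x.2.2 + x.2.1, x.2.2), B (x.1, ι x.2.2 + x.2.1, x.2.2)) with hΦ
  have hΦc : ContDiff ℝ 1 Φ := by
    rw [hΦ]; fun_prop
  set x0 : ℝ × (V × P) := (0, (0, p0)) with hx0
  have hs : HasStrictFDerivAt Φ (fderiv ℝ Φ x0) x0 :=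
    hΦc.contDiffAt.hasStrictFDerivAt (by norm_num)
  set Ψ : V × P → P := fun y => B (0, ι y.2 + y.1, y.2) with hΨ
  have hΨc : ContDiff ℝ 1 Ψ := by
    rw [hΨ]; fun_prop
  have hΨd : HasFDerivAt Ψ (fderiv ℝ Ψ (0, p0)) (0, p0) :=
    (hΨc.differentiable (by norm_num) _).hasFDerivAt
  set D := fderiv ℝ Ψ (0, p0) with hD
  have e1 : fderiv ℝ Φ x0 ∘L .inr ℝ ℝ (V × P) = (ContinuousLinearMap.fst ℝ V P).prod D := by
    have a1 : HasFDerivAt (fun y : V × P => Φ ((0 : ℝ), y))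
        (fderiv ℝ Φ x0 ∘L .inr ℝ ℝ (V × P)) (0, p0) :=
      hs.hasFDerivAt.comp (0, p0) (hasFDerivAt_prodMk_right (0 : ℝ) ((0, p0) : V × P))
    have a2 : HasFDerivAt (fun y : V × P => Φ ((0 : ℝ), y))
        ((ContinuousLinearMap.fst ℝ V P).prod D) (0, p0) := by
      have : (fun y : V × P => Φ ((0 : ℝ), y)) = fun y => (y.1, Ψ y) := by
        funext y; simp [hΦ, hΨ]
      rw [this]
      exact hasFDerivAt_fst.prodMk hΨd
    exact a1.unique a2
  have e2 : D ∘L .inr ℝ V P = (f' : P →L[ℝ] P) := by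
    have a1 : HasFDerivAt (fun p : P => Ψ ((0 : V), p)) (D ∘L .inr ℝ V P) p0 :=
      hΨd.comp p0 (hasFDerivAt_prodMk_right (0 : V) p0)
    have : (fun p : P => Ψ ((0 : V), p)) = fun p => B (0, ι p, p) := by
      funext y; simp [hΨ]
    rw [this] at a1
    exact a1.unique hf
  have e3 : ∀ e p, D (e, p) = D (e, 0) + f' p := by
    intro e p
    have : D (0, p) = f' p := by
      have := congrArg (fun l => l p) e2
      simpa using this
    rw [← this, ← map_add]; simp
  have hinv : (fderiv ℝ Φ x0 ∘L .inr ℝ ℝ (V × P)).IsInvertible := by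
    rw [e1]
    refine ContinuousLinearMap.IsInvertible.of_inverse
      (g := (ContinuousLinearMap.fst ℝ V P).prod
        ((f'.symm : P →L[ℝ] P) ∘L (ContinuousLinearMap.snd ℝ V P -
          D ∘L (ContinuousLinearMap.inl ℝ V P) ∘L ContinuousLinearMap.fst ℝ V P))) ?_ ?_
    · apply ContinuousLinearMap.ext
      rintro ⟨x, y⟩
      simp [e3 x (f'.symm _ - _)]
    · apply ContinuousLinearMap.ext
      rintro ⟨x, y⟩
      simp [e3 x y]
  have hx : Φ x0 = 0 := by simp [hΦ, hx0, h0]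
  have t1 := hs.tendsto_implicitFunctionOfProdDomain hinv
  have t2 := hs.eventually_apply_implicitFunctionOfProdDomain hinv
  set ψ := hs.implicitFunctionOfProdDomain hinv
  have t3 : Tendsto (fun ε : ℝ => ((ι (ψ ε).2 + (ψ ε).1, (ψ ε).2) : V × P)) (𝓝 0)
      (𝓝 (ι p0, p0)) := by
    have c : Continuous (fun y : V × P => ((ι y.2 + y.1, y.2) : V × P)) := by fun_prop
    have := (c.tendsto (0, p0)).comp t1
    simpa [Function.comp_def] using this
  filter_upwards [t3 hU, t2] with ε h1 h2
  refine ⟨_, _, h1, ?_, ?_⟩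
  · rw [hx] at h2
    have := congrArg Prod.fst h2
    simp only [hΦ, Prod.fst_zero] at this
    rw [sub_eq_zero] at this
    simpa using this
  · rw [hx] at h2
    have := congrArg Prod.snd h2
    simpa [hΦ] using this

end

instance fhn_fact_two_pi : Fact (0 < 2 * Real.pi) := ⟨Real.two_pi_pos⟩

abbrev CE := C(AddCircle (2 * Real.pi), ℝ)

noncomputable def mkE (f : ℝ → ℝ) (hf : Continuous f) (hp : Function.Periodic f (2 * Real.pi)) :
    CE := ⟨hp.lift, continuous_coinduced_dom.mpr hf⟩

lemma mkE_apply (f : ℝ → ℝ) (hf : Continuous f) (hp : Function.Periodic f (2 * Real.pi)) (t : ℝ) :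
    mkE f hf hp (t : AddCircle (2 * Real.pi)) = f t := rfl

lemma CE_cont (g : CE) : Continuous (fun t : ℝ => g (t : AddCircle (2 * Real.pi))) :=
  g.continuous.comp (AddCircle.continuous_mk' _)

lemma CE_per (g : CE) :
    Function.Periodic (fun t : ℝ => g (t : AddCircle (2 * Real.pi))) (2 * Real.pi) := by
  intro t
  simp only [AddCircle.coe_add_period]

lemma CE_int (g : CE) (a b : ℝ) : IntervalIntegrable
    (fun t : ℝ => g (t : AddCircle (2 * Real.pi))) MeasureTheory.volume a b :=
  (CE_cont g).intervalIntegrable a b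

lemma exists_avg : ∃ A : CE →L[ℝ] ℝ, ∀ g : CE,
    A g = (2 * Real.pi)⁻¹ * ∫ s in (0 : ℝ)..(2 * Real.pi), g (s : AddCircle (2 * Real.pi)) := by
  refine ⟨LinearMap.mkContinuous
    { toFun := fun g : CE =>
        (2 * Real.pi)⁻¹ * ∫ s in (0 : ℝ)..(2 * Real.pi), g (s : AddCircle (2 * Real.pi))
      map_add' := ?_
      map_smul' := ?_ } 1 ?_, fun g => rfl⟩
  · intro f g
    simp only [ContinuousMap.add_apply]
    rw [intervalIntegral.integral_add (CE_int f _ _) (CE_int g _ _)]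
    ring
  · intro c f
    simp only [ContinuousMap.smul_apply, smul_eq_mul, intervalIntegral.integral_const_mul,
      RingHom.id_apply]
    ring
  · intro g
    simp only [LinearMap.coe_mk, AddHom.coe_mk, one_mul]
    have h := intervalIntegral.norm_integral_le_of_norm_le_const (a := 0) (b := 2 * Real.pi)
      (C := ‖g‖) (f := fun s : ℝ => g (s : AddCircle (2 * Real.pi)))
      (fun x _ => g.norm_coe_le_norm _)
    have hp := Real.two_pi_pos
    rw [norm_mul, norm_inv, Real.norm_of_nonneg hp.le, inv_mul_le_iff₀ hp]
    rw [sub_zero, abs_of_pos hp] at h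
    linarith

noncomputable def avg : CE →L[ℝ] ℝ := exists_avg.choose

lemma avg_apply (g : CE) :
    avg g = (2 * Real.pi)⁻¹ * ∫ s in (0 : ℝ)..(2 * Real.pi), g (s : AddCircle (2 * Real.pi)) :=
  exists_avg.choose_spec g

lemma primitive_periodic (g : CE) : Function.Periodic
    (fun t : ℝ => ∫ s in (0 : ℝ)..t, (g (s : AddCircle (2 * Real.pi)) - avg g))
    (2 * Real.pi) := by
  intro t
  have hper : Function.Periodic (fun s : ℝ => g (s : AddCircle (2 * Real.pi)) - avg g)
      (2 * Real.pi) := fun s => by simp only [AddCircle.coe_add_period]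
  have hc : Continuous (fun s : ℝ => g (s : AddCircle (2 * Real.pi)) - avg g) :=
    (CE_cont g).sub continuous_const
  simp only
  have hp := Real.two_pi_pos
  have h2 : ∫ s in (0 : ℝ)..(2 * Real.pi), g (s : AddCircle (2 * Real.pi))
      = 2 * Real.pi * avg g := by
    rw [avg_apply]; field_simp
  have h3 : ∫ s in (0 : ℝ)..(2 * Real.pi), (g (s : AddCircle (2 * Real.pi)) - avg g) = 0 := by
    rw [intervalIntegral.integral_sub (CE_int g _ _) (by simp), h2,
      intervalIntegral.integral_const, smul_eq_mul]
    ring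
  rw [hper.intervalIntegral_add_eq_add 0 t (fun a b => hc.intervalIntegrable a b), zero_add, h3,
    add_zero]

lemma primitive_cont (g : CE) : Continuous
    (fun t : ℝ => ∫ s in (0 : ℝ)..t, (g (s : AddCircle (2 * Real.pi)) - avg g)) := by
  have hc : Continuous (fun s : ℝ => g (s : AddCircle (2 * Real.pi)) - avg g) :=
    (CE_cont g).sub continuous_const
  exact intervalIntegral.continuous_primitive (fun a b => hc.intervalIntegrable a b) 0

lemma exists_prim : ∃ K : CE →L[ℝ] CE, ∀ (g : CE) (t : ℝ),
    K g (t : AddCircle (2 * Real.pi)) =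
      ∫ s in (0 : ℝ)..t, (g (s : AddCircle (2 * Real.pi)) - avg g) := by
  refine ⟨LinearMap.mkContinuous
    { toFun := fun g : CE => mkE _ (primitive_cont g) (primitive_periodic g)
      map_add' := ?_
      map_smul' := ?_ } ((1 + ‖avg‖) * (2 * Real.pi)) ?_, fun g t => rfl⟩
  · intro f g
    ext t
    induction t using QuotientAddGroup.induction_on with | H t => ?_
    have hc : ∀ g : CE, Continuous (fun s : ℝ => g (s : AddCircle (2 * Real.pi)) - avg g) :=
      fun g => (CE_cont g).sub continuous_const
    simp only [ContinuousMap.add_apply, mkE_apply]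
    rw [← intervalIntegral.integral_add ((hc f).intervalIntegrable _ _)
      ((hc g).intervalIntegrable _ _), map_add]
    congr 1; ext s; ring
  · intro c f
    ext t
    induction t using QuotientAddGroup.induction_on with | H t => ?_
    simp only [ContinuousMap.smul_apply, mkE_apply, RingHom.id_apply, smul_eq_mul]
    rw [← intervalIntegral.integral_const_mul, map_smul, smul_eq_mul]
    congr 1; ext s; ring
  · intro g
    simp only [LinearMap.coe_mk, AddHom.coe_mk]
    have hp := Real.two_pi_pos
    refine (ContinuousMap.norm_le _ (by positivity)).mpr fun x => ?_
    have hx : x ∈ ((↑) : ℝ → AddCircle (2 * Real.pi)) '' Set.Ico 0 (0 + 2 * Real.pi) := by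
      rw [AddCircle.coe_image_Ico_eq]; trivial
    obtain ⟨t, ht, rfl⟩ := hx
    rw [mkE_apply]
    have h := intervalIntegral.norm_integral_le_of_norm_le_const (a := 0) (b := t)
      (C := (1 + ‖avg‖) * ‖g‖) (f := fun s : ℝ => g (s : AddCircle (2 * Real.pi)) - avg g)
      (fun x _ => by
        refine (norm_sub_le _ _).trans ?_
        have h1 := g.norm_coe_le_norm (x : AddCircle (2 * Real.pi))
        have h2 := avg.le_opNorm g
        linarith)
    refine h.trans ?_
    rw [sub_zero, abs_of_nonneg ht.1]
    have := ht.2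
    rw [zero_add] at this
    have h3 : 0 ≤ (1 + ‖avg‖) * ‖g‖ := by positivity
    nlinarith

noncomputable def prim : CE →L[ℝ] CE := exists_prim.choose

lemma prim_apply (g : CE) (t : ℝ) : prim g (t : AddCircle (2 * Real.pi)) =
      ∫ s in (0 : ℝ)..t, (g (s : AddCircle (2 * Real.pi)) - avg g) :=
  exists_prim.choose_spec g t

lemma prim_hasDeriv (g : CE) (hg : avg g = 0) (t : ℝ) :
    HasDerivAt (fun t : ℝ => prim g (t : AddCircle (2 * Real.pi)))
      (g (t : AddCircle (2 * Real.pi))) t := by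
  have hc : Continuous (fun s : ℝ => g (s : AddCircle (2 * Real.pi)) - avg g) :=
    (CE_cont g).sub continuous_const
  have h := intervalIntegral.integral_hasDerivAt_right (hc.intervalIntegrable 0 t)
    (hc.stronglyMeasurableAtFilter _ _) hc.continuousAt
  simp only [prim_apply]
  simpa only [hg, sub_zero] using h

noncomputable def cosE : CE := mkE Real.cos Real.continuous_cos Real.cos_periodic
noncomputable def sinE : CE := mkE Real.sin Real.continuous_sin Real.sin_periodic
lemma cosE_apply (t : ℝ) : cosE (t : AddCircle (2 * Real.pi)) = Real.cos t := rfl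
lemma sinE_apply (t : ℝ) : sinE (t : AddCircle (2 * Real.pi)) = Real.sin t := rfl

/-- averages via antiderivatives -/
lemma avg_of_deriv (g : CE) (c : ℝ) (F : ℝ → ℝ)
    (hF : ∀ t : ℝ, HasDerivAt F (g (t : AddCircle (2 * Real.pi))) t)
    (h : F (2 * Real.pi) - F 0 = c * (2 * Real.pi)) : avg g = c := by
  rw [avg_apply, intervalIntegral.integral_eq_sub_of_hasDerivAt (fun t _ => hF t) (CE_int g _ _), h]
  have hp := Real.two_pi_pos
  field_simp

lemma avg_one : avg 1 = 1 :=
  avg_of_deriv _ _ (fun t => t) (fun t => hasDerivAt_id t) (by ring)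
lemma avg_cos : avg cosE = 0 :=
  avg_of_deriv _ _ Real.sin (fun t => Real.hasDerivAt_sin t) (by simp)
lemma avg_sin : avg sinE = 0 :=
  avg_of_deriv _ _ (fun t => -Real.cos t) (fun t => by
    refine (Real.hasDerivAt_cos t).neg.congr_deriv ?_
    simp [sinE_apply]) (by simp)
lemma avg_cos_sin : avg (cosE * sinE) = 0 :=
  avg_of_deriv _ _ (fun t => Real.sin t ^ 2 / 2) (fun t => by
    have := ((Real.hasDerivAt_sin t).pow 2).div_const 2
    refine this.congr_deriv ?_
    simp [cosE_apply, sinE_apply]; ring) (by simp)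
lemma avg_cos_sq : avg (cosE ^ 2) = 1 / 2 :=
  avg_of_deriv _ _ (fun t => (t + Real.sin t * Real.cos t) / 2) (fun t => by
    have := ((hasDerivAt_id t).add
      ((Real.hasDerivAt_sin t).mul (Real.hasDerivAt_cos t))).div_const 2
    refine this.congr_deriv ?_
    simp only [ContinuousMap.pow_apply, cosE_apply]
    linear_combination -(1/2) * Real.sin_sq_add_cos_sq t) (by simp)
lemma avg_sin_sq : avg (sinE ^ 2) = 1 / 2 :=
  avg_of_deriv _ _ (fun t => (t - Real.sin t * Real.cos t) / 2) (fun t => by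
    have := ((hasDerivAt_id t).sub
      ((Real.hasDerivAt_sin t).mul (Real.hasDerivAt_cos t))).div_const 2
    refine this.congr_deriv ?_
    simp only [ContinuousMap.pow_apply, sinE_apply]
    linear_combination -(1/2) * Real.sin_sq_add_cos_sq t) (by simp)
lemma avg_cos_cube : avg (cosE ^ 3) = 0 :=
  avg_of_deriv _ _ (fun t => Real.sin t - Real.sin t ^ 3 / 3) (fun t => by
    have := (Real.hasDerivAt_sin t).sub (((Real.hasDerivAt_sin t).pow 3).div_const 3)
    refine this.congr_deriv ?_
    simp only [ContinuousMap.pow_apply, cosE_apply]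
    push_cast
    linear_combination -Real.cos t * Real.sin_sq_add_cos_sq t) (by simp)
lemma avg_cos_sq_sin : avg (cosE ^ 2 * sinE) = 0 :=
  avg_of_deriv _ _ (fun t => -(Real.cos t ^ 3 / 3)) (fun t => by
    have := (((Real.hasDerivAt_cos t).pow 3).div_const 3).neg
    refine this.congr_deriv ?_
    simp only [ContinuousMap.pow_apply, ContinuousMap.mul_apply, cosE_apply, sinE_apply]
    push_cast
    ring) (by simp)

structure FPar where
  (d w a1 a2 b1 b2 c1 c2 β : ℝ)

section
variable {R : Type*} [CommRing R] [Algebra ℝ R]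

noncomputable def gG (Q : FPar) (ε : ℝ) (ξ η M : R) : R :=
  (Q.a1 + ε * Q.a2) • (ξ + M) + ((Q.c1 + ε * Q.c2) * Q.w) • η
    - (1 - 1 / Q.d + ε * (Q.a1 + ε * Q.a2)) • ((ξ + M) * (ξ + M))
    + ε • ((ξ + M) * (ξ + M) * (ξ + M))

noncomputable def hG (Q : FPar) (ε : ℝ) (ξ η M : R) : R :=
  ((Q.b1 + ε * Q.b2) * (Q.d * Q.w)) • (Q.w • ξ + (Q.d * Q.β) • η) + (Q.d * Q.β) • gG Q ε ξ η M

noncomputable def F1 (Q : FPar) (ε σ : ℝ) (ξ η M : R) : R :=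
  σ • η - ((1 + ε * σ) * (Q.w ^ 3)⁻¹) • hG Q ε ξ η M
noncomputable def F2 (Q : FPar) (ε σ : ℝ) (ξ η M : R) : R :=
  -(σ • ξ) + ((1 + ε * σ) * (Q.w ^ 2)⁻¹) • gG Q ε ξ η M
noncomputable def F3 (Q : FPar) (ε σ : ℝ) (ξ η M : R) : R :=
  ((1 + ε * σ) * (Q.w ^ 3)⁻¹) • hG Q ε ξ η M
end

lemma gG_apply (Q : FPar) (ε : ℝ) (ξ η M : CE) (t) :
    (gG Q ε ξ η M) t = gG Q ε (ξ t) (η t) (M t) := by simp [gG]; ring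
lemma hG_apply (Q : FPar) (ε : ℝ) (ξ η M : CE) (t) :
    (hG Q ε ξ η M) t = hG Q ε (ξ t) (η t) (M t) := by simp [hG, gG_apply]; ring
lemma F1_apply (Q : FPar) (ε σ : ℝ) (ξ η M : CE) (t) :
    (F1 Q ε σ ξ η M) t = F1 Q ε σ (ξ t) (η t) (M t) := by simp [F1, hG_apply]
lemma F2_apply (Q : FPar) (ε σ : ℝ) (ξ η M : CE) (t) :
    (F2 Q ε σ ξ η M) t = F2 Q ε σ (ξ t) (η t) (M t) := by simp [F2, gG_apply]
lemma F3_apply (Q : FPar) (ε σ : ℝ) (ξ η M : CE) (t) :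
    (F3 Q ε σ ξ η M) t = F3 Q ε σ (ξ t) (η t) (M t) := by simp [F3, hG_apply]

abbrev VV := CE × CE × CE
abbrev PP := ℝ × ℝ × ℝ

noncomputable def xiE (v : VV) : CE := v.1 * cosE + v.2.1 * sinE
noncomputable def etaE (v : VV) : CE := v.2.1 * cosE - v.1 * sinE

noncomputable def GG (Q : FPar) (x : ℝ × VV × PP) : VV :=
  (cosE * F1 Q x.1 x.2.2.2.2 (xiE x.2.1) (etaE x.2.1) x.2.1.2.2
    - sinE * F2 Q x.1 x.2.2.2.2 (xiE x.2.1) (etaE x.2.1) x.2.1.2.2,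
   sinE * F1 Q x.1 x.2.2.2.2 (xiE x.2.1) (etaE x.2.1) x.2.1.2.2
    + cosE * F2 Q x.1 x.2.2.2.2 (xiE x.2.1) (etaE x.2.1) x.2.1.2.2,
   F3 Q x.1 x.2.2.2.2 (xiE x.2.1) (etaE x.2.1) x.2.1.2.2)

lemma GG_contDiff (Q : FPar) : ContDiff ℝ 1 (GG Q) := by
  have hxi : ContDiff ℝ 1 (fun x : ℝ × VV × PP => xiE x.2.1) := by unfold xiE; fun_prop
  have heta : ContDiff ℝ 1 (fun x : ℝ × VV × PP => etaE x.2.1) := by unfold etaE; fun_prop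
  have hg : ContDiff ℝ 1 (fun x : ℝ × VV × PP =>
      gG Q x.1 (xiE x.2.1) (etaE x.2.1) x.2.1.2.2) := by unfold gG; fun_prop
  have hh : ContDiff ℝ 1 (fun x : ℝ × VV × PP =>
      hG Q x.1 (xiE x.2.1) (etaE x.2.1) x.2.1.2.2) := by unfold hG; fun_prop
  have h1 : ContDiff ℝ 1 (fun x : ℝ × VV × PP =>
      F1 Q x.1 x.2.2.2.2 (xiE x.2.1) (etaE x.2.1) x.2.1.2.2) := by unfold F1; fun_prop
  have h2 : ContDiff ℝ 1 (fun x : ℝ × VV × PP =>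
      F2 Q x.1 x.2.2.2.2 (xiE x.2.1) (etaE x.2.1) x.2.1.2.2) := by unfold F2; fun_prop
  have h3 : ContDiff ℝ 1 (fun x : ℝ × VV × PP =>
      F3 Q x.1 x.2.2.2.2 (xiE x.2.1) (etaE x.2.1) x.2.1.2.2) := by unfold F3; fun_prop
  unfold GG
  fun_prop

noncomputable def iotaE : PP →L[ℝ] VV :=
  ((ContinuousLinearMap.fst ℝ ℝ (ℝ × ℝ)).smulRight (1 : CE)).prod
    ((0 : PP →L[ℝ] CE).prod
      (((ContinuousLinearMap.fst ℝ ℝ ℝ) ∘L (ContinuousLinearMap.snd ℝ ℝ (ℝ × ℝ))).smulRight (1 : CE)))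

lemma iotaE_apply (p : PP) : iotaE p = (p.1 • (1 : CE), 0, p.2.1 • (1 : CE)) := by
  simp [iotaE]

noncomputable def trigE (u0 uC uS uCC : ℝ) : CE :=
  u0 • (1 : CE) + uC • cosE + uS • sinE + uCC • cosE ^ 2

lemma avg_trig (u0 uC uS uCC : ℝ) : avg (trigE u0 uC uS uCC) = u0 + uCC / 2 := by
  simp only [trigE, map_add, map_smul, avg_one, avg_cos, avg_sin, avg_cos_sq, smul_eq_mul]
  ring

lemma avg_cos_trig (u0 uC uS uCC : ℝ) : avg (cosE * trigE u0 uC uS uCC) = uC / 2 := by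
  have : cosE * trigE u0 uC uS uCC =
      u0 • cosE + uC • cosE ^ 2 + uS • (cosE * sinE) + uCC • cosE ^ 3 := by
    ext t; simp [trigE]; ring
  rw [this]
  simp only [map_add, map_smul, avg_cos_sin, avg_cos, avg_cos_cube, avg_cos_sq, smul_eq_mul]
  ring

lemma avg_sin_trig (u0 uC uS uCC : ℝ) : avg (sinE * trigE u0 uC uS uCC) = uS / 2 := by
  have : sinE * trigE u0 uC uS uCC =
      u0 • sinE + uC • (cosE * sinE) + uS • sinE ^ 2 + uCC • (cosE ^ 2 * sinE) := by
    ext t; simp [trigE]; ring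
  rw [this]
  simp only [map_add, map_smul, avg_cos_sin, avg_sin, avg_cos_sq_sin, avg_sin_sq, smul_eq_mul]
  ring

noncomputable def BB (Q : FPar) (x : ℝ × VV × PP) : PP :=
  (avg (GG Q x).1, avg (GG Q x).2.1, avg (GG Q x).2.2)

noncomputable def ΓΓ (Q : FPar) (x : ℝ × VV × PP) : VV :=
  (prim (GG Q x).1, prim (GG Q x).2.1, prim (GG Q x).2.2)

lemma BB_contDiff (Q : FPar) : ContDiff ℝ 1 (BB Q) := by
  have := GG_contDiff Q
  exact (avg.contDiff.comp (contDiff_fst.comp this)).prodMk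
    ((avg.contDiff.comp (contDiff_fst.comp (contDiff_snd.comp this))).prodMk
      (avg.contDiff.comp (contDiff_snd.comp (contDiff_snd.comp this))))

lemma ΓΓ_contDiff (Q : FPar) : ContDiff ℝ 1 (ΓΓ Q) := by
  have := GG_contDiff Q
  exact (prim.contDiff.comp (contDiff_fst.comp this)).prodMk
    ((prim.contDiff.comp (contDiff_fst.comp (contDiff_snd.comp this))).prodMk
      (prim.contDiff.comp (contDiff_snd.comp (contDiff_snd.comp this))))

noncomputable def kk (Q : FPar) : ℝ := 1 - 1 / Q.d
noncomputable def A1 (Q : FPar) : ℝ :=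
  -(Q.d * Q.β * Q.a1 + Q.b1 * Q.d * Q.w ^ 2) / (2 * Q.w ^ 3) + Q.c1 / (2 * Q.w)
noncomputable def A2 (Q : FPar) : ℝ := Q.d * Q.β * kk Q / Q.w ^ 3
noncomputable def A3 (Q : FPar) : ℝ := (Q.d * Q.β * (Q.c1 + Q.d * Q.b1) + Q.a1) / (2 * Q.w ^ 2)
noncomputable def A4 (Q : FPar) : ℝ := - kk Q / Q.w ^ 2
noncomputable def A5 (Q : FPar) : ℝ := Q.d * Q.β / Q.w ^ 3

lemma BB_zero (Q : FPar) (hw : Q.w ≠ 0) (p : PP) : BB Q (0, iotaE p, p) =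
    (p.1 * (A1 Q + A2 Q * p.2.1), p.1 * (-p.2.2 + A3 Q + A4 Q * p.2.1),
     A5 Q * (Q.a1 * p.2.1 - kk Q * p.2.1 ^ 2 - kk Q * p.1 ^ 2 / 2)) := by
  obtain ⟨r, m, σ⟩ := p
  have hg : gG Q 0 (xiE (iotaE (r, m, σ))) (etaE (iotaE (r, m, σ))) (iotaE (r, m, σ)).2.2 =
      trigE (Q.a1 * m - kk Q * m ^ 2) (Q.a1 * r - 2 * kk Q * r * m) (-(Q.c1 * Q.w * r))
        (-(kk Q * r ^ 2)) := by
    ext t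
    simp [gG, trigE, xiE, etaE, iotaE_apply, kk]; ring
  have hh : hG Q 0 (xiE (iotaE (r, m, σ))) (etaE (iotaE (r, m, σ))) (iotaE (r, m, σ)).2.2 =
      trigE (Q.d * Q.β * (Q.a1 * m - kk Q * m ^ 2))
        (Q.d * Q.β * (Q.a1 * r - 2 * kk Q * r * m) + Q.b1 * Q.d * Q.w ^ 2 * r)
        (Q.d * Q.β * (-(Q.c1 * Q.w * r)) - Q.b1 * Q.d ^ 2 * Q.β * Q.w * r)
        (Q.d * Q.β * (-(kk Q * r ^ 2))) := by
    rw [hG, hg]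
    ext t
    simp [trigE, xiE, etaE, iotaE_apply, kk]; ring
  have hξ : xiE (iotaE (r, m, σ)) = r • cosE := by
    ext t; simp [xiE, iotaE_apply]
  have hη : etaE (iotaE (r, m, σ)) = -(r • sinE) := by
    ext t; simp [etaE, iotaE_apply]
  have e1 : ∀ g h : CE, avg (cosE * (σ • -(r • sinE) - (Q.w ^ 3)⁻¹ • h)
      - sinE * (-(σ • r • cosE) + (Q.w ^ 2)⁻¹ • g)) =
      -(Q.w ^ 3)⁻¹ * avg (cosE * h) - (Q.w ^ 2)⁻¹ * avg (sinE * g) := by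
    intro g h
    have : cosE * (σ • -(r • sinE) - (Q.w ^ 3)⁻¹ • h)
      - sinE * (-(σ • r • cosE) + (Q.w ^ 2)⁻¹ • g) =
      (-(Q.w ^ 3)⁻¹) • (cosE * h) - (Q.w ^ 2)⁻¹ • (sinE * g) := by
      ext t; simp; ring
    rw [this]
    simp only [map_sub, map_smul, smul_eq_mul]
  have e2 : ∀ g h : CE, avg (sinE * (σ • -(r • sinE) - (Q.w ^ 3)⁻¹ • h)
      + cosE * (-(σ • r • cosE) + (Q.w ^ 2)⁻¹ • g)) =
      -(σ * r) * (avg (sinE ^ 2) + avg (cosE ^ 2))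
      -(Q.w ^ 3)⁻¹ * avg (sinE * h) + (Q.w ^ 2)⁻¹ * avg (cosE * g) := by
    intro g h
    have : sinE * (σ • -(r • sinE) - (Q.w ^ 3)⁻¹ • h)
      + cosE * (-(σ • r • cosE) + (Q.w ^ 2)⁻¹ • g) =
      (-(σ * r)) • (sinE ^ 2 + cosE ^ 2) - (Q.w ^ 3)⁻¹ • (sinE * h)
        + (Q.w ^ 2)⁻¹ • (cosE * g) := by
      ext t; simp; ring
    rw [this]
    simp only [map_add, map_sub, map_smul, smul_eq_mul]
  simp only [BB, GG, F1, F2, F3, hg, hh, zero_mul, add_zero, one_mul]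
  rw [hξ, hη, e1, e2]
  simp only [map_smul, avg_trig, avg_cos_trig, avg_sin_trig, avg_cos_sq, avg_sin_sq, smul_eq_mul,
    A1, A2, A3, A4, A5]
  refine Prod.ext ?_ (Prod.ext ?_ ?_)
  · simp only; field_simp; ring
  · simp only; field_simp; ring
  · simp only; field_simp; ring

lemma deriv_equiv (a1 k A1 A2 A3 A4 A5 r m σ : ℝ) (hr : r ≠ 0) (hk : k ≠ 0) (hA2 : A2 ≠ 0)
    (hA5 : A5 ≠ 0) (h1 : A1 + A2 * m = 0) (h2 : σ = A3 + A4 * m) :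
    ∃ f' : PP ≃L[ℝ] PP, HasFDerivAt (fun p : PP =>
      ((p.1 * (A1 + A2 * p.2.1), p.1 * (-p.2.2 + A3 + A4 * p.2.1),
       A5 * (a1 * p.2.1 - k * p.2.1 ^ 2 - k * p.1 ^ 2 / 2)) : PP)) (f' : PP →L[ℝ] PP) (r, m, σ) := by
  set f : PP → PP := fun p : PP =>
      ((p.1 * (A1 + A2 * p.2.1), p.1 * (-p.2.2 + A3 + A4 * p.2.1),
       A5 * (a1 * p.2.1 - k * p.2.1 ^ 2 - k * p.1 ^ 2 / 2)) : PP) with hf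
  have x1 : HasFDerivAt (fun p : PP => p.1) (ContinuousLinearMap.fst ℝ ℝ (ℝ × ℝ)) (r, m, σ) :=
    hasFDerivAt_fst
  have x23 : HasFDerivAt (fun p : PP => p.2) (ContinuousLinearMap.snd ℝ ℝ (ℝ × ℝ)) (r, m, σ) :=
    hasFDerivAt_snd
  have x2 := x23.fst
  have x3 := x23.snd
  have d1 := x1.mul ((x2.const_mul A2).const_add A1)
  have d2 := x1.mul ((x3.neg.add_const A3).add (x2.const_mul A4))
  have d3 := (((x2.const_mul a1).sub ((x2.pow 2).const_mul k)).sub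
    (((x1.pow 2).const_mul k).mul_const (1/2))).const_mul A5
  have dd := d1.prodMk (d2.prodMk d3)
  set q1 : PP →L[ℝ] ℝ := ContinuousLinearMap.fst ℝ ℝ (ℝ × ℝ) with hq1
  set q2 : PP →L[ℝ] ℝ := (ContinuousLinearMap.fst ℝ ℝ ℝ) ∘L (ContinuousLinearMap.snd ℝ ℝ (ℝ × ℝ))
    with hq2
  set q3 : PP →L[ℝ] ℝ := (ContinuousLinearMap.snd ℝ ℝ ℝ) ∘L (ContinuousLinearMap.snd ℝ ℝ (ℝ × ℝ))
    with hq3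
  set Lm : PP →L[ℝ] PP := ((r * A2) • q2).prod ((r • (A4 • q2 - q3)).prod
    (A5 • ((a1 - 2 * k * m) • q2 - (k * r) • q1))) with hLm
  have hL : ∀ x y z : ℝ, Lm (x, y, z) = (r * A2 * y, r * (A4 * y - z),
      A5 * ((a1 - 2 * k * m) * y - k * r * x)) := by
    intro x y z
    simp [hLm, hq1, hq2, hq3]
  have hinj : Function.Injective (Lm : PP →ₗ[ℝ] PP) := by
    rw [injective_iff_map_eq_zero]
    rintro ⟨x, y, z⟩ h
    rw [ContinuousLinearMap.coe_coe, hL] at h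
    simp only [Prod.mk_eq_zero, mul_eq_zero, hr, hA2, hA5, false_or] at h
    obtain ⟨hy, hz, hx⟩ := h
    subst hy
    simp only [mul_zero, zero_sub, neg_eq_zero, mul_eq_zero, hk, hr, false_or] at hz hx
    simp [hz, hx]
  refine ⟨(LinearEquiv.ofInjectiveEndo (Lm : PP →ₗ[ℝ] PP) hinj).toContinuousLinearEquiv, ?_⟩
  have : ((LinearEquiv.ofInjectiveEndo (Lm : PP →ₗ[ℝ] PP) hinj).toContinuousLinearEquiv :
      PP →L[ℝ] PP) = Lm := by
    apply ContinuousLinearMap.ext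
    intro x
    simp
  rw [this]
  have hff : f = fun p : PP => ((p.1 * (A1 + A2 * p.2.1), p.1 * (-p.2.2 + A3 + A4 * p.2.1),
       A5 * (a1 * p.2.1 - k * p.2.1 ^ 2 - k * p.1 ^ 2 * (1 / 2))) : PP) := by
    funext p; simp only [hf]; congr 3; ring
  rw [hff]
  refine dd.congr_fderiv ?_
  apply ContinuousLinearMap.ext
  rintro ⟨x, y, z⟩
  rw [hL]
  refine Prod.ext ?_ (Prod.ext ?_ ?_)
  · simp [hq1, hq2]; linear_combination x * h1
  · simp [hq1, hq2, hq3]; linear_combination x * (-h2)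
  · simp [hq1, hq2]; left; ring

lemma exists_zero (Q : FPar) (hd : 0 < Q.d) (hw : 0 < Q.w) (hβ : 0 < Q.β) (hk : kk Q ≠ 0)
    (hrel : Q.d ^ 3 * Q.β ^ 2 = 1 - Q.d * Q.w ^ 2)
    (hl : Q.w ^ 4 * Q.d * (Q.d * Q.b1 - Q.c1) ^ 2 < Q.a1 ^ 2 * (1 - Q.d * Q.w ^ 2)) :
    ∃ r m : ℝ, 0 < r ∧ A1 Q + A2 Q * m = 0 ∧
      Q.a1 * m - kk Q * m ^ 2 - kk Q * r ^ 2 / 2 = 0 := by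
  obtain ⟨s, hs⟩ : ∃ s, s = Q.w ^ 2 * (Q.d * Q.b1 - Q.c1) / (Q.d * Q.β) := ⟨_, rfl⟩
  have hs1 : Q.d * Q.β * s = Q.w ^ 2 * (Q.d * Q.b1 - Q.c1) := by rw [hs]; field_simp
  have hs2 : 0 < Q.a1 ^ 2 - s ^ 2 := by
    have h1 : 0 < Q.d ^ 3 * Q.β ^ 2 := by positivity
    have h2 : 0 < Q.d ^ 3 * Q.β ^ 2 * (Q.a1 ^ 2 - s ^ 2) := by
      have : Q.d ^ 3 * Q.β ^ 2 * (Q.a1 ^ 2 - s ^ 2) =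
          Q.a1 ^ 2 * (1 - Q.d * Q.w ^ 2) - Q.w ^ 4 * Q.d * (Q.d * Q.b1 - Q.c1) ^ 2 := by
        linear_combination Q.a1 ^ 2 * hrel -
          Q.d * (Q.d * Q.β * s + Q.w ^ 2 * (Q.d * Q.b1 - Q.c1)) * hs1
      linarith
    exact (pos_iff_pos_of_mul_pos h2).mp h1
  have hq : 0 < (Q.a1 ^ 2 - s ^ 2) / (2 * kk Q ^ 2) := by positivity
  refine ⟨√((Q.a1 ^ 2 - s ^ 2) / (2 * kk Q ^ 2)), (Q.a1 + s) / (2 * kk Q), Real.sqrt_pos.mpr hq,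
    ?_, ?_⟩
  · have hb : Q.β = Q.β := rfl
    have : A1 Q + A2 Q * ((Q.a1 + s) / (2 * kk Q)) =
        (Q.d * Q.β * s - Q.w ^ 2 * (Q.d * Q.b1 - Q.c1)) / (2 * Q.w ^ 3) := by
      unfold A1 A2
      field_simp
      ring
    rw [this, hs1]; simp
  · rw [Real.sq_sqrt hq.le]
    field_simp
    ring

lemma ode_check (Q : FPar) (hd : 0 < Q.d) (hw : 0 < Q.w)
    (hrel : Q.d ^ 3 * Q.β ^ 2 = 1 - Q.d * Q.w ^ 2) (ε σ ν a b c : ℝ)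
    (ha : a = -1 / Q.d + ε * Q.a1 + ε ^ 2 * Q.a2)
    (hb : b = Q.β + ε * Q.b1 + ε ^ 2 * Q.b2)
    (hc : c = Q.d * Q.β + ε * Q.c1 + ε ^ 2 * Q.c2)
    (hν : ν * (1 + ε * σ) = Q.w)
    (ξ η M : ℝ → ℝ)
    (hξ : ∀ t, HasDerivAt ξ (η t + ε * F1 Q ε σ (ξ t) (η t) (M t)) t)
    (hη : ∀ t, HasDerivAt η (-ξ t + ε * F2 Q ε σ (ξ t) (η t) (M t)) t)
    (hM : ∀ t, HasDerivAt M (ε * F3 Q ε σ (ξ t) (η t) (M t)) t)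
    (φ : ℝ → ℝ × ℝ × ℝ)
    (hφ : φ = fun t => (ε * (ξ (ν * t) + M (ν * t)),
      ε * (M (ν * t) / Q.d + Q.d ^ 2 * Q.β ^ 2 * ξ (ν * t) - Q.d * Q.β * Q.w * η (ν * t)),
      ε * (Q.w * η (ν * t)))) (t : ℝ) :
    HasDerivAt φ
          ((φ t).2.2,
           b * ((φ t).1 - Q.d * (φ t).2.1),
           ((φ t).1 - a) * ((φ t).1 - 1) * (φ t).1 + (φ t).2.1 + c * (φ t).2.2) t := by
  have hlin : HasDerivAt (fun t : ℝ => ν * t) ν t := by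
    simpa using (hasDerivAt_id t).const_mul ν
  have dξ := (hξ (ν * t)).comp t hlin
  have dη := (hη (ν * t)).comp t hlin
  have dM := (hM (ν * t)).comp t hlin
  set x := ξ (ν * t) with hx
  set y := η (ν * t) with hy
  set m := M (ν * t) with hm
  obtain ⟨g, hg⟩ : ∃ g, g = gG Q ε x y m := ⟨_, rfl⟩
  obtain ⟨h, hh⟩ : ∃ h, h = hG Q ε x y m := ⟨_, rfl⟩
  have eξ : (y + ε * F1 Q ε σ x y m) * ν = Q.w * y - ε * h / Q.w ^ 2 := by
    have : F1 Q ε σ x y m = σ * y - (1 + ε * σ) * (Q.w ^ 3)⁻¹ * h := by rw [hh]; rfl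
    rw [this]
    have e : Q.w * y - ε * h / Q.w ^ 2 = Q.w * (y - ε * (Q.w ^ 3)⁻¹ * h) := by field_simp
    rw [e]
    linear_combination (y - ε * (Q.w ^ 3)⁻¹ * h) * hν
  have eη : (-x + ε * F2 Q ε σ x y m) * ν = -Q.w * x + ε * g / Q.w := by
    have : F2 Q ε σ x y m = -(σ * x) + (1 + ε * σ) * (Q.w ^ 2)⁻¹ * g := by rw [hg]; rfl
    rw [this]
    have e : -Q.w * x + ε * g / Q.w = Q.w * (-x + ε * (Q.w ^ 2)⁻¹ * g) := by field_simp
    rw [e]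
    linear_combination (-x + ε * (Q.w ^ 2)⁻¹ * g) * hν
  have eM : (ε * F3 Q ε σ x y m) * ν = ε * h / Q.w ^ 2 := by
    have : F3 Q ε σ x y m = (1 + ε * σ) * (Q.w ^ 3)⁻¹ * h := by rw [hh]; rfl
    rw [this]
    have e : ε * h / Q.w ^ 2 = Q.w * (ε * (Q.w ^ 3)⁻¹ * h) := by field_simp
    rw [e]
    linear_combination (ε * (Q.w ^ 3)⁻¹ * h) * hν
  rw [eξ] at dξ
  rw [eη] at dη
  rw [eM] at dM
  have hhg : h = ((Q.b1 + ε * Q.b2) * (Q.d * Q.w)) * (Q.w * x + (Q.d * Q.β) * y)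
      + (Q.d * Q.β) * g := by rw [hh, hg]; simp [hG]
  have c1 := (dξ.add dM).const_mul ε
  have c2 := (((dM.div_const Q.d).add (dξ.const_mul (Q.d ^ 2 * Q.β ^ 2))).sub
    (dη.const_mul (Q.d * Q.β * Q.w))).const_mul ε
  have c3 := (dη.const_mul Q.w).const_mul ε
  have cc := c1.prodMk (c2.prodMk c3)
  have hφt : φ t = (ε * (x + m),
      ε * (m / Q.d + Q.d ^ 2 * Q.β ^ 2 * x - Q.d * Q.β * Q.w * y), ε * (Q.w * y)) := by
    rw [hφ]
  rw [hφt]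
  have hβ2 : Q.d ^ 2 * Q.β ^ 2 = 1 / Q.d - Q.w ^ 2 := by
    field_simp; linear_combination hrel
  refine (hφ ▸ cc).congr_deriv ?_
  refine Prod.ext ?_ (Prod.ext ?_ ?_)
  · simp only; ring
  · simp only
    rw [hβ2, hhg, hb]
    field_simp
    linear_combination (-(ε * Q.w ^ 3 * y)) * hrel
  · simp only
    rw [hβ2, hg, ha, hc]
    simp only [gG, smul_eq_mul]
    field_simp
    ring

lemma CE_bound {g : CE} {R : ℝ} (h : ‖g‖ ≤ R) (t : AddCircle (2 * Real.pi)) : |g t| ≤ R :=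
  (g.norm_coe_le_norm t).trans h

lemma abs_trig_le {p q R θ : ℝ} (hp : |p| ≤ R) (hq : |q| ≤ R) :
    |p * Real.cos θ + q * Real.sin θ| ≤ 2 * R := by
  have h1 : |p * Real.cos θ| ≤ R := by
    rw [abs_mul]
    exact (mul_le_of_le_one_right (abs_nonneg _) (Real.abs_cos_le_one θ)).trans hp
  have h2 : |q * Real.sin θ| ≤ R := by
    rw [abs_mul]
    exact (mul_le_of_le_one_right (abs_nonneg _) (Real.abs_sin_le_one θ)).trans hq
  have := abs_add_le (p * Real.cos θ) (q * Real.sin θ)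
  linarith

theorem fhn_core (Q : FPar) (hd : 0 < Q.d) (hw : 0 < Q.w) (hβ : 0 < Q.β) (hk : kk Q ≠ 0)
    (hrel : Q.d ^ 3 * Q.β ^ 2 = 1 - Q.d * Q.w ^ 2)
    (hl : Q.w ^ 4 * Q.d * (Q.d * Q.b1 - Q.c1) ^ 2 < Q.a1 ^ 2 * (1 - Q.d * Q.w ^ 2))
    (a b c : ℝ → ℝ)
    (ha : ∀ ε, a ε = -1 / Q.d + ε * Q.a1 + ε ^ 2 * Q.a2)
    (hb : ∀ ε, b ε = Q.β + ε * Q.b1 + ε ^ 2 * Q.b2)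
    (hc : ∀ ε, c ε = Q.d * Q.β + ε * Q.c1 + ε ^ 2 * Q.c2) :
    ∀ δ > 0, ∃ ε₀ > 0, ∀ ε : ℝ, 0 < |ε| → |ε| < ε₀ →
      ∃ (φ : ℝ → ℝ × ℝ × ℝ) (T : ℝ), 0 < T ∧
        (∀ t, HasDerivAt φ
          ((φ t).2.2,
           b ε * ((φ t).1 - Q.d * (φ t).2.1),
           ((φ t).1 - a ε) * ((φ t).1 - 1) * (φ t).1 + (φ t).2.1 + c ε * (φ t).2.2) t) ∧
        (∀ t, φ (t + T) = φ t) ∧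
        (∃ t s, φ t ≠ φ s) ∧
        (∀ t, ‖φ t‖ < δ) := by
  intro δ hδ
  obtain ⟨r, m, hr, hz1, hz3⟩ := exists_zero Q hd hw hβ hk hrel hl
  have hA2 : A2 Q ≠ 0 := by
    unfold A2; exact div_ne_zero (mul_ne_zero (by positivity) hk) (by positivity)
  have hA5 : A5 Q ≠ 0 := by unfold A5; positivity
  obtain ⟨σ₀, hσ₀⟩ : ∃ σ, σ = A3 Q + A4 Q * m := ⟨_, rfl⟩
  obtain ⟨f', hf'⟩ := deriv_equiv Q.a1 (kk Q) (A1 Q) (A2 Q) (A3 Q) (A4 Q) (A5 Q) r m σ₀ hr.ne' hk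
    hA2 hA5 hz1 hσ₀
  have hBB : (fun p => BB Q (0, iotaE p, p)) = _ := funext (BB_zero Q hw.ne')
  rw [← hBB] at hf'
  have h0 : BB Q (0, iotaE (r, m, σ₀), (r, m, σ₀)) = 0 := by
    rw [BB_zero Q hw.ne']
    refine Prod.ext ?_ (Prod.ext ?_ ?_)
    · simp only [hz1]; simp
    · simp only [hσ₀]; simp
    · simp only [hz3]; simp
  obtain ⟨R, hR⟩ : ∃ R, R = ‖((iotaE (r, m, σ₀), (r, m, σ₀)) : VV × PP)‖ + r / 2 := ⟨_, rfl⟩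
  have hR0 : 0 < R := by
    rw [hR]; positivity
  have hev := abstract_bif (ΓΓ Q) (BB Q) iotaE (r, m, σ₀) (ΓΓ_contDiff Q) (BB_contDiff Q) f' hf' h0
    (Metric.ball _ (r / 2)) (Metric.ball_mem_nhds _ (by positivity))
  obtain ⟨CC, hCC⟩ : ∃ CC, CC = 3 * R + 2 * Q.w * R +
    (R / Q.d + Q.d ^ 2 * Q.β ^ 2 * (2 * R) + Q.d * Q.β * Q.w * (2 * R)) := ⟨_, rfl⟩
  have hCC0 : 0 < CC := by rw [hCC]; positivity
  obtain ⟨ε₁, hε₁, hball⟩ := Metric.eventually_nhds_iff.mp hev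
  refine ⟨min ε₁ (min (δ / CC) (1 / R)), by positivity, fun ε hεpos hε => ?_⟩
  have hε1 : |ε| < ε₁ := hε.trans_le (min_le_left _ _)
  have hε2 : |ε| * CC < δ := by
    rw [← lt_div_iff₀ hCC0]
    exact hε.trans_le ((min_le_right _ _).trans (min_le_left _ _))
  have hε3 : |ε| * R < 1 := by
    rw [← lt_div_iff₀ hR0]
    exact hε.trans_le ((min_le_right _ _).trans (min_le_right _ _))
  obtain ⟨⟨P, S, M⟩, ⟨r', m', σ⟩, hU, hv, hB⟩ := hball (y := ε) (by simpa using hε1)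
  have hnorm : ‖((P, S, M), (r', m', σ))‖ ≤ R := by
    rw [hR]
    have h1 := norm_sub_norm_le (((P, S, M), (r', m', σ)) : VV × PP)
      (iotaE (r, m, σ₀), (r, m, σ₀))
    rw [Metric.mem_ball, dist_eq_norm] at hU
    linarith
  simp only [Prod.norm_def, max_le_iff] at hnorm
  obtain ⟨⟨hPR, hSR, hMR⟩, -, -, hσR⟩ := hnorm
  have hPr : ∀ t, 0 < P t := by
    intro t
    rw [Metric.mem_ball, dist_eq_norm, iotaE_apply] at hU
    simp only [Prod.norm_def, Prod.fst_sub, Prod.snd_sub, max_lt_iff] at hU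
    have h1 := (P - r • (1 : CE)).norm_coe_le_norm t
    have h2 := hU.1.1
    have h3 := h1.trans_lt h2
    simp only [ContinuousMap.sub_apply, ContinuousMap.smul_apply, ContinuousMap.one_apply,
      smul_eq_mul, mul_one, Real.norm_eq_abs] at h3
    have := (abs_lt.mp h3).1
    linarith
  set x : ℝ × VV × PP := (ε, (P, S, M), (r', m', σ)) with hx
  simp only [BB, Prod.mk_eq_zero] at hB
  obtain ⟨hB1, hB2, hB3⟩ := hB
  rw [iotaE_apply] at hv
  simp only [ΓΓ, Prod.smul_mk, Prod.mk_add_mk, Prod.mk.injEq] at hv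
  obtain ⟨hv1, hv2, hv3⟩ := hv
  have der : ∀ (V G : CE) (c₀ : ℝ), avg G = 0 → V = c₀ • (1 : CE) + ε • prim G → ∀ t : ℝ,
      HasDerivAt (fun t : ℝ => V (t : AddCircle (2 * Real.pi)))
        (ε * G (t : AddCircle (2 * Real.pi))) t := by
    intro V G c₀ hG hV t
    have e : (fun t : ℝ => V (t : AddCircle (2 * Real.pi))) =
        fun t : ℝ => c₀ + ε * prim G (t : AddCircle (2 * Real.pi)) := by
      funext t; conv_lhs => rw [hV]
      simp
    rw [e]
    exact ((prim_hasDeriv G hG t).const_mul ε).const_add c₀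
  have dP := der P _ r' hB1 hv1
  have dS := der S _ 0 hB2 (by rw [zero_smul]; exact hv2)
  have dM := der M _ m' hB3 hv3
  -- the functions
  set p : ℝ → ℝ := fun t => P (t : AddCircle (2 * Real.pi)) with hp
  set q : ℝ → ℝ := fun t => S (t : AddCircle (2 * Real.pi)) with hq
  set M' : ℝ → ℝ := fun t => M (t : AddCircle (2 * Real.pi)) with hM'
  set ξ : ℝ → ℝ := fun t => p t * Real.cos t + q t * Real.sin t with hξ
  set η : ℝ → ℝ := fun t => q t * Real.cos t + (-p t) * Real.sin t with hη
  have exi : ∀ t : ℝ, xiE (P, S, M) (t : AddCircle (2 * Real.pi)) = ξ t := by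
    intro t; simp [xiE, hξ, hp, hq, cosE_apply, sinE_apply]
  have eeta : ∀ t : ℝ, etaE (P, S, M) (t : AddCircle (2 * Real.pi)) = η t := by
    intro t; simp [etaE, hη, hp, hq, cosE_apply, sinE_apply]; ring
  have dP' : ∀ t, HasDerivAt p (ε * (Real.cos t * F1 Q ε σ (ξ t) (η t) (M' t)
      - Real.sin t * F2 Q ε σ (ξ t) (η t) (M' t))) t := by
    intro t
    have := dP t
    simpa only [GG, hx, ContinuousMap.sub_apply, ContinuousMap.mul_apply, F1_apply, F2_apply, exi,
      eeta, cosE_apply, sinE_apply] using this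
  have dS' : ∀ t, HasDerivAt q (ε * (Real.sin t * F1 Q ε σ (ξ t) (η t) (M' t)
      + Real.cos t * F2 Q ε σ (ξ t) (η t) (M' t))) t := by
    intro t
    have := dS t
    simpa only [GG, hx, ContinuousMap.add_apply, ContinuousMap.mul_apply, F1_apply, F2_apply, exi,
      eeta, cosE_apply, sinE_apply] using this
  have dM' : ∀ t, HasDerivAt M' (ε * F3 Q ε σ (ξ t) (η t) (M' t)) t := by
    intro t
    have := dM t
    simpa only [GG, hx, F3_apply, exi, eeta] using this
  have dξ : ∀ t, HasDerivAt ξ (η t + ε * F1 Q ε σ (ξ t) (η t) (M' t)) t := by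
    intro t
    refine (((dP' t).mul (Real.hasDerivAt_cos t)).add
      ((dS' t).mul (Real.hasDerivAt_sin t))).congr_deriv ?_
    have := Real.sin_sq_add_cos_sq t
    have e : η t = q t * Real.cos t + (-p t) * Real.sin t := rfl
    linear_combination (ε * F1 Q ε σ (ξ t) (η t) (M' t)) * this - e
  have dη : ∀ t, HasDerivAt η (-ξ t + ε * F2 Q ε σ (ξ t) (η t) (M' t)) t := by
    intro t
    refine (((dS' t).mul (Real.hasDerivAt_cos t)).add
      ((dP' t).neg.mul (Real.hasDerivAt_sin t))).congr_deriv ?_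
    have := Real.sin_sq_add_cos_sq t
    have e : ξ t = p t * Real.cos t + q t * Real.sin t := rfl
    simp only [Pi.neg_apply]
    linear_combination (ε * F2 Q ε σ (ξ t) (η t) (M' t)) * this + e
  have hpos : 0 < 1 + ε * σ := by
    have h1 : |ε * σ| < 1 := by
      rw [abs_mul]
      exact (mul_le_mul_of_nonneg_left hσR (abs_nonneg ε)).trans_lt hε3
    linarith [(abs_lt.mp h1).1]
  obtain ⟨ν, hν⟩ : ∃ ν, ν = Q.w / (1 + ε * σ) := ⟨_, rfl⟩
  have hν0 : 0 < ν := by rw [hν]; positivity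
  have hν1 : ν * (1 + ε * σ) = Q.w := by rw [hν]; field_simp
  have hpi := Real.pi_pos
  have perp : ∀ t, p (t + 2 * Real.pi) = p t := CE_per P
  have perq : ∀ t, q (t + 2 * Real.pi) = q t := CE_per S
  have perM : ∀ t, M' (t + 2 * Real.pi) = M' t := CE_per M
  have perξ : ∀ t, ξ (t + 2 * Real.pi) = ξ t := by
    intro t; simp only [hξ, perp, perq, Real.cos_add_two_pi, Real.sin_add_two_pi]
  have perη : ∀ t, η (t + 2 * Real.pi) = η t := by
    intro t; simp only [hη, perp, perq, Real.cos_add_two_pi, Real.sin_add_two_pi]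
  refine ⟨fun t => (ε * (ξ (ν * t) + M' (ν * t)),
      ε * (M' (ν * t) / Q.d + Q.d ^ 2 * Q.β ^ 2 * ξ (ν * t) - Q.d * Q.β * Q.w * η (ν * t)),
      ε * (Q.w * η (ν * t))), 2 * Real.pi / ν, by positivity, ?_, ?_, ?_, ?_⟩
  · intro t
    exact ode_check Q hd hw hrel ε σ ν (a ε) (b ε) (c ε) (ha ε) (hb ε) (hc ε) hν1 ξ η M' dξ dη dM' _
      rfl t
  · intro t
    have : ν * (t + 2 * Real.pi / ν) = ν * t + 2 * Real.pi := by field_simp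
    simp only [this, perξ, perη, perM]
  · refine ⟨(Real.pi / 2) / ν, (-(Real.pi / 2)) / ν, fun h => ?_⟩
    have h3 := congrArg (fun z : ℝ × ℝ × ℝ => z.2.2) h
    simp only [mul_div_cancel₀ _ hν0.ne'] at h3
    have hε0 : ε ≠ 0 := abs_pos.mp hεpos
    have h4 := mul_left_cancel₀ hw.ne' (mul_left_cancel₀ hε0 h3)
    simp only [hη, Real.cos_neg, Real.sin_neg, Real.cos_pi_div_two, Real.sin_pi_div_two] at h4
    have h5 : 0 < p (Real.pi / 2) := hPr _
    have h6 : 0 < p (-(Real.pi / 2)) := hPr _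
    linarith
  · intro t
    have bP : |p (ν * t)| ≤ R := CE_bound hPR _
    have bS : |q (ν * t)| ≤ R := CE_bound hSR _
    have bM : |M' (ν * t)| ≤ R := CE_bound hMR _
    have bξ : |ξ (ν * t)| ≤ 2 * R := abs_trig_le bP bS
    have bη : |η (ν * t)| ≤ 2 * R := abs_trig_le bS (by rwa [abs_neg])
    have key : ∀ z, |z| ≤ CC → |ε * z| < δ := by
      intro z hz
      rw [abs_mul]
      exact (mul_le_mul_of_nonneg_left hz (abs_nonneg ε)).trans_lt hε2
    have n1 : 0 ≤ R / Q.d := by positivity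
    have n2 : 0 ≤ Q.d ^ 2 * Q.β ^ 2 := by positivity
    have n3 : 0 ≤ Q.d * Q.β * Q.w := by positivity
    have n4 : 0 ≤ Q.d ^ 2 * Q.β ^ 2 * (2 * R) := by positivity
    have n5 : 0 ≤ Q.d * Q.β * Q.w * (2 * R) := by positivity
    have n6 : 0 ≤ 2 * Q.w * R := by positivity
    simp only [Prod.norm_def, max_lt_iff, Real.norm_eq_abs]
    refine ⟨key _ ?_, key _ ?_, key _ ?_⟩
    · have := abs_add_le (ξ (ν * t)) (M' (ν * t))
      linarith
    · have h1 := abs_sub (M' (ν * t) / Q.d + Q.d ^ 2 * Q.β ^ 2 * ξ (ν * t))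
        (Q.d * Q.β * Q.w * η (ν * t))
      have h2 := abs_add_le (M' (ν * t) / Q.d) (Q.d ^ 2 * Q.β ^ 2 * ξ (ν * t))
      have h3 : |M' (ν * t) / Q.d| ≤ R / Q.d := by
        rw [abs_div, abs_of_pos hd]; gcongr
      have h4 : |Q.d ^ 2 * Q.β ^ 2 * ξ (ν * t)| ≤ Q.d ^ 2 * Q.β ^ 2 * (2 * R) := by
        rw [abs_mul, abs_of_nonneg n2]; gcongr
      have h5 : |Q.d * Q.β * Q.w * η (ν * t)| ≤ Q.d * Q.β * Q.w * (2 * R) := by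
        rw [abs_mul, abs_of_nonneg n3]; gcongr
      linarith
    · have h5 : |Q.w * η (ν * t)| ≤ Q.w * (2 * R) := by
        rw [abs_mul, abs_of_pos hw]; gcongr
      linarith


/-- **Theorem A (I), existence part.** For Family A parameters
`a(ε) = -1/d + εα₁ + ε²α₂`, `b(ε) = β₀ + εβ₁ + ε²β₂`, `c(ε) = dβ₀ + εγ₁ + ε²γ₂`
with `β₀ = (1/d)√(1/d - w²)`, if `l₀·(w²d - 1) > 0` and `l₀ ≠ 0`, then for every
`δ > 0` and all sufficiently small `ε ≠ 0` the FitzHugh–Nagumo system has a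
nonconstant periodic solution contained in the ball of radius `δ` about the
origin. -/
theorem fhn_familyA_periodic_solution
    (d w α₁ α₂ β₁ β₂ γ₁ γ₂ : ℝ) (hd : 0 < d) (hd1 : d ≠ 1) (hw : 0 < w)
    (hdw : 0 < 1 - d * w ^ 2)
    (β₀ : ℝ) (hβ₀ : β₀ = (1 / d) * Real.sqrt (1 / d - w ^ 2))
    (l₀ : ℝ) (hl₀ : l₀ = 2 * w ^ 4 * d * (d * β₁ - γ₁) ^ 2 + 2 * α₁ ^ 2 * (d * w ^ 2 - 1))
    (hsign : l₀ * (w ^ 2 * d - 1) > 0) (hne : l₀ ≠ 0)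
    (a b c : ℝ → ℝ)
    (ha : ∀ ε, a ε = -1 / d + ε * α₁ + ε ^ 2 * α₂)
    (hb : ∀ ε, b ε = β₀ + ε * β₁ + ε ^ 2 * β₂)
    (hc : ∀ ε, c ε = d * β₀ + ε * γ₁ + ε ^ 2 * γ₂) :
    ∀ δ > 0, ∃ ε₀ > 0, ∀ ε : ℝ, 0 < |ε| → |ε| < ε₀ →
      ∃ (φ : ℝ → ℝ × ℝ × ℝ) (T : ℝ), 0 < T ∧
        (∀ t, HasDerivAt φ
          ((φ t).2.2,
           b ε * ((φ t).1 - d * (φ t).2.1),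
           ((φ t).1 - a ε) * ((φ t).1 - 1) * (φ t).1 + (φ t).2.1 + c ε * (φ t).2.2) t) ∧
        (∀ t, φ (t + T) = φ t) ∧
        (∃ t s, φ t ≠ φ s) ∧
        (∀ t, ‖φ t‖ < δ) := by
  have hβpos : 0 < β₀ := by
    rw [hβ₀]
    have : 0 < 1 / d - w ^ 2 := by
      have : 1 / d - w ^ 2 = (1 - d * w ^ 2) / d := by field_simp
      rw [this]; positivity
    have := Real.sqrt_pos.mpr this
    positivity
  have hrel : d ^ 3 * β₀ ^ 2 = 1 - d * w ^ 2 := by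
    have h1 : 0 ≤ 1 / d - w ^ 2 := by
      have : 1 / d - w ^ 2 = (1 - d * w ^ 2) / d := by field_simp
      rw [this]; positivity
    rw [hβ₀, mul_pow, Real.sq_sqrt h1]
    field_simp
  have hl : l₀ < 0 := by
    by_contra h
    push Not at h
    nlinarith
  have hk : 1 - 1 / d ≠ 0 := by
    intro h
    apply hd1
    field_simp at h
    linarith
  exact fhn_core ⟨d, w, α₁, α₂, β₁, β₂, γ₁, γ₂, β₀⟩ hd hw hβpos hk hrel
    (by simp only; nlinarith) a b c ha hb hc
end

section
/- Let d, w, α₁, β₁, γ₁ be real numbers with d > 0, d ≠ 1, w > 0, 1 − d·w² > 0; set β₀ = (1/d)·√(1/d − w²) and l₀ = 2w⁴d(dβ₁ − γ₁)² + 2α₁²(dw² − 1), and assume l₀·(w²d − 1) > 0. Define g₁ : ℝ² → ℝ² by g₁¹(r,z) = −rπ((α₁d²w² − 2z(d−1)(w²d−1))·d·β₀ + d²w⁴(β₁d − γ₁)) / (d²w⁵) and g₁²(r,z) = β₀π((1−d)r² − 8(d−1)(dw²−1)²z² + 8α₁d²w²(dw²−1)z) / (4dw⁵(dw²−1)). Set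 r⁺ = (d²/(d−1))·√(l₀/(w²d−1))·w², r⁻ = −r⁺, and z⋆ = d·w²(d·β₀·α₁ + w²dβ₁ − w²γ₁) / (2β₀(d−1)(w²d−1)). Then g₁(r⁺, z⋆) = (0,0) and g₁(r⁻, z⋆) = (0,0). -/
open Real

/-- The nontrivial zeros `(r⁺, z⋆)` and `(r⁻, z⋆)` of the first-order averaged
function `g₁` for Family A of the FitzHugh–Nagumo system. -/
theorem fhn_familyA_averaged_zeros
    (d w α₁ β₁ γ₁ : ℝ) (hd : 0 < d) (hd1 : d ≠ 1) (hw : 0 < w)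
    (hdw : 0 < 1 - d * w ^ 2)
    (β₀ : ℝ) (hβ₀ : β₀ = (1 / d) * Real.sqrt (1 / d - w ^ 2))
    (l₀ : ℝ) (hl₀ : l₀ = 2 * w ^ 4 * d * (d * β₁ - γ₁) ^ 2 + 2 * α₁ ^ 2 * (d * w ^ 2 - 1))
    (hsign : l₀ * (w ^ 2 * d - 1) > 0)
    (g₁ : ℝ → ℝ → ℝ × ℝ)
    (hg₁ : ∀ r z, g₁ r z =
      (-(r * π * ((α₁ * d ^ 2 * w ^ 2 - 2 * z * (d - 1) * (w ^ 2 * d - 1)) * d * β₀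
          + d ^ 2 * w ^ 4 * (β₁ * d - γ₁))) / (d ^ 2 * w ^ 5),
       β₀ * π * ((1 - d) * r ^ 2 - 8 * (d - 1) * (d * w ^ 2 - 1) ^ 2 * z ^ 2
          + 8 * α₁ * d ^ 2 * w ^ 2 * (d * w ^ 2 - 1) * z) / (4 * d * w ^ 5 * (d * w ^ 2 - 1))))
    (rp rm zs : ℝ)
    (hrp : rp = (d ^ 2 / (d - 1)) * Real.sqrt (l₀ / (w ^ 2 * d - 1)) * w ^ 2)
    (hrm : rm = -rp)
    (hzs : zs = d * w ^ 2 * (d * β₀ * α₁ + w ^ 2 * d * β₁ - w ^ 2 * γ₁)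
        / (2 * β₀ * (d - 1) * (w ^ 2 * d - 1))) :
    g₁ rp zs = (0, 0) ∧ g₁ rm zs = (0, 0) := by
  have hD : w ^ 2 * d - 1 ≠ 0 := by nlinarith
  have hD' : d * w ^ 2 - 1 ≠ 0 := by nlinarith
  have hd0 : d ≠ 0 := hd.ne'
  have hd2 : d - 1 ≠ 0 := sub_ne_zero.mpr hd1
  have hpos : 0 < 1 / d - w ^ 2 := by
    have : 1 / d - w ^ 2 = (1 - d * w ^ 2) / d := by field_simp
    rw [this]; positivity
  have hb : β₀ ≠ 0 := by
    rw [hβ₀]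
    have := Real.sqrt_pos.mpr hpos
    positivity
  have hb2 : β₀ ^ 2 * d ^ 3 = -(w ^ 2 * d - 1) := by
    rw [hβ₀, mul_pow, Real.sq_sqrt hpos.le]
    field_simp
    ring
  have hq : 0 ≤ l₀ / (w ^ 2 * d - 1) := by
    have : l₀ / (w ^ 2 * d - 1) = l₀ * (w ^ 2 * d - 1) / (w ^ 2 * d - 1) ^ 2 := by
      field_simp
    rw [this]; positivity
  have hr2 : rp ^ 2 * ((d - 1) ^ 2 * (w ^ 2 * d - 1)) = d ^ 4 * w ^ 4 * l₀ := by
    rw [hrp, mul_pow, mul_pow, Real.sq_sqrt hq]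
    field_simp
  have hz : zs * (2 * β₀ * (d - 1) * (w ^ 2 * d - 1))
      = d * w ^ 2 * (d * β₀ * α₁ + w ^ 2 * d * β₁ - w ^ 2 * γ₁) := by
    rw [hzs]; field_simp
  have h1 : (α₁ * d ^ 2 * w ^ 2 - 2 * zs * (d - 1) * (w ^ 2 * d - 1)) * d * β₀
          + d ^ 2 * w ^ 4 * (β₁ * d - γ₁) = 0 := by
    linear_combination (-d) * hz
  have h2 : (1 - d) * rp ^ 2 - 8 * (d - 1) * (d * w ^ 2 - 1) ^ 2 * zs ^ 2
          + 8 * α₁ * d ^ 2 * w ^ 2 * (d * w ^ 2 - 1) * zs = 0 := by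
    have hne : β₀ ^ 2 * (d - 1) * (w ^ 2 * d - 1) ≠ 0 := by
      simp [hb, hd2, hD]
    refine (mul_eq_zero.mp ?_).resolve_left hne
    rw [hl₀] at hr2
    have e : zs * (2 * β₀ * (d - 1) * (w ^ 2 * d - 1)) - 2 * d ^ 2 * w ^ 2 * α₁ * β₀
      = d * w ^ 2 * (-(d * β₀ * α₁) + w ^ 2 * d * β₁ - w ^ 2 * γ₁) := by
      linear_combination hz
    linear_combination (-β₀ ^ 2) * hr2
      - 2 * (w ^ 2 * d - 1) * (zs * (2 * β₀ * (d - 1) * (w ^ 2 * d - 1)) - 2 * d ^ 2 * w ^ 2 * α₁ * β₀) * hz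
      - 2 * (w ^ 2 * d - 1) * (d * w ^ 2 * (d * β₀ * α₁ + w ^ 2 * d * β₁ - w ^ 2 * γ₁)) * e
      - 2 * d ^ 2 * w ^ 8 * (d * β₁ - γ₁) ^ 2 * hb2
  rw [hg₁, hg₁, hrm, neg_sq, h1, h2]
  simp
end

section
/- Under the hypotheses and notation of the Family A averaged function (d > 0, d ≠ 1, w > 0, 1 − d·w² > 0, β₀ = (1/d)·√(1/d − w²), l₀ = 2w⁴d(dβ₁ − γ₁)² + 2α₁²(dw² − 1), l₀·(w²d − 1) > 0, and g₁, r⁺, r⁻, z⋆ as defined there), the determinant of the Jacobian matrix Dg₁ of g₁ evaluated at either (r⁺, z⋆) or (r⁻, z⋆) equals −π²·l₀ / (d·w⁶). In particular, this determinant is nonzero whenever l₀ ≠ 0. -/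
open Real

/-- The determinant of the Jacobian of the Family A first-order averaged
function `g₁` at the zeros `(r⁺, z⋆)` and `(r⁻, z⋆)` equals `-π²·l₀/(d·w⁶)`;
in particular it is nonzero whenever `l₀ ≠ 0`. -/
theorem fhn_familyA_averaged_jacobian_det
    (d w α₁ β₁ γ₁ : ℝ) (hd : 0 < d) (hd1 : d ≠ 1) (hw : 0 < w)
    (hdw : 0 < 1 - d * w ^ 2)
    (β₀ : ℝ) (hβ₀ : β₀ = (1 / d) * Real.sqrt (1 / d - w ^ 2))
    (l₀ : ℝ) (hl₀ : l₀ = 2 * w ^ 4 * d * (d * β₁ - γ₁) ^ 2 + 2 * α₁ ^ 2 * (d * w ^ 2 - 1))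
    (hsign : l₀ * (w ^ 2 * d - 1) > 0)
    (g₁ : ℝ → ℝ → ℝ × ℝ)
    (hg₁ : ∀ r z, g₁ r z =
      (-(r * π * ((α₁ * d ^ 2 * w ^ 2 - 2 * z * (d - 1) * (w ^ 2 * d - 1)) * d * β₀
          + d ^ 2 * w ^ 4 * (β₁ * d - γ₁))) / (d ^ 2 * w ^ 5),
       β₀ * π * ((1 - d) * r ^ 2 - 8 * (d - 1) * (d * w ^ 2 - 1) ^ 2 * z ^ 2
          + 8 * α₁ * d ^ 2 * w ^ 2 * (d * w ^ 2 - 1) * z) / (4 * d * w ^ 5 * (d * w ^ 2 - 1))))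
    (rp rm zs : ℝ)
    (hrp : rp = (d ^ 2 / (d - 1)) * Real.sqrt (l₀ / (w ^ 2 * d - 1)) * w ^ 2)
    (hrm : rm = -rp)
    (hzs : zs = d * w ^ 2 * (d * β₀ * α₁ + w ^ 2 * d * β₁ - w ^ 2 * γ₁)
        / (2 * β₀ * (d - 1) * (w ^ 2 * d - 1)))
    (Dg₁ : ℝ → ℝ → Matrix (Fin 2) (Fin 2) ℝ)
    (hDg₁ : ∀ r z, Dg₁ r z =
      ![![deriv (fun r' => (g₁ r' z).1) r, deriv (fun z' => (g₁ r z').1) z],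
        ![deriv (fun r' => (g₁ r' z).2) r, deriv (fun z' => (g₁ r z').2) z]]) :
    (Dg₁ rp zs).det = -(π ^ 2 * l₀) / (d * w ^ 6) ∧
    (Dg₁ rm zs).det = -(π ^ 2 * l₀) / (d * w ^ 6) ∧
    (l₀ ≠ 0 → (Dg₁ rp zs).det ≠ 0 ∧ (Dg₁ rm zs).det ≠ 0) := by
  have hd1' : d - 1 ≠ 0 := sub_ne_zero.mpr hd1
  have hk : w ^ 2 * d - 1 ≠ 0 := by nlinarith
  have hk' : d * w ^ 2 - 1 ≠ 0 := by nlinarith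
  have hd0 : d ≠ 0 := hd.ne'
  have hw0 : w ≠ 0 := hw.ne'
  have hpos : 0 < 1 / d - w ^ 2 := by
    have : 1 / d - w ^ 2 = (1 - d * w ^ 2) / d := by field_simp
    rw [this]; positivity
  have hb2 : β₀ ^ 2 = (1 - d * w ^ 2) / d ^ 3 := by
    rw [hβ₀, mul_pow, Real.sq_sqrt hpos.le]; field_simp
  have hb0 : β₀ ≠ 0 := by
    rw [hβ₀]
    have := Real.sqrt_pos.mpr hpos
    positivity
  have hq : 0 ≤ l₀ / (w ^ 2 * d - 1) := by
    have : l₀ / (w ^ 2 * d - 1) = (l₀ * (w ^ 2 * d - 1)) / (w ^ 2 * d - 1) ^ 2 := by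
      field_simp
    rw [this]; positivity
  have hr2 : rp ^ 2 = d ^ 4 / (d - 1) ^ 2 * (l₀ / (w ^ 2 * d - 1)) * w ^ 4 := by
    rw [hrp, mul_pow, mul_pow, Real.sq_sqrt hq, div_pow]; ring
  have hz : 2 * zs * (d - 1) * (w ^ 2 * d - 1) * β₀
      = d * w ^ 2 * (d * β₀ * α₁ + w ^ 2 * d * β₁ - w ^ 2 * γ₁) := by
    rw [hzs]; field_simp
  have key : ∀ r : ℝ, r ^ 2 = rp ^ 2 → (Dg₁ r zs).det = -(π ^ 2 * l₀) / (d * w ^ 6) := by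
    intro r hr
    have h1 : deriv (fun r' => (g₁ r' zs).1) r = 0 := by
      have : (fun r' => (g₁ r' zs).1) = fun _ => (0 : ℝ) := by
        funext x
        rw [hg₁]
        have e : (α₁ * d ^ 2 * w ^ 2 - 2 * zs * (d - 1) * (w ^ 2 * d - 1)) * d * β₀
          + d ^ 2 * w ^ 4 * (β₁ * d - γ₁) = 0 := by linear_combination (-d) * hz
        simp only [e]; simp
      rw [this]; simp
    have h2 : deriv (fun z' => (g₁ r z').1) zs
        = r * π * (2 * (d - 1) * (w ^ 2 * d - 1) * d * β₀) / (d ^ 2 * w ^ 5) := by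
      have : (fun z' => (g₁ r z').1) = fun z' =>
          (r * π * (2 * (d - 1) * (w ^ 2 * d - 1) * d * β₀) / (d ^ 2 * w ^ 5)) * z'
          + (-(r * π * (α₁ * d ^ 2 * w ^ 2 * d * β₀
          + d ^ 2 * w ^ 4 * (β₁ * d - γ₁))) / (d ^ 2 * w ^ 5)) := by
        funext x
        rw [hg₁]; ring
      rw [this]
      simpa using (((hasDerivAt_id zs).const_mul _).add_const _).deriv
    have h3 : deriv (fun r' => (g₁ r' zs).2) r
        = β₀ * π * (1 - d) / (4 * d * w ^ 5 * (d * w ^ 2 - 1)) * (2 * r) := by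
      have : (fun r' => (g₁ r' zs).2) = fun r' =>
          (β₀ * π * (1 - d) / (4 * d * w ^ 5 * (d * w ^ 2 - 1))) * r' ^ 2
          + β₀ * π * (- 8 * (d - 1) * (d * w ^ 2 - 1) ^ 2 * zs ^ 2
          + 8 * α₁ * d ^ 2 * w ^ 2 * (d * w ^ 2 - 1) * zs) / (4 * d * w ^ 5 * (d * w ^ 2 - 1)) := by
        funext x
        rw [hg₁]; ring
      rw [this]
      simpa using (((hasDerivAt_pow 2 r).const_mul _).add_const _).deriv
    have m00 : Dg₁ r zs 0 0 = deriv (fun r' => (g₁ r' zs).1) r := by rw [hDg₁]; rfl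
    have m01 : Dg₁ r zs 0 1 = deriv (fun z' => (g₁ r z').1) zs := by rw [hDg₁]; rfl
    have m10 : Dg₁ r zs 1 0 = deriv (fun r' => (g₁ r' zs).2) r := by rw [hDg₁]; rfl
    have m11 : Dg₁ r zs 1 1 = deriv (fun z' => (g₁ r z').2) zs := by rw [hDg₁]; rfl
    rw [Matrix.det_fin_two, m00, m01, m10, m11, h1, h2, h3]
    have e : 0 * deriv (fun z' => (g₁ r z').2) zs
        - r * π * (2 * (d - 1) * (w ^ 2 * d - 1) * d * β₀) / (d ^ 2 * w ^ 5) *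
          (β₀ * π * (1 - d) / (4 * d * w ^ 5 * (d * w ^ 2 - 1)) * (2 * r))
        = r ^ 2 * β₀ ^ 2 * π ^ 2 * (d - 1) ^ 2 / (d ^ 2 * w ^ 10) := by
      rw [mul_comm (w ^ 2) d]
      field_simp
      ring
    refine Eq.trans e ?_
    rw [hr, hr2, hb2, mul_comm (w ^ 2) d]
    field_simp
    ring
  have hp := key rp rfl
  have hm := key rm (by rw [hrm]; ring)
  refine ⟨hp, hm, fun hl => ?_⟩
  have : -(π ^ 2 * l₀) / (d * w ^ 6) ≠ 0 := by
    have := Real.pi_ne_zero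
    exact div_ne_zero (neg_ne_zero.mpr (by positivity)) (by positivity)
  rw [hp, hm]
  exact ⟨this, this⟩
end

section
/- Under the hypotheses and notation of the Family A averaged function (d > 0, d ≠ 1, w > 0, 1 − d·w² > 0, β₀ = (1/d)·√(1/d − w²), l₀ = 2w⁴d(dβ₁ − γ₁)² + 2α₁²(dw² − 1), l₀·(w²d − 1) > 0, and g₁, r⁺, r⁻, z⋆ as defined there), the characteristic polynomial of the 2×2 Jacobian matrix Dg₁ evaluated at (r⁺, z⋆) (and likewise at (r⁻, z⋆)) equals X² + (2π(β₁d − γ₁)/w)·X − π²·l₀/(d·w⁶). -/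
open Real Polynomial

/-- The characteristic polynomial of the Jacobian of the Family A first-order
averaged function `g₁` at `(r⁺, z⋆)` (and at `(r⁻, z⋆)`) is
`X² + (2π(β₁d - γ₁)/w)·X - π²·l₀/(d·w⁶)`. -/
theorem fhn_familyA_averaged_jacobian_charpoly
    (d w α₁ β₁ γ₁ : ℝ) (hd : 0 < d) (hd1 : d ≠ 1) (hw : 0 < w)
    (hdw : 0 < 1 - d * w ^ 2)
    (β₀ : ℝ) (hβ₀ : β₀ = (1 / d) * Real.sqrt (1 / d - w ^ 2))
    (l₀ : ℝ) (hl₀ : l₀ = 2 * w ^ 4 * d * (d * β₁ - γ₁) ^ 2 + 2 * α₁ ^ 2 * (d * w ^ 2 - 1))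
    (hsign : l₀ * (w ^ 2 * d - 1) > 0)
    (g₁ : ℝ → ℝ → ℝ × ℝ)
    (hg₁ : ∀ r z, g₁ r z =
      (-(r * π * ((α₁ * d ^ 2 * w ^ 2 - 2 * z * (d - 1) * (w ^ 2 * d - 1)) * d * β₀
          + d ^ 2 * w ^ 4 * (β₁ * d - γ₁))) / (d ^ 2 * w ^ 5),
       β₀ * π * ((1 - d) * r ^ 2 - 8 * (d - 1) * (d * w ^ 2 - 1) ^ 2 * z ^ 2
          + 8 * α₁ * d ^ 2 * w ^ 2 * (d * w ^ 2 - 1) * z) / (4 * d * w ^ 5 * (d * w ^ 2 - 1))))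
    (rp rm zs : ℝ)
    (hrp : rp = (d ^ 2 / (d - 1)) * Real.sqrt (l₀ / (w ^ 2 * d - 1)) * w ^ 2)
    (hrm : rm = -rp)
    (hzs : zs = d * w ^ 2 * (d * β₀ * α₁ + w ^ 2 * d * β₁ - w ^ 2 * γ₁)
        / (2 * β₀ * (d - 1) * (w ^ 2 * d - 1)))
    (Dg₁ : ℝ → ℝ → Matrix (Fin 2) (Fin 2) ℝ)
    (hDg₁ : ∀ r z, Dg₁ r z =
      ![![deriv (fun r' => (g₁ r' z).1) r, deriv (fun z' => (g₁ r z').1) z],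
        ![deriv (fun r' => (g₁ r' z).2) r, deriv (fun z' => (g₁ r z').2) z]]) :
    (Dg₁ rp zs).charpoly
        = X ^ 2 + C (2 * π * (β₁ * d - γ₁) / w) * X - C (π ^ 2 * l₀ / (d * w ^ 6)) ∧
    (Dg₁ rm zs).charpoly
        = X ^ 2 + C (2 * π * (β₁ * d - γ₁) / w) * X - C (π ^ 2 * l₀ / (d * w ^ 6)) := by
  have hd0 : d ≠ 0 := hd.ne'
  have hw0 : w ≠ 0 := hw.ne'
  have hd1' : d - 1 ≠ 0 := sub_ne_zero.mpr hd1
  have he : d * w ^ 2 - 1 ≠ 0 := by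
    intro h
    linarith
  have hcomm : w ^ 2 * d = d * w ^ 2 := mul_comm _ _
  rw [hcomm] at hsign hrp hzs
  have hpos : 0 < 1 / d - w ^ 2 := by
    have h : 1 / d - w ^ 2 = (1 - d * w ^ 2) / d := by field_simp
    rw [h]
    positivity
  have hb0 : β₀ ≠ 0 := by
    rw [hβ₀]
    have := Real.sqrt_pos.mpr hpos
    positivity
  have hb2 : β₀ ^ 2 * d ^ 3 = -(d * w ^ 2 - 1) := by
    rw [hβ₀, mul_pow, Real.sq_sqrt hpos.le]
    field_simp
    ring
  have hl : 0 ≤ l₀ / (d * w ^ 2 - 1) := by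
    have h : l₀ / (d * w ^ 2 - 1) = l₀ * (d * w ^ 2 - 1) / (d * w ^ 2 - 1) ^ 2 := by
      field_simp
    rw [h]
    exact div_nonneg hsign.le (sq_nonneg _)
  have hr2 : rp ^ 2 * ((d - 1) ^ 2 * (d * w ^ 2 - 1)) = d ^ 4 * l₀ * w ^ 4 := by
    rw [hrp, mul_pow, mul_pow, Real.sq_sqrt hl]
    field_simp
  have hz : 2 * zs * (d - 1) * (d * w ^ 2 - 1) * β₀
      = d * w ^ 2 * (d * β₀ * α₁ + w ^ 2 * (β₁ * d - γ₁)) := by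
    rw [hzs]
    field_simp
    ring
  have key : ∀ r, r ^ 2 = rp ^ 2 → (Dg₁ r zs).charpoly
        = X ^ 2 + C (2 * π * (β₁ * d - γ₁) / w) * X - C (π ^ 2 * l₀ / (d * w ^ 6)) := by
    intro r hr
    rw [← hr] at hr2
    have h11 : deriv (fun r' => (g₁ r' zs).1) r = 0 := by
      have hf : (fun r' => (g₁ r' zs).1) = fun _ => (0 : ℝ) := by
        funext r'
        rw [hg₁]
        simp only [hcomm]
        have : (α₁ * d ^ 2 * w ^ 2 - 2 * zs * (d - 1) * (d * w ^ 2 - 1)) * d * β₀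
          + d ^ 2 * w ^ 4 * (β₁ * d - γ₁) = 0 := by
          linear_combination (-d) * hz
        rw [this]
        simp
      rw [hf]
      simp
    have h12 : deriv (fun z' => (g₁ r z').1) zs
        = r * π * (2 * (d - 1) * (d * w ^ 2 - 1)) * β₀ / (d * w ^ 5) := by
      have hf : (fun z' => (g₁ r z').1) = fun z' =>
          (r * π * (2 * (d - 1) * (d * w ^ 2 - 1)) * β₀ / (d * w ^ 5)) * z'
          + (-(r * π * (α₁ * d ^ 2 * w ^ 2 * d * β₀
          + d ^ 2 * w ^ 4 * (β₁ * d - γ₁))) / (d ^ 2 * w ^ 5)) := by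
        funext z'
        rw [hg₁]
        field_simp
        ring
      rw [hf]
      exact ((((hasDerivAt_id' zs).const_mul _).add_const _).deriv).trans (mul_one _)
    have h21 : deriv (fun r' => (g₁ r' zs).2) r
        = β₀ * π * (1 - d) * r / (2 * d * w ^ 5 * (d * w ^ 2 - 1)) := by
      have hf : (fun r' => (g₁ r' zs).2) = fun r' =>
          (β₀ * π * (1 - d) / (4 * d * w ^ 5 * (d * w ^ 2 - 1))) * r' ^ 2 + (g₁ 0 zs).2 := by
        funext r'
        rw [hg₁, hg₁]
        ring
      rw [hf, (((hasDerivAt_pow 2 r).const_mul _).add_const _).deriv]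
      field_simp
      norm_num
      ring
    have h22 : deriv (fun z' => (g₁ r z').2) zs = -(2 * π * (β₁ * d - γ₁) / w) := by
      have hf : (fun z' => (g₁ r z').2) = fun z' =>
          (β₀ * π * (-2 * (d - 1) * (d * w ^ 2 - 1)) / (d * w ^ 5)) * z' ^ 2
          + (β₀ * π * (2 * α₁ * d ^ 2 * w ^ 2) / (d * w ^ 5)) * z' + (g₁ r 0).2 := by
        funext z'
        rw [hg₁, hg₁]
        field_simp
        ring
      rw [hf]
      refine (((((hasDerivAt_pow 2 zs).const_mul _).add
        ((hasDerivAt_id' zs).const_mul _)).add_const _).deriv).trans ?_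
      have h1 : -(2 * π * (β₁ * d - γ₁) / w)
          = (π / (d * w ^ 5)) * (-2 * (d * w ^ 4 * (β₁ * d - γ₁))) := by
        field_simp
      rw [h1]
      norm_num
      linear_combination (-2 * (π / (d * w ^ 5))) * hz
    rw [Matrix.charpoly_fin_two]
    have htr : (Dg₁ r zs).trace = -(2 * π * (β₁ * d - γ₁) / w) := by
      rw [Matrix.trace_fin_two, hDg₁, h11, h12, h21, h22]
      simp
    have hdet : (Dg₁ r zs).det = -(π ^ 2 * l₀ / (d * w ^ 6)) := by
      rw [Matrix.det_fin_two, hDg₁, h11, h12, h21, h22]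
      simp only [Matrix.cons_val_zero, Matrix.cons_val_one]
      have hr2' : r ^ 2 * (d - 1) ^ 2 = d ^ 4 * l₀ * w ^ 4 / (d * w ^ 2 - 1) := by
        rw [eq_div_iff he]
        linear_combination hr2
      have hb2' : β₀ ^ 2 = -(d * w ^ 2 - 1) / d ^ 3 := by
        rw [eq_div_iff (by positivity)]
        exact hb2
      have : 0 * -(2 * π * (β₁ * d - γ₁) / w) - r * π * (2 * (d - 1) * (d * w ^ 2 - 1)) * β₀ / (d * w ^ 5)
          * (β₀ * π * (1 - d) * r / (2 * d * w ^ 5 * (d * w ^ 2 - 1)))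
          = π ^ 2 * (r ^ 2 * (d - 1) ^ 2) * β₀ ^ 2 / (d ^ 2 * w ^ 10) := by
        field_simp
        ring
      refine this.trans ?_
      rw [hr2', hb2']
      field_simp
    rw [htr, hdet]
    simp only [map_neg]
    ring
  exact ⟨key rp rfl, key rm (by rw [hrm]; ring)⟩
end

section
/- Under the hypotheses and notation of the Family A averaged function (d > 0, d ≠ 1, w > 0, 1 − d·w² > 0, β₀ = (1/d)·√(1/d − w²), l₀ = 2w⁴d(dβ₁ − γ₁)² + 2α₁²(dw² − 1), and g₁, r⁺, r⁻, z⋆ as defined there), assume l₀ < 0. Let M be the Jacobian matrix Dg₁ evaluated at (r⁺, z⋆) (or at (r⁻, z⋆)), viewed as a 2×2 complex matrix. If β₁·d − γ₁ > 0, then every complex eigenvalue of M has strictly negative real part. If β₁·d − γ₁ < 0, then M has a complex eigenvalue with strictly positive real part. -/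
open Real

lemma fhn_spec (M : Matrix (Fin 2) (Fin 2) ℂ) (b c e : ℝ)
    (h00 : M 0 0 = 0) (h01 : M 0 1 = (b : ℂ)) (h10 : M 1 0 = (c : ℂ)) (h11 : M 1 1 = (e : ℂ))
    (μ : ℂ) : μ ∈ spectrum ℂ M ↔ μ * (μ - e) - b * c = 0 := by
  rw [spectrum.mem_iff, Matrix.isUnit_iff_isUnit_det, isUnit_iff_ne_zero, not_not,
    Matrix.det_fin_two]
  simp [Matrix.algebraMap_matrix_apply, h00, h01, h10, h11]

lemma fhn_neg (b c e : ℝ) (hbc : b * c < 0) (he : e < 0) (μ : ℂ)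
    (h : μ * (μ - e) - b * c = 0) : μ.re < 0 := by
  have h1 := congrArg Complex.re h
  have h2 := congrArg Complex.im h
  simp at h1 h2
  by_contra hx
  push Not at hx
  have h3 : μ.im * (2 * μ.re - e) = 0 := by linarith
  rcases mul_eq_zero.1 h3 with h4 | h4
  · rw [h4] at h1
    nlinarith [mul_nonneg hx hx, mul_nonneg hx (neg_nonneg.2 he.le)]
  · linarith

lemma fhn_pos (b c e : ℝ) (he : 0 < e) :
    ∃ μ : ℂ, μ * (μ - e) - b * c = 0 ∧ 0 < μ.re := by
  obtain ⟨s, hs⟩ := IsAlgClosed.exists_pow_nat_eq ((e : ℂ) ^ 2 + 4 * b * c) (n := 2) (by norm_num)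
  by_cases h : 0 ≤ s.re
  · refine ⟨(e + s) / 2, by linear_combination hs / 4, ?_⟩
    simp
    linarith
  · refine ⟨(e - s) / 2, by linear_combination hs / 4, ?_⟩
    simp
    linarith

/-- Stability of the Family A periodic solution: if `l₀ < 0`, the eigenvalues of
the Jacobian of `g₁` at `(r±, z⋆)` all have negative real part when
`β₁d - γ₁ > 0`, and there is an eigenvalue with positive real part when
`β₁d - γ₁ < 0`. -/
theorem fhn_familyA_stability
    (d w α₁ β₁ γ₁ : ℝ) (hd : 0 < d) (hd1 : d ≠ 1) (hw : 0 < w)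
    (hdw : 0 < 1 - d * w ^ 2)
    (β₀ : ℝ) (hβ₀ : β₀ = (1 / d) * Real.sqrt (1 / d - w ^ 2))
    (l₀ : ℝ) (hl₀ : l₀ = 2 * w ^ 4 * d * (d * β₁ - γ₁) ^ 2 + 2 * α₁ ^ 2 * (d * w ^ 2 - 1))
    (hneg : l₀ < 0)
    (g₁ : ℝ → ℝ → ℝ × ℝ)
    (hg₁ : ∀ r z, g₁ r z =
      (-(r * π * ((α₁ * d ^ 2 * w ^ 2 - 2 * z * (d - 1) * (w ^ 2 * d - 1)) * d * β₀
          + d ^ 2 * w ^ 4 * (β₁ * d - γ₁))) / (d ^ 2 * w ^ 5),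
       β₀ * π * ((1 - d) * r ^ 2 - 8 * (d - 1) * (d * w ^ 2 - 1) ^ 2 * z ^ 2
          + 8 * α₁ * d ^ 2 * w ^ 2 * (d * w ^ 2 - 1) * z) / (4 * d * w ^ 5 * (d * w ^ 2 - 1))))
    (rp rm zs : ℝ)
    (hrp : rp = (d ^ 2 / (d - 1)) * Real.sqrt (l₀ / (w ^ 2 * d - 1)) * w ^ 2)
    (hrm : rm = -rp)
    (hzs : zs = d * w ^ 2 * (d * β₀ * α₁ + w ^ 2 * d * β₁ - w ^ 2 * γ₁)
        / (2 * β₀ * (d - 1) * (w ^ 2 * d - 1)))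
    (Dg₁ : ℝ → ℝ → Matrix (Fin 2) (Fin 2) ℝ)
    (hDg₁ : ∀ r z, Dg₁ r z =
      ![![deriv (fun r' => (g₁ r' z).1) r, deriv (fun z' => (g₁ r z').1) z],
        ![deriv (fun r' => (g₁ r' z).2) r, deriv (fun z' => (g₁ r z').2) z]])
    (M : Matrix (Fin 2) (Fin 2) ℂ)
    (hM : M = (Dg₁ rp zs).map Complex.ofReal ∨ M = (Dg₁ rm zs).map Complex.ofReal) :
    (β₁ * d - γ₁ > 0 → ∀ μ ∈ spectrum ℂ M, μ.re < 0) ∧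
    (β₁ * d - γ₁ < 0 → ∃ μ ∈ spectrum ℂ M, 0 < μ.re) := by
  have hβ : 0 < β₀ := by
    rw [hβ₀]
    have : 0 < 1 / d - w ^ 2 := by
      have : 1 / d - w ^ 2 = (1 - d * w ^ 2) / d := by field_simp
      rw [this]; positivity
    positivity
  have hD : d * w ^ 2 - 1 < 0 := by linarith
  have hD' : w ^ 2 * d - 1 < 0 := by linarith
  have hD0 := hD.ne
  have hD0' := hD'.ne
  have hd1' : d - 1 ≠ 0 := sub_ne_zero.2 hd1
  have hrp0 : rp ≠ 0 := by
    have : 0 < l₀ / (w ^ 2 * d - 1) := div_pos_of_neg_of_neg hneg hD'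
    have := Real.sqrt_pos.2 this
    rw [hrp]; positivity
  obtain ⟨r, hr0, hMr⟩ : ∃ r : ℝ, r ≠ 0 ∧ M = (Dg₁ r zs).map Complex.ofReal := by
    rcases hM with h | h
    · exact ⟨rp, hrp0, h⟩
    · exact ⟨rm, by rw [hrm]; exact neg_ne_zero.2 hrp0, h⟩
  have hz : 2 * zs * (d - 1) * (w ^ 2 * d - 1) * β₀
      = d * w ^ 2 * (d * β₀ * α₁ + w ^ 2 * d * β₁ - w ^ 2 * γ₁) := by
    rw [hzs]; field_simp
  have d1 : deriv (fun r' => (g₁ r' zs).1) r = 0 := by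
    have : (fun r' => (g₁ r' zs).1) = fun _ => (0 : ℝ) := by
      funext x
      rw [hg₁]
      have : (α₁ * d ^ 2 * w ^ 2 - 2 * zs * (d - 1) * (w ^ 2 * d - 1)) * d * β₀
          + d ^ 2 * w ^ 4 * (β₁ * d - γ₁) = 0 := by linear_combination (-d) * hz
      simp only [this]; simp
    rw [this]; simp
  have d2 : deriv (fun z' => (g₁ r z').1) zs
      = r * π * 2 * (d - 1) * (w ^ 2 * d - 1) * d * β₀ / (d ^ 2 * w ^ 5) := by
    have : (fun z' => (g₁ r z').1) = fun z' =>
        (r * π * 2 * (d - 1) * (w ^ 2 * d - 1) * d * β₀ / (d ^ 2 * w ^ 5)) * z'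
        + (-(r * π * (α₁ * d ^ 2 * w ^ 2 * d * β₀
          + d ^ 2 * w ^ 4 * (β₁ * d - γ₁))) / (d ^ 2 * w ^ 5)) := by
      funext x
      rw [hg₁]
      ring
    rw [this]
    exact (((hasDerivAt_id' zs).const_mul _).add_const _).deriv.trans (mul_one _)
  have d3 : deriv (fun r' => (g₁ r' zs).2) r
      = β₀ * π * (1 - d) / (4 * d * w ^ 5 * (d * w ^ 2 - 1)) * (2 * r) := by
    have : (fun r' => (g₁ r' zs).2) = fun r' =>
        (β₀ * π * (1 - d) / (4 * d * w ^ 5 * (d * w ^ 2 - 1))) * r' ^ 2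
        + β₀ * π * (- 8 * (d - 1) * (d * w ^ 2 - 1) ^ 2 * zs ^ 2
          + 8 * α₁ * d ^ 2 * w ^ 2 * (d * w ^ 2 - 1) * zs) / (4 * d * w ^ 5 * (d * w ^ 2 - 1)) := by
      funext x
      rw [hg₁]
      ring
    rw [this]
    have h := (((hasDerivAt_pow 2 r).const_mul
      (β₀ * π * (1 - d) / (4 * d * w ^ 5 * (d * w ^ 2 - 1)))).add_const
        (β₀ * π * (- 8 * (d - 1) * (d * w ^ 2 - 1) ^ 2 * zs ^ 2
          + 8 * α₁ * d ^ 2 * w ^ 2 * (d * w ^ 2 - 1) * zs) / (4 * d * w ^ 5 * (d * w ^ 2 - 1)))).deriv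
    rw [h]; simp
  have d4 : deriv (fun z' => (g₁ r z').2) zs = -(2 * π * (β₁ * d - γ₁) / w) := by
    have : (fun z' => (g₁ r z').2) = fun z' =>
        ((-(2 * β₀ * π * (d - 1) * (d * w ^ 2 - 1) / (d * w ^ 5))) * z' ^ 2
        + (2 * β₀ * π * α₁ * d / w ^ 3) * z')
        + β₀ * π * ((1 - d) * r ^ 2) / (4 * d * w ^ 5 * (d * w ^ 2 - 1)) := by
      funext x
      rw [hg₁]
      field_simp
      ring
    rw [this]
    have h := ((((hasDerivAt_pow 2 zs).const_mul
      (-(2 * β₀ * π * (d - 1) * (d * w ^ 2 - 1) / (d * w ^ 5)))).add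
        ((hasDerivAt_id' zs).const_mul (2 * β₀ * π * α₁ * d / w ^ 3))).add_const
        (β₀ * π * ((1 - d) * r ^ 2) / (4 * d * w ^ 5 * (d * w ^ 2 - 1)))).deriv
    refine h.trans ?_
    simp
    field_simp
    linear_combination (-1) * hz
  have hspec := fhn_spec M _ _ _ (by rw [hMr, hDg₁]; exact (congrArg Complex.ofReal d1).trans Complex.ofReal_zero)
    (by rw [hMr, hDg₁]; exact congrArg Complex.ofReal d2)
    (by rw [hMr, hDg₁]; exact congrArg Complex.ofReal d3)
    (by rw [hMr, hDg₁]; exact congrArg Complex.ofReal d4)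
  constructor
  · intro hB μ hμ
    refine fhn_neg _ _ _ ?_ ?_ μ ((hspec μ).1 hμ)
    · have : r * π * 2 * (d - 1) * (w ^ 2 * d - 1) * d * β₀ / (d ^ 2 * w ^ 5)
          * (β₀ * π * (1 - d) / (4 * d * w ^ 5 * (d * w ^ 2 - 1)) * (2 * r))
          = -((r * π * (d - 1) * β₀ / (d * w ^ 5)) ^ 2) := by
        rw [mul_comm (w ^ 2) d]
        field_simp
        ring
      rw [this]
      have : r * π * (d - 1) * β₀ / (d * w ^ 5) ≠ 0 := by positivity
      have := sq_pos_of_ne_zero this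
      linarith
    · have : 0 < 2 * π * (β₁ * d - γ₁) / w := by
        have := Real.pi_pos
        exact div_pos (mul_pos (by linarith) hB) hw
      linarith
  · intro hB
    obtain ⟨μ, h1, h2⟩ := fhn_pos
      (r * π * 2 * (d - 1) * (w ^ 2 * d - 1) * d * β₀ / (d ^ 2 * w ^ 5))
      (β₀ * π * (1 - d) / (4 * d * w ^ 5 * (d * w ^ 2 - 1)) * (2 * r))
      (-(2 * π * (β₁ * d - γ₁) / w)) (by
        have := Real.pi_pos
        have : 2 * π * (β₁ * d - γ₁) / w < 0 :=
          div_neg_of_neg_of_pos (mul_neg_of_pos_of_neg (by linarith) hB) hw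
        linarith)
    exact ⟨μ, (hspec μ).2 h1, h2⟩
end

section
/- Under the hypotheses and notation of the Family A averaged function (d > 0, d ≠ 1, w > 0, 1 − d·w² > 0, α₁ ≠ 0, β₀ = (1/d)·√(1/d − w²), l₀ = 2w⁴d(dβ₁ − γ₁)² + 2α₁²(dw² − 1), and g₁, r⁺, z⋆ as defined there, regarded as functions of the parameter γ₁), assume l₀ < −d·w⁴·(β₁d − γ₁)². Then the 2×2 matrix Dg₁ evaluated at (r⁺, z⋆), viewed over ℂ, has a pair of non-real complex conjugate eigenvalues whose common real part equals π(γ₁ − β₁d)/w. In particular, when γ₁ = β₁·d these eigenvalues are purely imaginary and equal ±i·w₀ with w₀ = √2·π·|α₁|·√(d(1 − w²d)) / (d·w³), and the real part, as a function of γ₁, vanishes at γ₁ = β₁·d with derivative π/w > 0. -/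
open Real

theorem fhn_aux_spec (M : Matrix (Fin 2) (Fin 2) ℝ) (T D : ℝ)
    (hT : M 0 0 + M 1 1 = T) (hD : M 0 0 * M 1 1 - M 0 1 * M 1 0 = D) (μ : ℂ)
    (h : μ ^ 2 - T * μ + D = 0) : μ ∈ spectrum ℂ (M.map Complex.ofReal) := by
  rw [spectrum.mem_iff, Matrix.isUnit_iff_isUnit_det, Matrix.det_fin_two]
  subst hT hD
  push_cast at h
  have : ((algebraMap ℂ (Matrix (Fin 2) (Fin 2) ℂ) μ - M.map Complex.ofReal) 0 0 *
      (algebraMap ℂ (Matrix (Fin 2) (Fin 2) ℂ) μ - M.map Complex.ofReal) 1 1 -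
      (algebraMap ℂ (Matrix (Fin 2) (Fin 2) ℂ) μ - M.map Complex.ofReal) 0 1 *
      (algebraMap ℂ (Matrix (Fin 2) (Fin 2) ℂ) μ - M.map Complex.ofReal) 1 0) = 0 := by
    simp [Matrix.algebraMap_matrix_apply]
    linear_combination h
  rw [this]
  simp

theorem fhn_aux_pair (M : Matrix (Fin 2) (Fin 2) ℝ) (a b : ℝ)
    (hT : M 0 0 + M 1 1 = 2 * a) (hD : M 0 0 * M 1 1 - M 0 1 * M 1 0 = a ^ 2 + b ^ 2) :
    (⟨a, b⟩ : ℂ) ∈ spectrum ℂ (M.map Complex.ofReal) := by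
  apply fhn_aux_spec M _ _ hT hD
  apply Complex.ext
  · simp [pow_two]; ring
  · simp [pow_two]; ring

/-- Hopf (Neimark–Sacker) non-degeneracy and transversality conditions for the
torus bifurcation in Family A: if `l₀ < -dw⁴(β₁d - γ₁)²` then `Dg₁(r⁺, z⋆)` has
a pair of non-real complex conjugate eigenvalues with common real part
`π(γ₁ - β₁d)/w`; at `γ₁ = β₁d` these are `±i·w₀` with
`w₀ = √2·π·|α₁|·√(d(1 - w²d))/(d·w³)`, and the real part vanishes at
`γ₁ = β₁d` with derivative `π/w > 0`. -/
theorem fhn_familyA_torus_eigenvalue_conditions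
    (d w α₁ β₁ γ₁ : ℝ) (hd : 0 < d) (hd1 : d ≠ 1) (hw : 0 < w)
    (hdw : 0 < 1 - d * w ^ 2) (hα₁ : α₁ ≠ 0)
    (β₀ : ℝ) (hβ₀ : β₀ = (1 / d) * Real.sqrt (1 / d - w ^ 2))
    (l₀ : ℝ) (hl₀ : l₀ = 2 * w ^ 4 * d * (d * β₁ - γ₁) ^ 2 + 2 * α₁ ^ 2 * (d * w ^ 2 - 1))
    (hdisc : l₀ < -(d * w ^ 4 * (β₁ * d - γ₁) ^ 2))
    (g₁ : ℝ → ℝ → ℝ × ℝ)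
    (hg₁ : ∀ r z, g₁ r z =
      (-(r * π * ((α₁ * d ^ 2 * w ^ 2 - 2 * z * (d - 1) * (w ^ 2 * d - 1)) * d * β₀
          + d ^ 2 * w ^ 4 * (β₁ * d - γ₁))) / (d ^ 2 * w ^ 5),
       β₀ * π * ((1 - d) * r ^ 2 - 8 * (d - 1) * (d * w ^ 2 - 1) ^ 2 * z ^ 2
          + 8 * α₁ * d ^ 2 * w ^ 2 * (d * w ^ 2 - 1) * z) / (4 * d * w ^ 5 * (d * w ^ 2 - 1))))
    (rp zs : ℝ)
    (hrp : rp = (d ^ 2 / (d - 1)) * Real.sqrt (l₀ / (w ^ 2 * d - 1)) * w ^ 2)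
    (hzs : zs = d * w ^ 2 * (d * β₀ * α₁ + w ^ 2 * d * β₁ - w ^ 2 * γ₁)
        / (2 * β₀ * (d - 1) * (w ^ 2 * d - 1)))
    (Dg₁ : ℝ → ℝ → Matrix (Fin 2) (Fin 2) ℝ)
    (hDg₁ : ∀ r z, Dg₁ r z =
      ![![deriv (fun r' => (g₁ r' z).1) r, deriv (fun z' => (g₁ r z').1) z],
        ![deriv (fun r' => (g₁ r' z).2) r, deriv (fun z' => (g₁ r z').2) z]])
    (w₀ : ℝ)
    (hw₀ : w₀ = Real.sqrt 2 * π * |α₁| * Real.sqrt (d * (1 - w ^ 2 * d)) / (d * w ^ 3)) :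
    (∃ μ : ℂ, μ.im ≠ 0 ∧
        μ ∈ spectrum ℂ (((Dg₁ rp zs).map Complex.ofReal)) ∧
        (starRingEnd ℂ) μ ∈ spectrum ℂ (((Dg₁ rp zs).map Complex.ofReal)) ∧
        μ.re = π * (γ₁ - β₁ * d) / w) ∧
    (γ₁ = β₁ * d →
        (Complex.I * w₀ ∈ spectrum ℂ (((Dg₁ rp zs).map Complex.ofReal)) ∧
         -(Complex.I * w₀) ∈ spectrum ℂ (((Dg₁ rp zs).map Complex.ofReal)))) ∧
    π * (β₁ * d - β₁ * d) / w = 0 ∧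
    deriv (fun g : ℝ => π * (g - β₁ * d) / w) (β₁ * d) = π / w ∧
    0 < π / w := by
  have hd0 : d ≠ 0 := hd.ne'
  have hw0 : w ≠ 0 := hw.ne'
  have he : d - 1 ≠ 0 := sub_ne_zero.mpr hd1
  have hu : d * w ^ 2 - 1 ≠ 0 := by linarith
  have hu' : w ^ 2 * d - 1 ≠ 0 := by rw [mul_comm]; exact hu
  have hs : 0 < 1 / d - w ^ 2 := by
    have : 1 / d - w ^ 2 = (1 - d * w ^ 2) / d := by field_simp
    rw [this]; positivity
  have hβp : 0 < β₀ := by rw [hβ₀]; have := Real.sqrt_pos.mpr hs; positivity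
  have hβn : β₀ ≠ 0 := hβp.ne'
  have hβsq : β₀ ^ 2 = (1 - d * w ^ 2) / d ^ 3 := by
    rw [hβ₀, mul_pow, Real.sq_sqrt hs.le]; field_simp
  have hl : l₀ < 0 := by
    have : 0 ≤ d * w ^ 4 * (β₁ * d - γ₁) ^ 2 := by positivity
    linarith
  have hq : 0 ≤ l₀ / (w ^ 2 * d - 1) := by
    apply div_nonneg_of_nonpos hl.le; linarith
  have hrsq : rp ^ 2 = d ^ 4 / (d - 1) ^ 2 * (l₀ / (w ^ 2 * d - 1)) * w ^ 4 := by
    rw [hrp, mul_pow, mul_pow, div_pow, Real.sq_sqrt hq, ← pow_mul, ← pow_mul]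
  have hz : 2 * zs * (d - 1) * (w ^ 2 * d - 1) * β₀
      = d * w ^ 2 * (d * β₀ * α₁ + w ^ 2 * d * β₁ - w ^ 2 * γ₁) := by
    rw [hzs]; field_simp
  have e00 : (Dg₁ rp zs) 0 0 = 0 := by
    rw [hDg₁]
    simp only [hg₁]
    have h : HasDerivAt (fun r' : ℝ => -(r' * π * ((α₁ * d ^ 2 * w ^ 2 - 2 * zs * (d - 1) * (w ^ 2 * d - 1)) * d * β₀
          + d ^ 2 * w ^ 4 * (β₁ * d - γ₁))) / (d ^ 2 * w ^ 5)) _ rp :=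
      ((((hasDerivAt_id rp).mul_const π).mul_const _).neg).div_const _
    refine h.deriv.trans ?_
    rw [div_eq_zero_iff]; left
    linear_combination π * d * hz
  have e01 : (Dg₁ rp zs) 0 1 = 2 * rp * π * (d - 1) * (w ^ 2 * d - 1) * β₀ / (d * w ^ 5) := by
    rw [hDg₁]
    simp only [hg₁]
    have h : HasDerivAt (fun z' : ℝ => -(rp * π * ((α₁ * d ^ 2 * w ^ 2 - 2 * z' * (d - 1) * (w ^ 2 * d - 1)) * d * β₀
          + d ^ 2 * w ^ 4 * (β₁ * d - γ₁))) / (d ^ 2 * w ^ 5)) _ zs :=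
      (((((((((((hasDerivAt_id zs).const_mul 2).mul_const (d - 1)).mul_const (w ^ 2 * d - 1)).const_sub
        (α₁ * d ^ 2 * w ^ 2)).mul_const d).mul_const β₀).add_const
          (d ^ 2 * w ^ 4 * (β₁ * d - γ₁))).const_mul (rp * π)).neg).div_const _)
    refine h.deriv.trans ?_
    field_simp
  have e10 : (Dg₁ rp zs) 1 0 = -(β₀ * π * (d - 1) * rp) / (2 * d * w ^ 5 * (w ^ 2 * d - 1)) := by
    rw [hDg₁]
    simp only [hg₁]
    have h : HasDerivAt (fun r' : ℝ => β₀ * π * ((1 - d) * r' ^ 2 - 8 * (d - 1) * (d * w ^ 2 - 1) ^ 2 * zs ^ 2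
          + 8 * α₁ * d ^ 2 * w ^ 2 * (d * w ^ 2 - 1) * zs) / (4 * d * w ^ 5 * (d * w ^ 2 - 1))) _ rp :=
      (((((hasDerivAt_pow 2 rp).const_mul (1 - d)).sub_const _).add_const _).const_mul (β₀ * π)).div_const _
    refine h.deriv.trans ?_
    rw [mul_comm (w ^ 2) d]
    field_simp
    norm_num
    ring
  have e11 : (Dg₁ rp zs) 1 1 = 2 * (π * (γ₁ - β₁ * d) / w) := by
    rw [hDg₁]
    simp only [hg₁]
    have h : HasDerivAt (fun z' : ℝ => β₀ * π * ((1 - d) * rp ^ 2 - 8 * (d - 1) * (d * w ^ 2 - 1) ^ 2 * z' ^ 2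
          + 8 * α₁ * d ^ 2 * w ^ 2 * (d * w ^ 2 - 1) * z') / (4 * d * w ^ 5 * (d * w ^ 2 - 1))) _ zs :=
      (((((hasDerivAt_pow 2 zs).const_mul (8 * (d - 1) * (d * w ^ 2 - 1) ^ 2)).const_sub
        ((1 - d) * rp ^ 2)).add ((hasDerivAt_id zs).const_mul
          (8 * α₁ * d ^ 2 * w ^ 2 * (d * w ^ 2 - 1)))).const_mul (β₀ * π)).div_const _
    refine h.deriv.trans ?_
    have h4 : 4 * d * w ^ 5 * (d * w ^ 2 - 1) ≠ 0 := by positivity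
    have h5 : 2 * (π * (γ₁ - β₁ * d) / w) = (2 * π * (γ₁ - β₁ * d) * (4 * d * w ^ 4 * (d * w ^ 2 - 1)))
        / (4 * d * w ^ 5 * (d * w ^ 2 - 1)) := by
      rw [eq_div_iff h4]; field_simp
    rw [h5]
    congr 1
    push_cast
    norm_num
    linear_combination (-8 * π * (d * w ^ 2 - 1)) * hz
  have hdet : (Dg₁ rp zs) 0 0 * (Dg₁ rp zs) 1 1 - (Dg₁ rp zs) 0 1 * (Dg₁ rp zs) 1 0
      = -(π ^ 2 * l₀) / (d * w ^ 6) := by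
    rw [e00, e01, e10]
    have h1 : 0 * (Dg₁ rp zs) 1 1 - 2 * rp * π * (d - 1) * (w ^ 2 * d - 1) * β₀ / (d * w ^ 5) *
        (-(β₀ * π * (d - 1) * rp) / (2 * d * w ^ 5 * (w ^ 2 * d - 1)))
        = β₀ ^ 2 * rp ^ 2 * π ^ 2 * (d - 1) ^ 2 / (d ^ 2 * w ^ 10) := by
      field_simp; ring
    rw [h1, hβsq, hrsq]
    field_simp
    ring
  have htr : (Dg₁ rp zs) 0 0 + (Dg₁ rp zs) 1 1 = 2 * (π * (γ₁ - β₁ * d) / w) := by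
    rw [e00, e11, zero_add]
  have hpos : 0 < -(π ^ 2 * l₀) / (d * w ^ 6) - (π * (γ₁ - β₁ * d) / w) ^ 2 := by
    have : -(π ^ 2 * l₀) / (d * w ^ 6) - (π * (γ₁ - β₁ * d) / w) ^ 2
        = π ^ 2 * (-(d * w ^ 4 * (β₁ * d - γ₁) ^ 2) - l₀) / (d * w ^ 6) := by
      field_simp; ring
    rw [this]
    have h2 : 0 < -(d * w ^ 4 * (β₁ * d - γ₁) ^ 2) - l₀ := by linarith
    have := Real.pi_pos
    positivity
  refine ⟨?_, ?_, by simp, ?_, div_pos Real.pi_pos hw⟩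
  · set b := Real.sqrt (-(π ^ 2 * l₀) / (d * w ^ 6) - (π * (γ₁ - β₁ * d) / w) ^ 2) with hb
    have hb2 : b ^ 2 = _ := Real.sq_sqrt hpos.le
    have hbp : 0 < b := Real.sqrt_pos.mpr hpos
    refine ⟨⟨π * (γ₁ - β₁ * d) / w, b⟩, hbp.ne', ?_, ?_, rfl⟩
    · apply fhn_aux_pair _ _ _ htr
      rw [hdet, hb2]; ring
    · have : (starRingEnd ℂ) (⟨π * (γ₁ - β₁ * d) / w, b⟩ : ℂ) = ⟨π * (γ₁ - β₁ * d) / w, -b⟩ := by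
        apply Complex.ext <;> simp
      rw [this]
      apply fhn_aux_pair _ _ _ htr
      rw [hdet, neg_sq, hb2]; ring
  · intro hγ
    have hw2 : w₀ ^ 2 = -(π ^ 2 * l₀) / (d * w ^ 6) := by
      have h3 : 0 ≤ d * (1 - w ^ 2 * d) := by
        have : 0 ≤ 1 - w ^ 2 * d := by linarith
        positivity
      rw [hw₀, div_pow, mul_pow, mul_pow, mul_pow, Real.sq_sqrt h3, Real.sq_sqrt (by norm_num), sq_abs,
        hl₀, hγ]
      field_simp
      ring
    have htr0 : (Dg₁ rp zs) 0 0 + (Dg₁ rp zs) 1 1 = 2 * 0 := by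
      rw [htr, hγ]; simp
    have h1 : Complex.I * w₀ = ⟨0, w₀⟩ := by apply Complex.ext <;> simp
    have h2 : -(Complex.I * w₀) = ⟨0, -w₀⟩ := by apply Complex.ext <;> simp
    rw [h2, h1]
    constructor
    · apply fhn_aux_pair _ _ _ htr0
      rw [hdet, hw2]; ring
    · apply fhn_aux_pair _ _ _ htr0
      rw [hdet, neg_sq, hw2]; ring
  · have h : HasDerivAt (fun g : ℝ => π * (g - β₁ * d) / w) (π * 1 / w) (β₁ * d) :=
      (((hasDerivAt_id (β₁ * d)).sub_const _).const_mul π).div_const w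
    rw [h.deriv, mul_one]
end

section
/- Let w, α₁, β₂, γ₁, γ₂ be real numbers with w > 0, γ₁·(w² − 1) > 0, and set k₀ = (γ₁α₁ − w²γ₂ + β₂)(γ₁α₁ + w²γ₂ − β₂); assume k₀ > 0. Define g₂ : ℝ² → ℝ² by g₂¹(r,z) = rπ(2γ₁z − w²γ₁α₁ − 2w²γ₁z − w²β₂ + w⁴γ₂)/w⁵ and g₂²(r,z) = γ₁π((w² − 1)(r²w⁴ + 8z²) + 8w²α₁z)/(4w⁵). Set r⋆ = √2·√k₀ / |(w² − 1)γ₁| and z⋆ = w²(w²γ₂ − γ₁α₁ − β₂)/(2γ₁(w² − 1)). Then r⋆ > 0, g₂(r⋆, z⋆) = (0,0), and the determinant of the Jacobian matrix Dg₂ of g₂ at (r⋆, z⋆) equals 2π²·k₀/w⁶, which is nonzero. -/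
open Real

/-- The Class B1 second-order averaged function `g₂` has the positive zero
`(r⋆, z⋆)` and the determinant of its Jacobian there is `2π²k₀/w⁶ ≠ 0`. -/
theorem fhn_classB1_averaged_zero
    (w α₁ β₂ γ₁ γ₂ : ℝ) (hw : 0 < w) (hγ : γ₁ * (w ^ 2 - 1) > 0)
    (k₀ : ℝ) (hk₀ : k₀ = (γ₁ * α₁ - w ^ 2 * γ₂ + β₂) * (γ₁ * α₁ + w ^ 2 * γ₂ - β₂))
    (hk : k₀ > 0)
    (g₂ : ℝ → ℝ → ℝ × ℝ)
    (hg₂ : ∀ r z, g₂ r z =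
      (r * π * (2 * γ₁ * z - w ^ 2 * γ₁ * α₁ - 2 * w ^ 2 * γ₁ * z - w ^ 2 * β₂
          + w ^ 4 * γ₂) / w ^ 5,
       γ₁ * π * ((w ^ 2 - 1) * (r ^ 2 * w ^ 4 + 8 * z ^ 2) + 8 * w ^ 2 * α₁ * z)
          / (4 * w ^ 5)))
    (rs zs : ℝ)
    (hrs : rs = Real.sqrt 2 * Real.sqrt k₀ / |(w ^ 2 - 1) * γ₁|)
    (hzs : zs = w ^ 2 * (w ^ 2 * γ₂ - γ₁ * α₁ - β₂) / (2 * γ₁ * (w ^ 2 - 1)))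
    (Dg₂ : ℝ → ℝ → Matrix (Fin 2) (Fin 2) ℝ)
    (hDg₂ : ∀ r z, Dg₂ r z =
      ![![deriv (fun r' => (g₂ r' z).1) r, deriv (fun z' => (g₂ r z').1) z],
        ![deriv (fun r' => (g₂ r' z).2) r, deriv (fun z' => (g₂ r z').2) z]]) :
    0 < rs ∧ g₂ rs zs = (0, 0) ∧
    (Dg₂ rs zs).det = 2 * π ^ 2 * k₀ / w ^ 6 ∧
    (Dg₂ rs zs).det ≠ 0 := by
  have hm : (w ^ 2 - 1) * γ₁ ≠ 0 := by
    intro h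
    nlinarith
  have hr0 : 0 < rs := by
    rw [hrs]
    have := abs_pos.mpr hm
    positivity
  have hr2 : rs ^ 2 * ((w ^ 2 - 1) * γ₁) ^ 2 = 2 * k₀ := by
    rw [hrs, div_pow, mul_pow, Real.sq_sqrt (by norm_num), Real.sq_sqrt hk.le, sq_abs]
    exact div_mul_cancel₀ _ (pow_ne_zero 2 hm)
  have hz : 2 * γ₁ * (w ^ 2 - 1) * zs = w ^ 2 * (w ^ 2 * γ₂ - γ₁ * α₁ - β₂) := by
    rw [hzs]
    apply mul_div_cancel₀
    intro h
    apply hm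
    linarith
  have hw0 : w ≠ 0 := hw.ne'
  have hA : 2 * γ₁ * zs - w ^ 2 * γ₁ * α₁ - 2 * w ^ 2 * γ₁ * zs - w ^ 2 * β₂
          + w ^ 4 * γ₂ = 0 := by linear_combination -hz
  have hB : γ₁ * ((w ^ 2 - 1) * (rs ^ 2 * w ^ 4 + 8 * zs ^ 2) + 8 * w ^ 2 * α₁ * zs) = 0 := by
    apply (mul_eq_zero.mp _).resolve_left hm
    linear_combination w ^ 4 * hr2 + 2 * w ^ 4 * hk₀ +
      (2 * (2 * γ₁ * (w ^ 2 - 1) * zs + w ^ 2 * (w ^ 2 * γ₂ - γ₁ * α₁ - β₂))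
        + 4 * w ^ 2 * α₁ * γ₁) * hz
  have d1 : deriv (fun r' => (g₂ r' zs).1) rs = 0 := by
    simp only [hg₂, hA]
    simp
  have d2 : deriv (fun z' => (g₂ rs z').1) zs = rs * π * (-2 * ((w ^ 2 - 1) * γ₁)) / w ^ 5 := by
    have h : (fun z' => (g₂ rs z').1) = fun z' => (rs * π * (-2 * ((w ^ 2 - 1) * γ₁)) / w ^ 5) * z'
        + rs * π * (- w ^ 2 * γ₁ * α₁ - w ^ 2 * β₂ + w ^ 4 * γ₂) / w ^ 5 := by
      funext z'
      simp only [hg₂]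
      ring
    rw [h]
    simpa using (((hasDerivAt_id zs).const_mul
      (rs * π * (-2 * ((w ^ 2 - 1) * γ₁)) / w ^ 5)).add_const
      (rs * π * (- w ^ 2 * γ₁ * α₁ - w ^ 2 * β₂ + w ^ 4 * γ₂) / w ^ 5)).deriv
  have d3 : deriv (fun r' => (g₂ r' zs).2) rs
      = γ₁ * π * (w ^ 2 - 1) * w ^ 4 / (4 * w ^ 5) * (2 * rs) := by
    have h : (fun r' => (g₂ r' zs).2) = fun r' => (γ₁ * π * (w ^ 2 - 1) * w ^ 4 / (4 * w ^ 5))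
        * r' ^ 2 + γ₁ * π * ((w ^ 2 - 1) * (8 * zs ^ 2) + 8 * w ^ 2 * α₁ * zs) / (4 * w ^ 5) := by
      funext r'
      simp only [hg₂]
      ring
    rw [h]
    simpa using (((hasDerivAt_pow 2 rs).const_mul
      (γ₁ * π * (w ^ 2 - 1) * w ^ 4 / (4 * w ^ 5))).add_const
      (γ₁ * π * ((w ^ 2 - 1) * (8 * zs ^ 2) + 8 * w ^ 2 * α₁ * zs) / (4 * w ^ 5))).deriv
  have hdet : (Dg₂ rs zs).det = 2 * π ^ 2 * k₀ / w ^ 6 := by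
    rw [hDg₂, d1, d2, d3, show 2 * π ^ 2 * k₀ = π ^ 2 * (2 * k₀) by ring, ← hr2]
    generalize deriv (fun z' => (g₂ rs z').2) zs = q
    have := Matrix.det_fin_two_of (0 : ℝ) (rs * π * (-2 * ((w ^ 2 - 1) * γ₁)) / w ^ 5)
      (γ₁ * π * (w ^ 2 - 1) * w ^ 4 / (4 * w ^ 5) * (2 * rs)) q
    refine Eq.trans this ?_
    field_simp
    ring
  refine ⟨hr0, ?_, hdet, ?_⟩
  · rw [hg₂, hA]
    refine Prod.ext ?_ ?_
    · simp
    · show _ / _ = (0 : ℝ)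
      rw [mul_right_comm, hB]
      simp
  · rw [hdet]
    have := Real.pi_pos
    positivity
end

section
/- Under the hypotheses and notation of the Class B1 second-order averaged function (w > 0, γ₁(w² − 1) > 0, k₀ = (γ₁α₁ − w²γ₂ + β₂)(γ₁α₁ + w²γ₂ − β₂) > 0, and g₂, r⋆, z⋆ as defined there), the characteristic polynomial of the 2×2 Jacobian matrix Dg₂ of g₂ evaluated at (r⋆, z⋆) equals X² + (2π(β₂ − γ₂w²)/w³)·X + 2π²·k₀/w⁶. -/
open Real Polynomial

/-- The characteristic polynomial of the Jacobian of the Class B1 second-order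
averaged function `g₂` at `(r⋆, z⋆)` is
`X² + (2π(β₂ - γ₂w²)/w³)·X + 2π²k₀/w⁶`. -/
theorem fhn_classB1_averaged_jacobian_charpoly
    (w α₁ β₂ γ₁ γ₂ : ℝ) (hw : 0 < w) (hγ : γ₁ * (w ^ 2 - 1) > 0)
    (k₀ : ℝ) (hk₀ : k₀ = (γ₁ * α₁ - w ^ 2 * γ₂ + β₂) * (γ₁ * α₁ + w ^ 2 * γ₂ - β₂))
    (hk : k₀ > 0)
    (g₂ : ℝ → ℝ → ℝ × ℝ)
    (hg₂ : ∀ r z, g₂ r z =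
      (r * π * (2 * γ₁ * z - w ^ 2 * γ₁ * α₁ - 2 * w ^ 2 * γ₁ * z - w ^ 2 * β₂
          + w ^ 4 * γ₂) / w ^ 5,
       γ₁ * π * ((w ^ 2 - 1) * (r ^ 2 * w ^ 4 + 8 * z ^ 2) + 8 * w ^ 2 * α₁ * z)
          / (4 * w ^ 5)))
    (rs zs : ℝ)
    (hrs : rs = Real.sqrt 2 * Real.sqrt k₀ / |(w ^ 2 - 1) * γ₁|)
    (hzs : zs = w ^ 2 * (w ^ 2 * γ₂ - γ₁ * α₁ - β₂) / (2 * γ₁ * (w ^ 2 - 1)))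
    (Dg₂ : ℝ → ℝ → Matrix (Fin 2) (Fin 2) ℝ)
    (hDg₂ : ∀ r z, Dg₂ r z =
      ![![deriv (fun r' => (g₂ r' z).1) r, deriv (fun z' => (g₂ r z').1) z],
        ![deriv (fun r' => (g₂ r' z).2) r, deriv (fun z' => (g₂ r z').2) z]]) :
    (Dg₂ rs zs).charpoly
      = X ^ 2 + C (2 * π * (β₂ - γ₂ * w ^ 2) / w ^ 3) * X + C (2 * π ^ 2 * k₀ / w ^ 6) := by
  have hw0 : w ≠ 0 := hw.ne'
  have hne : γ₁ * (w ^ 2 - 1) ≠ 0 := hγ.ne'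
  have hγ0 : γ₁ ≠ 0 := left_ne_zero_of_mul hne
  have hw1 : w ^ 2 - 1 ≠ 0 := right_ne_zero_of_mul hne
  have hr2 : rs ^ 2 * ((w ^ 2 - 1) * γ₁) ^ 2 = 2 * k₀ := by
    have h1 : |(w ^ 2 - 1) * γ₁| ≠ 0 := abs_ne_zero.mpr (mul_ne_zero hw1 hγ0)
    rw [← sq_abs ((w ^ 2 - 1) * γ₁), hrs, div_pow, mul_pow, Real.sq_sqrt (by norm_num),
      Real.sq_sqrt hk.le]
    field_simp
  have hz : zs * (2 * γ₁ * (w ^ 2 - 1)) = w ^ 2 * (w ^ 2 * γ₂ - γ₁ * α₁ - β₂) := by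
    rw [hzs]; field_simp
  have d11 : deriv (fun r' => (g₂ r' zs).1) rs = 0 := by
    have : (fun r' => (g₂ r' zs).1) = fun _ => (0 : ℝ) := by
      funext r'
      rw [hg₂]
      have : 2 * γ₁ * zs - w ^ 2 * γ₁ * α₁ - 2 * w ^ 2 * γ₁ * zs - w ^ 2 * β₂
          + w ^ 4 * γ₂ = 0 := by linear_combination -hz
      simp [this]
    rw [this]; simp
  have d12 : deriv (fun z' => (g₂ rs z').1) zs
      = rs * π * (2 * γ₁ * (1 - w ^ 2)) / w ^ 5 := by
    have : (fun z' => (g₂ rs z').1) = fun z' => (rs * π * (2 * γ₁ * (1 - w ^ 2)) / w ^ 5) * z'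
        + rs * π * (- w ^ 2 * γ₁ * α₁ - w ^ 2 * β₂ + w ^ 4 * γ₂) / w ^ 5 := by
      funext z'
      rw [hg₂]
      ring
    rw [this]
    have h := ((hasDerivAt_id zs).const_mul (rs * π * (2 * γ₁ * (1 - w ^ 2)) / w ^ 5)).add_const
      (rs * π * (- w ^ 2 * γ₁ * α₁ - w ^ 2 * β₂ + w ^ 4 * γ₂) / w ^ 5)
    simp
  have d21 : deriv (fun r' => (g₂ r' zs).2) rs
      = γ₁ * π * (w ^ 2 - 1) * rs / (2 * w) := by
    have : (fun r' => (g₂ r' zs).2) = fun r' => (γ₁ * π * (w ^ 2 - 1) / (4 * w)) * r' ^ 2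
        + γ₁ * π * ((w ^ 2 - 1) * (8 * zs ^ 2) + 8 * w ^ 2 * α₁ * zs) / (4 * w ^ 5) := by
      funext r'
      rw [hg₂]
      field_simp
      ring
    rw [this]
    have h := ((hasDerivAt_pow 2 rs).const_mul (γ₁ * π * (w ^ 2 - 1) / (4 * w))).add_const
      (γ₁ * π * ((w ^ 2 - 1) * (8 * zs ^ 2) + 8 * w ^ 2 * α₁ * zs) / (4 * w ^ 5))
    rw [h.deriv]
    field_simp
    norm_num
    ring
  have d22 : deriv (fun z' => (g₂ rs z').2) zs
      = 2 * π * (γ₂ * w ^ 2 - β₂) / w ^ 3 := by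
    have : (fun z' => (g₂ rs z').2) = fun z' => (2 * γ₁ * π * (w ^ 2 - 1) / w ^ 5) * z' ^ 2
        + (2 * γ₁ * π * α₁ / w ^ 3) * z' + γ₁ * π * (w ^ 2 - 1) * rs ^ 2 / (4 * w) := by
      funext z'
      rw [hg₂]
      field_simp
      ring
    rw [this]
    have h := (((hasDerivAt_pow 2 zs).const_mul (2 * γ₁ * π * (w ^ 2 - 1) / w ^ 5)).add
      ((hasDerivAt_id zs).const_mul (2 * γ₁ * π * α₁ / w ^ 3))).add_const
      (γ₁ * π * (w ^ 2 - 1) * rs ^ 2 / (4 * w))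
    refine h.deriv.trans ?_
    field_simp
    norm_num
    linear_combination hz
  have htr : (Dg₂ rs zs).trace = -(2 * π * (β₂ - γ₂ * w ^ 2) / w ^ 3) := by
    rw [Matrix.trace_fin_two, hDg₂, d11, d12, d21, d22]
    simp
    ring
  have hdet : (Dg₂ rs zs).det = 2 * π ^ 2 * k₀ / w ^ 6 := by
    rw [Matrix.det_fin_two, hDg₂, d11, d12, d21, d22]
    simp
    field_simp
    linear_combination hr2
  rw [Matrix.charpoly_fin_two, htr, hdet, C_neg]
  ring
end

section
/- Let w > 0 and let αᵢ, βᵢ, γᵢ (i = 1,…,5) be real numbers with d = 1/w², β₁ = γ₁·w², γ₁·(w² − 1) > 0, and k₀ = (γ₁α₁ − w²γ₂ + β₂)(γ₁α₁ + w²γ₂ − β₂) > 0. For ε ∈ ℝ define a(ε) = −w² + Σᵢ₌₁⁵ εⁱαᵢ, b(ε) = Σᵢ₌₁⁵ εⁱβᵢ, c(ε) = Σᵢ₌₁⁵ εⁱγᵢ. Then for every δ > 0 there exists ε₀ > 0 such that for all ε with 0 < |ε| < ε₀, the FitzHugh–Nagumo system ẋ = z, ẏ = b(ε)(x − d y), ż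 = (x − a(ε))(x − 1)x + y + c(ε) z admits a nonconstant periodic solution φ : ℝ → ℝ³ (differentiable, satisfying the system at every time, and T-periodic for some T > 0) whose image is contained in the open ball of radius δ centered at the origin. -/
section FHN
open Filter Topology

/-- Data for the reduced problem. -/
structure FhnOps (E : Type) [NormedCommRing E] [NormedAlgebra ℝ E] where
  co : E
  si : E
  I : E →L[ℝ] ℝ
  J : E →L[ℝ] E
  S : E →L[ℝ] E
  S' : E →L[ℝ] E
  I_one : I 1 = 1
  I_co : I co = 0
  I_co2 : I (co ^ 2) = 1 / 2
  I_co3 : I (co ^ 3) = 0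
  I_si2 : I (si ^ 2) = 1 / 2

variable {E : Type} [NormedCommRing E] [NormedAlgebra ℝ E]

noncomputable def fhnU (O : FhnOps E) (p : ℝ × E × ℝ × ℝ × ℝ) : E :=
  p.2.2.1 • (1 : E) + p.2.2.2.1 • O.co + p.1 • O.S p.2.1

noncomputable def fhnV (O : FhnOps E) (p : ℝ × E × ℝ × ℝ × ℝ) : E :=
  p.1 • O.S' p.2.1 - p.2.2.2.1 • O.si

noncomputable def fhnTau (w : ℝ) (p : ℝ × E × ℝ × ℝ × ℝ) : ℝ :=
  w⁻¹ * (1 + p.1 * p.2.2.2.2)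

noncomputable def fhnQ (O : FhnOps E) (w : ℝ) (A : ℝ → ℝ) (p : ℝ × E × ℝ × ℝ × ℝ) : E :=
  A p.1 • fhnU O p - (1 - w ^ 2 + p.1 * A p.1) • fhnU O p ^ 2 + p.1 • fhnU O p ^ 3

noncomputable def fhnN (O : FhnOps E) (w : ℝ) (A B C K : ℝ → ℝ) (p : ℝ × E × ℝ × ℝ × ℝ) : E :=
  (fhnTau w p ^ 2) • fhnQ O w A p
    - (2 * p.2.2.2.2 + p.1 * p.2.2.2.2 ^ 2) • fhnU O p
    + p.1 • ((K p.1 * fhnTau w p) • fhnV O p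
      + (B p.1 * C p.1 * fhnTau w p ^ 2) • fhnU O p
      + (B p.1 * fhnTau w p ^ 3) • O.J (fhnQ O w A p))

noncomputable def fhnG (O : FhnOps E) (w : ℝ) (A B C K : ℝ → ℝ) (p : ℝ × E × ℝ × ℝ × ℝ) :
    E × ℝ × ℝ × ℝ :=
  (p.2.1 - fhnN O w A B C K p, O.I (p.2.1 * O.co), O.I (fhnQ O w A p),
    K p.1 * O.I (fhnV O p ^ 2) - B p.1 * fhnTau w p ^ 2 * O.I (fhnU O p * fhnQ O w A p))

theorem fhnU_contDiff (O : FhnOps E) : ContDiff ℝ 1 (fhnU O) := by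
  unfold fhnU; fun_prop

theorem fhnV_contDiff (O : FhnOps E) : ContDiff ℝ 1 (fhnV O) := by
  unfold fhnV; fun_prop

theorem fhnTau_contDiff (w : ℝ) : ContDiff ℝ 1 (fhnTau (E := E) w) := by
  unfold fhnTau; fun_prop

theorem fhnQ_contDiff (O : FhnOps E) (w : ℝ) (A : ℝ → ℝ) (hA : ContDiff ℝ 1 A) :
    ContDiff ℝ 1 (fhnQ O w A) := by
  have := fhnU_contDiff O
  unfold fhnQ; fun_prop

theorem fhnG_contDiff (O : FhnOps E) (w : ℝ) (A B C K : ℝ → ℝ) (hA : ContDiff ℝ 1 A)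
    (hB : ContDiff ℝ 1 B) (hC : ContDiff ℝ 1 C) (hK : ContDiff ℝ 1 K) :
    ContDiff ℝ 1 (fhnG O w A B C K) := by
  have h1 := fhnU_contDiff O
  have h2 := fhnV_contDiff O
  have h3 := fhnTau_contDiff (E := E) w
  have h4 := fhnQ_contDiff O w A hA
  unfold fhnG fhnN; fun_prop

theorem fhnG_zero (O : FhnOps E) (w : ℝ) (A B C K : ℝ → ℝ) (f : E) (m r s : ℝ) :
    fhnG O w A B C K (0, f, m, r, s) =
      (f + (2 * s * m - (w⁻¹) ^ 2 * (A 0 * m - (1 - w ^ 2) * m ^ 2)) • (1 : E)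
        + (2 * s * r - (w⁻¹) ^ 2 * (A 0 * r - (1 - w ^ 2) * (2 * m * r))) • O.co
        + ((w⁻¹) ^ 2 * (1 - w ^ 2) * r ^ 2) • O.co ^ 2,
       O.I (f * O.co),
       A 0 * m - (1 - w ^ 2) * (m ^ 2 + r ^ 2 / 2),
       K 0 * (r ^ 2 / 2) - B 0 * (w⁻¹) ^ 2 * (A 0 * (m ^ 2 + r ^ 2 / 2)
        - (1 - w ^ 2) * (m ^ 3 + 3 / 2 * m * r ^ 2))) := by
  have e2 : (m • (1 : E) + r • O.co) ^ 2
      = (m ^ 2) • (1 : E) + (2 * m * r) • O.co + (r ^ 2) • O.co ^ 2 := by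
    simp only [Algebra.smul_def, map_mul, map_pow, map_ofNat]; ring
  have e3 : (m • (1 : E) + r • O.co) ^ 3
      = (m ^ 3) • (1 : E) + (3 * m ^ 2 * r) • O.co + (3 * m * r ^ 2) • O.co ^ 2
        + (r ^ 3) • O.co ^ 3 := by
    simp only [Algebra.smul_def, map_mul, map_pow, map_ofNat]; ring
  have hU : fhnU O (0, f, m, r, s) = m • (1 : E) + r • O.co := by simp [fhnU]
  have hV : fhnV O (0, f, m, r, s) = - (r • O.si) := by simp [fhnV]
  have hT : fhnTau w (0, f, m, r, s) = w⁻¹ := by simp [fhnTau]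
  have hQ : fhnQ O w A (0, f, m, r, s) = A 0 • (m • (1 : E) + r • O.co)
      - (1 - w ^ 2) • (m • (1 : E) + r • O.co) ^ 2 := by simp [fhnQ, hU]
  have hUQ : fhnU O (0, f, m, r, s) * fhnQ O w A (0, f, m, r, s)
      = A 0 • (m • (1 : E) + r • O.co) ^ 2 - (1 - w ^ 2) • (m • (1 : E) + r • O.co) ^ 3 := by
    rw [hQ, hU]; simp only [Algebra.smul_def]; ring
  have hV2 : fhnV O (0, f, m, r, s) ^ 2 = (r ^ 2) • O.si ^ 2 := by
    rw [hV]; simp only [Algebra.smul_def, map_pow]; ring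
  unfold fhnG fhnN
  rw [hUQ, hV2, hQ, hU, hT, e2, e3]
  simp only [map_add, map_sub, map_smul, O.I_one, O.I_co, O.I_co2, O.I_co3, O.I_si2, smul_eq_mul,
    Prod.mk.injEq, zero_smul, zero_mul, add_zero, true_and]
  refine ⟨?_, ?_, ?_⟩
  · module
  · ring
  · ring

theorem fhn_ift [CompleteSpace E] (O : FhnOps E) (w : ℝ) (A B C K : ℝ → ℝ) (hA : ContDiff ℝ 1 A)
    (hB : ContDiff ℝ 1 B) (hC : ContDiff ℝ 1 C) (hK : ContDiff ℝ 1 K)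
    (hw : 0 < w) (hw1 : 1 - w ^ 2 ≠ 0) (hB0 : B 0 ≠ 0)
    (hk : 0 < (B 0 * A 0 - w ^ 2 * K 0) * (B 0 * A 0 + w ^ 2 * K 0)) :
    ∃ (x₀ : E × ℝ × ℝ × ℝ) (ψ : ℝ → E × ℝ × ℝ × ℝ), x₀.2.2.1 ≠ 0 ∧ Tendsto ψ (𝓝 0) (𝓝 x₀) ∧
      ∀ᶠ ε in 𝓝 0, fhnG O w A B C K (ε, ψ ε) = 0 := by
  obtain ⟨q, hq⟩ : ∃ q, q = 1 - w ^ 2 := ⟨_, rfl⟩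
  obtain ⟨v, hv⟩ : ∃ v, v = (w⁻¹) ^ 2 := ⟨_, rfl⟩
  have hv0 : v ≠ 0 := by rw [hv]; positivity
  have hvw : v * w ^ 2 = 1 := by rw [hv]; field_simp
  rw [← hq] at hw1
  obtain ⟨m, hm⟩ : ∃ m, m = (B 0 * A 0 - w ^ 2 * K 0) / (2 * B 0 * q) := ⟨_, rfl⟩
  obtain ⟨r, hr⟩ : ∃ r, r = √(((B 0 * A 0 - w ^ 2 * K 0) * (B 0 * A 0 + w ^ 2 * K 0))
    / (2 * (B 0 * q) ^ 2)) := ⟨_, rfl⟩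
  have hr0 : 0 < r := by rw [hr]; positivity
  have hr2 : r ^ 2 = ((B 0 * A 0 - w ^ 2 * K 0) * (B 0 * A 0 + w ^ 2 * K 0))
    / (2 * (B 0 * q) ^ 2) := by rw [hr]; exact Real.sq_sqrt (by positivity)
  have h3 : A 0 * m - q * (m ^ 2 + r ^ 2 / 2) = 0 := by
    rw [hr2, hm]; field_simp; ring
  have h4' : K 0 = B 0 * v * (A 0 - 2 * q * m) := by
    have : w ^ 2 * K 0 = B 0 * (A 0 - 2 * q * m) := by rw [hm]; field_simp; ring
    calc K 0 = v * w ^ 2 * K 0 := by rw [hvw, one_mul]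
      _ = v * (w ^ 2 * K 0) := by ring
      _ = _ := by rw [this]; ring
  have h4 : K 0 * (r ^ 2 / 2) - B 0 * v * (A 0 * (m ^ 2 + r ^ 2 / 2)
        - q * (m ^ 3 + 3 / 2 * m * r ^ 2)) = 0 := by
    rw [h4']; linear_combination (- B 0 * v * m) * h3
  obtain ⟨s, hs⟩ : ∃ s, s = v * (A 0 - 2 * q * m) / 2 := ⟨_, rfl⟩
  obtain ⟨f, hf⟩ : ∃ f : E, f = -((2 * s * m - v * (A 0 * m - q * m ^ 2)) • (1 : E)
        + (2 * s * r - v * (A 0 * r - q * (2 * m * r))) • O.co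
        + (v * q * r ^ 2) • O.co ^ 2) := ⟨_, rfl⟩
  have hG0 : fhnG O w A B C K (0, f, m, r, s) = 0 := by
    rw [fhnG_zero, ← hq, ← hv, h3, h4]
    have : O.I (f * O.co) = 0 := by
      have : f * O.co = -((2 * s * m - v * (A 0 * m - q * m ^ 2)) • O.co
        + (2 * s * r - v * (A 0 * r - q * (2 * m * r))) • O.co ^ 2
        + (v * q * r ^ 2) • O.co ^ 3) := by
        rw [hf]; simp only [Algebra.smul_def]; ring
      rw [this]
      simp only [map_add, map_neg, map_smul, O.I_co, O.I_co2, O.I_co3, smul_eq_mul, hs]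
      ring
    rw [this, hf]
    ext <;> simp
    abel
  have hstrict : HasStrictFDerivAt (fhnG O w A B C K)
      (fderiv ℝ (fhnG O w A B C K) (0, f, m, r, s)) (0, f, m, r, s) :=
    (fhnG_contDiff O w A B C K hA hB hC hK).contDiffAt.hasStrictFDerivAt (by norm_num)
  set G' := fderiv ℝ (fhnG O w A B C K) (0, f, m, r, s) with hG'
  set D := G' ∘L .inr ℝ ℝ (E × ℝ × ℝ × ℝ) with hDdef
  have hD : ∀ (g : E) (a b c : ℝ), D (g, a, b, c) =
      (g + (2 * (c * m + s * a) - v * (A 0 * a - q * (2 * m * a))) • (1 : E)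
        + (2 * (c * r + s * b) - v * (A 0 * b - q * (2 * (a * r + m * b)))) • O.co
        + (v * q * (2 * r * b)) • O.co ^ 2,
       O.I (g * O.co),
       A 0 * a - q * (2 * m * a + r * b),
       K 0 * (r * b) - B 0 * v * (A 0 * (2 * m * a + r * b)
        - q * (3 * m ^ 2 * a + 3 / 2 * (a * r ^ 2 + m * (2 * r * b))))) := by
    intro g a b c
    have hc : HasDerivAt (fun t : ℝ => ((0 : ℝ), f + t • g, m + t * a, r + t * b, s + t * c))
        ((0 : ℝ), g, a, b, c) 0 := by
      refine (hasDerivAt_const _ _).prodMk (HasDerivAt.prodMk ?_ (HasDerivAt.prodMk ?_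
        (HasDerivAt.prodMk ?_ ?_)))
      · simpa using ((hasDerivAt_id (0 : ℝ)).smul_const g).const_add f
      · simpa using ((hasDerivAt_id (0 : ℝ)).mul_const a).const_add m
      · simpa using ((hasDerivAt_id (0 : ℝ)).mul_const b).const_add r
      · simpa using ((hasDerivAt_id (0 : ℝ)).mul_const c).const_add s
    have hL : HasDerivAt (fun t : ℝ => fhnG O w A B C K
        ((0 : ℝ), f + t • g, m + t * a, r + t * b, s + t * c)) (D (g, a, b, c)) 0 := by
      have hst : HasFDerivAt (fhnG O w A B C K) G'
        ((fun t : ℝ => ((0 : ℝ), f + t • g, m + t * a, r + t * b, s + t * c)) 0) := by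
        simpa using hstrict.hasFDerivAt
      exact hst.comp_hasDerivAt 0 hc
    have hpoly : ∀ {F : Type} [NormedAddCommGroup F] [NormedSpace ℝ F] (z0 z1 z2 z3 : F),
        HasDerivAt (fun t : ℝ => z0 + t • z1 + t ^ 2 • z2 + t ^ 3 • z3) z1 0 := by
      intro F _ _ z0 z1 z2 z3
      have h1 := ((hasDerivAt_id (0 : ℝ)).smul_const z1).const_add z0
      have h2 := ((hasDerivAt_id (0 : ℝ)).pow 2).smul_const z2
      have h3 := ((hasDerivAt_id (0 : ℝ)).pow 3).smul_const z3
      have h := (h1.add h2).add h3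
      simp at h
      exact h
    refine hL.unique ?_
    simp only [fhnG_zero, ← hq, ← hv]
    refine HasDerivAt.prodMk ?_ (HasDerivAt.prodMk ?_ (HasDerivAt.prodMk ?_ ?_))
    · refine (hpoly (f + (2 * s * m - v * (A 0 * m - q * m ^ 2)) • (1 : E)
        + (2 * s * r - v * (A 0 * r - q * (2 * m * r))) • O.co
        + (v * q * r ^ 2) • O.co ^ 2) _
        ((2 * c * a + v * q * a ^ 2) • (1 : E)
          + (2 * c * b + v * q * (2 * a * b)) • O.co + (v * q * b ^ 2) • O.co ^ 2) 0).congr_of_eventuallyEq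
        (Eventually.of_forall fun t => ?_)
      dsimp only
      module
    · have := hpoly (O.I (f * O.co)) (O.I (g * O.co)) 0 0
      refine this.congr_of_eventuallyEq (Eventually.of_forall fun t => ?_)
      simp [add_mul]
    · refine (hpoly (A 0 * m - q * (m ^ 2 + r ^ 2 / 2)) _ (- q * (a ^ 2 + b ^ 2 / 2)) 0).congr_of_eventuallyEq
        (Eventually.of_forall fun t => ?_)
      simp only [smul_eq_mul]; ring
    · refine (hpoly (K 0 * (r ^ 2 / 2) - B 0 * v * (A 0 * (m ^ 2 + r ^ 2 / 2)
        - q * (m ^ 3 + 3 / 2 * m * r ^ 2))) _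
        (K 0 * (b ^ 2 / 2) - B 0 * v * (A 0 * (a ^ 2 + b ^ 2 / 2)
        - q * (3 * m * a ^ 2 + 3 / 2 * (m * b ^ 2 + a * 2 * r * b))))
        (B 0 * v * q * (a ^ 3 + 3 / 2 * a * b ^ 2))).congr_of_eventuallyEq
        (Eventually.of_forall fun t => ?_)
      simp only [smul_eq_mul]; ring
  -- row combination
  have hrow : ∀ a b : ℝ, K 0 * (r * b) - B 0 * v * (A 0 * (2 * m * a + r * b)
        - q * (3 * m ^ 2 * a + 3 / 2 * (a * r ^ 2 + m * (2 * r * b))))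
      = B 0 * v * (q * r ^ 2 * a - m * (A 0 * a - q * (2 * m * a + r * b))) := by
    intro a b
    rw [h4']
    linear_combination (- B 0 * v * a) * h3
  have hBv : B 0 * v ≠ 0 := mul_ne_zero hB0 hv0
  have hqr : q * r ^ 2 ≠ 0 := mul_ne_zero hw1 (by positivity)
  have hIE : ∀ c0 c1 c2 : ℝ, O.I ((c0 • (1 : E) + c1 • O.co + c2 • O.co ^ 2) * O.co) = c1 / 2 := by
    intro c0 c1 c2
    have : (c0 • (1 : E) + c1 • O.co + c2 • O.co ^ 2) * O.co
        = c0 • O.co + c1 • O.co ^ 2 + c2 • O.co ^ 3 := by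
      simp only [Algebra.smul_def]; ring
    rw [this]
    simp only [map_add, map_smul, O.I_co, O.I_co2, O.I_co3, smul_eq_mul]
    ring
  have hinj : D.ker = ⊥ := by
    rw [LinearMap.ker_eq_bot']
    rintro ⟨g, a, b, c⟩ h
    have h : D (g, a, b, c) = 0 := h
    rw [hD, hrow] at h
    simp only [Prod.mk_eq_zero] at h
    obtain ⟨e1, e2, e3, e4⟩ := h
    rw [e3] at e4
    have ha : a = 0 := by
      have := (mul_eq_zero.mp e4).resolve_left hBv
      have h' : q * r ^ 2 * a = 0 := by linarith
      exact (mul_eq_zero.mp h').resolve_left hqr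
    subst ha
    have hb : b = 0 := by
      have h' : (q * r) * b = 0 := by linarith
      exact (mul_eq_zero.mp h').resolve_left (mul_ne_zero hw1 hr0.ne')
    subst hb
    have hg : g = -((2 * (c * m)) • (1 : E) + (2 * (c * r)) • O.co + (0 : ℝ) • O.co ^ 2) := by
      rw [eq_neg_iff_add_eq_zero, ← e1]; module
    have hc : c = 0 := by
      rw [hg, neg_mul, map_neg, hIE] at e2
      have h' : r * c = 0 := by linarith
      exact (mul_eq_zero.mp h').resolve_left hr0.ne'
    subst hc
    simp [hg]
  have hsurj : D.range = ⊤ := by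
    rw [LinearMap.range_eq_top]
    rintro ⟨g, y2, y3, y4⟩
    obtain ⟨a, ha⟩ : ∃ a, a = (y4 / (B 0 * v) + m * y3) / (q * r ^ 2) := ⟨_, rfl⟩
    obtain ⟨b, hb⟩ : ∃ b, b = (A 0 * a - q * (2 * m * a) - y3) / (q * r) := ⟨_, rfl⟩
    obtain ⟨c, hc⟩ : ∃ c, c = (O.I (g * O.co) - y2 - s * b
      + v * (A 0 * b - q * (2 * (a * r + m * b))) / 2) / r := ⟨_, rfl⟩
    refine ⟨(g - ((2 * (c * m + s * a) - v * (A 0 * a - q * (2 * m * a))) • (1 : E)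
        + (2 * (c * r + s * b) - v * (A 0 * b - q * (2 * (a * r + m * b)))) • O.co
        + (v * q * (2 * r * b)) • O.co ^ 2), a, b, c), ?_⟩
    have e3 : A 0 * a - q * (2 * m * a + r * b) = y3 := by
      rw [hb]; field_simp; ring
    change D _ = _
    rw [hD, hrow, e3, sub_mul, map_sub, hIE]
    simp only [Prod.mk.injEq, true_and]
    refine ⟨?_, ?_, ?_⟩
    · module
    · rw [hc]; field_simp; ring
    · rw [ha]; field_simp; ring
  have hinv : D.IsInvertible :=
    ⟨ContinuousLinearEquiv.ofBijective D hinj hsurj, ContinuousLinearEquiv.coe_ofBijective D hinj hsurj⟩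
  refine ⟨(f, m, r, s), hstrict.implicitFunctionOfProdDomain hinv, hr0.ne',
    hstrict.tendsto_implicitFunctionOfProdDomain hinv, ?_⟩
  have := hstrict.eventually_apply_implicitFunctionOfProdDomain hinv
  rwa [hG0] at this

end FHN
section FHN2
open Filter Topology

instance fhnFact : Fact (0 < 2 * Real.pi) := ⟨Real.two_pi_pos⟩

/-- Continuous functions on the circle. -/
abbrev FhnE : Type := C(AddCircle (2 * Real.pi), ℝ)

noncomputable def fhnMk (g : ℝ → ℝ) (hc : Continuous g) (hp : Function.Periodic g (2 * Real.pi)) :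
    FhnE :=
  ⟨hp.lift, continuous_coinduced_dom.mpr hc⟩

theorem fhnMk_apply (g : ℝ → ℝ) (hc : Continuous g) (hp : Function.Periodic g (2 * Real.pi))
    (θ : ℝ) : fhnMk g hc hp (θ : AddCircle (2 * Real.pi)) = g θ := rfl

theorem fhn_cont (f : FhnE) : Continuous (fun θ : ℝ => f (θ : AddCircle (2 * Real.pi))) :=
  f.continuous.comp (AddCircle.continuous_mk' _)

theorem fhn_per (f : FhnE) :
    Function.Periodic (fun θ : ℝ => f (θ : AddCircle (2 * Real.pi))) (2 * Real.pi) := by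
  intro θ
  simp only [AddCircle.coe_add_period]

noncomputable def fhnI : FhnE →L[ℝ] ℝ :=
  LinearMap.mkContinuous
    { toFun := fun f : FhnE => (2 * Real.pi)⁻¹ * ∫ t in (0 : ℝ)..(2 * Real.pi), f (t : AddCircle (2 * Real.pi))
      map_add' := by
        intro f g
        simp only [ContinuousMap.add_apply]
        rw [intervalIntegral.integral_add ((fhn_cont f).intervalIntegrable _ _)
          ((fhn_cont g).intervalIntegrable _ _)]
        ring
      map_smul' := by
        intro c f
        simp only [ContinuousMap.smul_apply, smul_eq_mul, intervalIntegral.integral_const_mul,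
          RingHom.id_apply]
        ring } 1 (by
    intro f
    have h := intervalIntegral.norm_integral_le_of_norm_le_const (a := 0) (b := 2 * Real.pi)
      (f := fun t : ℝ => f (t : AddCircle (2 * Real.pi))) (C := ‖f‖) (fun x _ => f.norm_coe_le_norm _)
    have hpi := Real.two_pi_pos
    simp only [LinearMap.coe_mk, AddHom.coe_mk]
    rw [norm_mul, norm_inv]
    rw [sub_zero, abs_of_pos hpi] at h
    rw [Real.norm_of_nonneg hpi.le, one_mul, inv_mul_le_iff₀ hpi]
    linarith)

theorem fhnI_apply (f : FhnE) : fhnI f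
    = (2 * Real.pi)⁻¹ * ∫ t in (0 : ℝ)..(2 * Real.pi), f (t : AddCircle (2 * Real.pi)) := rfl

theorem fhnI_deriv (h g : FhnE) (hd : ∀ θ : ℝ, HasDerivAt
    (fun θ : ℝ => h (θ : AddCircle (2 * Real.pi))) (g (θ : AddCircle (2 * Real.pi))) θ) :
    fhnI g = 0 := by
  rw [fhnI_apply, intervalIntegral.integral_eq_sub_of_hasDerivAt (fun x _ => hd x)
    ((fhn_cont g).intervalIntegrable _ _)]
  have := fhn_per h 0
  simp only [zero_add] at this
  rw [this]; simp

theorem fhnI_bound (f : FhnE) : |fhnI f| ≤ ‖f‖ := by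
  have h := fhnI.le_opNorm f
  have h2 : ‖fhnI‖ ≤ 1 := LinearMap.mkContinuous_norm_le _ zero_le_one _
  rw [Real.norm_eq_abs] at h
  nlinarith [norm_nonneg f]

noncomputable def fhnJfun (f : FhnE) (θ : ℝ) : ℝ :=
  ∫ t in (0 : ℝ)..θ, (f (t : AddCircle (2 * Real.pi)) - fhnI f)

theorem fhnJfun_deriv (f : FhnE) (θ : ℝ) :
    HasDerivAt (fhnJfun f) (f (θ : AddCircle (2 * Real.pi)) - fhnI f) θ := by
  have hc : Continuous fun t : ℝ => f (t : AddCircle (2 * Real.pi)) - fhnI f :=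
    (fhn_cont f).sub continuous_const
  exact intervalIntegral.integral_hasDerivAt_right (hc.intervalIntegrable _ _)
    (hc.stronglyMeasurableAtFilter _ _) hc.continuousAt

theorem fhnJfun_cont (f : FhnE) : Continuous (fhnJfun f) :=
  continuous_iff_continuousAt.mpr fun θ => (fhnJfun_deriv f θ).continuousAt

theorem fhnJfun_per (f : FhnE) : Function.Periodic (fhnJfun f) (2 * Real.pi) := by
  intro θ
  have hc : Continuous fun t : ℝ => f (t : AddCircle (2 * Real.pi)) - fhnI f :=
    (fhn_cont f).sub continuous_const
  have hp : Function.Periodic (fun t : ℝ => f (t : AddCircle (2 * Real.pi)) - fhnI f)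
      (2 * Real.pi) := fun t => by
    have := fhn_per f t
    simp only at this ⊢
    rw [this]
  have h1 := hp.intervalIntegral_add_eq θ 0
  have h2 := intervalIntegral.integral_add_adjacent_intervals
    (hc.intervalIntegrable (μ := MeasureTheory.volume) 0 θ) (hc.intervalIntegrable θ (θ + 2 * Real.pi))
  unfold fhnJfun
  have h3 : ∫ t in (0 : ℝ)..(2 * Real.pi), f (t : AddCircle (2 * Real.pi))
      = 2 * Real.pi * fhnI f := by
    rw [fhnI_apply, mul_inv_cancel_left₀ Real.two_pi_pos.ne']
  have h4 : ∫ t in (0 : ℝ)..(2 * Real.pi), (f (t : AddCircle (2 * Real.pi)) - fhnI f) = 0 := by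
    rw [intervalIntegral.integral_sub ((fhn_cont f).intervalIntegrable _ _) (by simp), h3,
      intervalIntegral.integral_const, smul_eq_mul]
    ring
  rw [← h2, h1, zero_add, h4, add_zero]

noncomputable def fhnJ : FhnE →L[ℝ] FhnE :=
  LinearMap.mkContinuous
    { toFun := fun f : FhnE => fhnMk (fhnJfun f) (fhnJfun_cont f) (fhnJfun_per f)
      map_add' := by
        intro f g
        ext x
        induction x using QuotientAddGroup.induction_on with
        | H θ =>
          rw [ContinuousMap.add_apply]
          erw [fhnMk_apply, fhnMk_apply, fhnMk_apply]
          unfold fhnJfun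
          have hf : Continuous fun t : ℝ => f (t : AddCircle (2 * Real.pi)) - fhnI f :=
            (fhn_cont f).sub continuous_const
          have hg : Continuous fun t : ℝ => g (t : AddCircle (2 * Real.pi)) - fhnI g :=
            (fhn_cont g).sub continuous_const
          rw [← intervalIntegral.integral_add (hf.intervalIntegrable _ _)
            (hg.intervalIntegrable _ _)]
          congr 1
          ext t
          simp only [ContinuousMap.add_apply, map_add]
          ring
      map_smul' := by
        intro c f
        ext x
        induction x using QuotientAddGroup.induction_on with
        | H θ =>
          rw [ContinuousMap.smul_apply]
          erw [fhnMk_apply, fhnMk_apply]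
          unfold fhnJfun
          rw [RingHom.id_apply, smul_eq_mul, ← intervalIntegral.integral_const_mul]
          congr 1
          ext t
          simp only [ContinuousMap.smul_apply, map_smul, smul_eq_mul]
          ring } (4 * Real.pi) (by
    intro f
    have hpi := Real.two_pi_pos
    rw [ContinuousMap.norm_le _ (by positivity)]
    intro x
    obtain ⟨θ, hθ, rfl⟩ := AddCircle.eq_coe_Ico x
    change ‖fhnJfun f θ‖ ≤ _
    have h := intervalIntegral.norm_integral_le_of_norm_le_const (a := 0) (b := θ)
      (f := fun t : ℝ => f (t : AddCircle (2 * Real.pi)) - fhnI f) (C := 2 * ‖f‖) (fun x _ => by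
        have h1 := f.norm_coe_le_norm (x : AddCircle (2 * Real.pi))
        have h2 := fhnI_bound f
        have h3 := norm_sub_le (f (x : AddCircle (2 * Real.pi))) (fhnI f)
        rw [Real.norm_eq_abs (fhnI f)] at h3
        linarith)
    rw [sub_zero, abs_of_nonneg hθ.1] at h
    refine h.trans ?_
    nlinarith [norm_nonneg f, hθ.2])

theorem fhnJ_deriv (f : FhnE) (θ : ℝ) :
    HasDerivAt (fun θ : ℝ => fhnJ f (θ : AddCircle (2 * Real.pi)))
      (f (θ : AddCircle (2 * Real.pi)) - fhnI f) θ := fhnJfun_deriv f θ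

noncomputable def fhnCo : FhnE := fhnMk Real.cos Real.continuous_cos Real.cos_periodic
noncomputable def fhnSi : FhnE := fhnMk Real.sin Real.continuous_sin Real.sin_periodic

theorem fhnCo_apply (θ : ℝ) : fhnCo (θ : AddCircle (2 * Real.pi)) = Real.cos θ := rfl
theorem fhnSi_apply (θ : ℝ) : fhnSi (θ : AddCircle (2 * Real.pi)) = Real.sin θ := rfl

noncomputable def fhnP : FhnE →L[ℝ] FhnE :=
  ContinuousLinearMap.id ℝ FhnE
    - (ContinuousLinearMap.smulRight (fhnI ∘L ContinuousLinearMap.mul ℝ FhnE fhnSi) ((2 : ℝ) • fhnSi))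

theorem fhnP_apply (f : FhnE) : fhnP f = f - (2 * fhnI (fhnSi * f)) • fhnSi := by
  simp [fhnP, smul_smul, mul_comm]

noncomputable def fhnS : FhnE →L[ℝ] FhnE :=
  ContinuousLinearMap.mul ℝ FhnE fhnSi ∘L fhnJ ∘L ContinuousLinearMap.mul ℝ FhnE fhnCo ∘L fhnP
    - ContinuousLinearMap.mul ℝ FhnE fhnCo ∘L fhnJ ∘L ContinuousLinearMap.mul ℝ FhnE fhnSi ∘L fhnP

noncomputable def fhnS' : FhnE →L[ℝ] FhnE :=
  ContinuousLinearMap.mul ℝ FhnE fhnCo ∘L fhnJ ∘L ContinuousLinearMap.mul ℝ FhnE fhnCo ∘L fhnP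
    + ContinuousLinearMap.mul ℝ FhnE fhnSi ∘L fhnJ ∘L ContinuousLinearMap.mul ℝ FhnE fhnSi ∘L fhnP

theorem fhnS_apply (f : FhnE) :
    fhnS f = fhnSi * fhnJ (fhnCo * fhnP f) - fhnCo * fhnJ (fhnSi * fhnP f) := by
  simp [fhnS]

theorem fhnS'_apply (f : FhnE) :
    fhnS' f = fhnCo * fhnJ (fhnCo * fhnP f) + fhnSi * fhnJ (fhnSi * fhnP f) := by
  simp [fhnS']

theorem fhnI_one : fhnI 1 = 1 := by
  have := Real.two_pi_pos
  rw [fhnI_apply]; simp; field_simp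

theorem fhnI_co : fhnI fhnCo = 0 :=
  fhnI_deriv fhnSi fhnCo fun θ => Real.hasDerivAt_sin θ

theorem fhnI_co2 : fhnI (fhnCo ^ 2) = 1 / 2 := by
  have h := fhnI_deriv (fhnSi * fhnCo) ((2 : ℝ) • fhnCo ^ 2 - 1) fun θ => by
    refine HasDerivAt.congr_deriv ((Real.hasDerivAt_sin θ).mul (Real.hasDerivAt_cos θ)) ?_
    simp only [ContinuousMap.sub_apply, ContinuousMap.smul_apply, ContinuousMap.pow_apply,
      ContinuousMap.one_apply, fhnCo_apply, smul_eq_mul]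
    linear_combination -1 * Real.sin_sq_add_cos_sq θ
  rw [map_sub, map_smul, fhnI_one, smul_eq_mul] at h
  linarith

theorem fhn_sq : fhnSi ^ 2 + fhnCo ^ 2 = 1 := by
  ext x
  induction x using QuotientAddGroup.induction_on with
  | H θ => exact Real.sin_sq_add_cos_sq θ

theorem fhnI_si2 : fhnI (fhnSi ^ 2) = 1 / 2 := by
  have := congrArg fhnI fhn_sq
  rw [map_add, fhnI_co2, fhnI_one] at this
  linarith

theorem fhnI_si_co : fhnI (fhnCo * fhnSi) = 0 := by
  have h := fhnI_deriv (fhnSi ^ 2) ((2 : ℝ) • (fhnCo * fhnSi)) fun θ => by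
    refine HasDerivAt.congr_deriv ((Real.hasDerivAt_sin θ).pow 2) ?_
    simp only [ContinuousMap.smul_apply, ContinuousMap.mul_apply, fhnCo_apply, fhnSi_apply,
      smul_eq_mul]
    push_cast; ring
  rw [map_smul, smul_eq_mul] at h
  linarith

theorem fhnI_co3 : fhnI (fhnCo ^ 3) = 0 := by
  refine fhnI_deriv (fhnSi - (1 / 3 : ℝ) • fhnSi ^ 3) _ fun θ => ?_
  refine HasDerivAt.congr_deriv ((Real.hasDerivAt_sin θ).sub (((Real.hasDerivAt_sin θ).pow 3).const_mul (1 / 3 : ℝ))) ?_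
  simp only [ContinuousMap.pow_apply, fhnCo_apply]
  push_cast
  linear_combination (- Real.cos θ) * Real.sin_sq_add_cos_sq θ

noncomputable def fhnO : FhnOps FhnE where
  co := fhnCo
  si := fhnSi
  I := fhnI
  J := fhnJ
  S := fhnS
  S' := fhnS'
  I_one := fhnI_one
  I_co := fhnI_co
  I_co2 := fhnI_co2
  I_co3 := fhnI_co3
  I_si2 := fhnI_si2

theorem fhn_P_co (f : FhnE) (h : fhnI (f * fhnCo) = 0) : fhnI (fhnCo * fhnP f) = 0 := by
  have : fhnCo * fhnP f = f * fhnCo - (2 * fhnI (fhnSi * f)) • (fhnCo * fhnSi) := by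
    rw [fhnP_apply]; simp only [Algebra.smul_def]; ring
  rw [this, map_sub, map_smul, h, fhnI_si_co]; simp

theorem fhn_P_si (f : FhnE) : fhnI (fhnSi * fhnP f) = 0 := by
  have : fhnSi * fhnP f = fhnSi * f - (2 * fhnI (fhnSi * f)) • (fhnSi ^ 2) := by
    rw [fhnP_apply]; simp only [Algebra.smul_def]; ring
  rw [this, map_sub, map_smul, fhnI_si2]; simp; ring

theorem fhnS_deriv (f : FhnE) (h : fhnI (f * fhnCo) = 0) (θ : ℝ) :
    HasDerivAt (fun θ : ℝ => fhnS f (θ : AddCircle (2 * Real.pi)))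
      (fhnS' f (θ : AddCircle (2 * Real.pi))) θ := by
  have h1 := fhnJ_deriv (fhnCo * fhnP f) θ
  have h2 := fhnJ_deriv (fhnSi * fhnP f) θ
  rw [fhn_P_co f h] at h1
  rw [fhn_P_si f] at h2
  rw [fhnS_apply, fhnS'_apply]
  refine HasDerivAt.congr_deriv (((Real.hasDerivAt_sin θ).mul h1).sub ((Real.hasDerivAt_cos θ).mul h2)) ?_
  simp only [ContinuousMap.add_apply, ContinuousMap.mul_apply, fhnCo_apply, fhnSi_apply]
  ring

theorem fhnS'_deriv (f : FhnE) (h : fhnI (f * fhnCo) = 0) (θ : ℝ) :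
    HasDerivAt (fun θ : ℝ => fhnS' f (θ : AddCircle (2 * Real.pi)))
      (fhnP f (θ : AddCircle (2 * Real.pi)) - fhnS f (θ : AddCircle (2 * Real.pi))) θ := by
  have h1 := fhnJ_deriv (fhnCo * fhnP f) θ
  have h2 := fhnJ_deriv (fhnSi * fhnP f) θ
  rw [fhn_P_co f h] at h1
  rw [fhn_P_si f] at h2
  rw [fhnS_apply, fhnS'_apply]
  refine HasDerivAt.congr_deriv (((Real.hasDerivAt_cos θ).mul h1).add ((Real.hasDerivAt_sin θ).mul h2)) ?_
  simp only [ContinuousMap.sub_apply, ContinuousMap.mul_apply, fhnCo_apply, fhnSi_apply]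
  linear_combination (fhnP f (θ : AddCircle (2 * Real.pi))) * Real.sin_sq_add_cos_sq θ

theorem fhn_solve (w : ℝ) (A B C K : ℝ → ℝ) (ε : ℝ) (f : FhnE) (m r s : ℝ)
    (hε : ε ≠ 0) (hG : fhnG fhnO w A B C K (ε, f, m, r, s) = 0)
    (hne : fhnI (fhnV fhnO (ε, f, m, r, s) * fhnSi) ≠ 0) :
    (∀ θ : ℝ, HasDerivAt (fun θ : ℝ => fhnU fhnO (ε, f, m, r, s) (θ : AddCircle (2 * Real.pi)))
      (fhnV fhnO (ε, f, m, r, s) (θ : AddCircle (2 * Real.pi))) θ) ∧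
    (∀ θ : ℝ, HasDerivAt (fun θ : ℝ => fhnV fhnO (ε, f, m, r, s) (θ : AddCircle (2 * Real.pi)))
      (m - fhnU fhnO (ε, f, m, r, s) (θ : AddCircle (2 * Real.pi))
        + ε * fhnN fhnO w A B C K (ε, f, m, r, s) (θ : AddCircle (2 * Real.pi))) θ) ∧
    (∀ θ : ℝ, HasDerivAt
      (fun θ : ℝ => fhnJ (fhnQ fhnO w A (ε, f, m, r, s)) (θ : AddCircle (2 * Real.pi)))
      (fhnQ fhnO w A (ε, f, m, r, s) (θ : AddCircle (2 * Real.pi))) θ) := by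
  simp only [fhnG, Prod.mk_eq_zero] at hG
  obtain ⟨g1, g2, g3, g4⟩ := hG
  replace g1 := sub_eq_zero.mp g1
  change fhnI (f * fhnCo) = 0 at g2
  change fhnI (fhnQ fhnO w A (ε, f, m, r, s)) = 0 at g3
  change K ε * fhnI (fhnV fhnO (ε, f, m, r, s) ^ 2) - B ε * fhnTau w (ε, f, m, r, s) ^ 2 *
    fhnI (fhnU fhnO (ε, f, m, r, s) * fhnQ fhnO w A (ε, f, m, r, s)) = 0 at g4
  have hU : fhnU fhnO (ε, f, m, r, s) = m • (1 : FhnE) + r • fhnCo + ε • fhnS f := rfl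
  have hV : fhnV fhnO (ε, f, m, r, s) = ε • fhnS' f - r • fhnSi := rfl
  have dU : ∀ θ : ℝ, HasDerivAt
      (fun θ : ℝ => fhnU fhnO (ε, f, m, r, s) (θ : AddCircle (2 * Real.pi)))
      (fhnV fhnO (ε, f, m, r, s) (θ : AddCircle (2 * Real.pi))) θ := by
    intro θ
    rw [hU, hV]
    refine HasDerivAt.congr_deriv ((((Real.hasDerivAt_cos θ).const_mul r).const_add (m * 1)).add
      ((fhnS_deriv f g2 θ).const_mul ε)) ?_
    simp only [ContinuousMap.sub_apply, ContinuousMap.smul_apply, fhnSi_apply, smul_eq_mul]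
    ring
  have dV : ∀ θ : ℝ, HasDerivAt
      (fun θ : ℝ => fhnV fhnO (ε, f, m, r, s) (θ : AddCircle (2 * Real.pi)))
      (m - fhnU fhnO (ε, f, m, r, s) (θ : AddCircle (2 * Real.pi))
        + ε * fhnP f (θ : AddCircle (2 * Real.pi))) θ := by
    intro θ
    rw [hU, hV]
    refine HasDerivAt.congr_deriv (((fhnS'_deriv f g2 θ).const_mul ε).sub
      ((Real.hasDerivAt_sin θ).const_mul r)) ?_
    simp only [ContinuousMap.add_apply, ContinuousMap.smul_apply, fhnCo_apply, smul_eq_mul,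
      ContinuousMap.one_apply]
    ring
  have dJ : ∀ θ : ℝ, HasDerivAt
      (fun θ : ℝ => fhnJ (fhnQ fhnO w A (ε, f, m, r, s)) (θ : AddCircle (2 * Real.pi)))
      (fhnQ fhnO w A (ε, f, m, r, s) (θ : AddCircle (2 * Real.pi))) θ := by
    intro θ
    have := fhnJ_deriv (fhnQ fhnO w A (ε, f, m, r, s)) θ
    rwa [g3, sub_zero] at this
  have hQ : fhnQ fhnO w A (ε, f, m, r, s) = A ε • fhnU fhnO (ε, f, m, r, s)
    - (1 - w ^ 2 + ε * A ε) • fhnU fhnO (ε, f, m, r, s) ^ 2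
    + ε • fhnU fhnO (ε, f, m, r, s) ^ 3 := rfl
  have hN : f = (fhnTau w (ε, f, m, r, s) ^ 2) • fhnQ fhnO w A (ε, f, m, r, s)
    - (2 * s + ε * s ^ 2) • fhnU fhnO (ε, f, m, r, s)
    + ε • ((K ε * fhnTau w (ε, f, m, r, s)) • fhnV fhnO (ε, f, m, r, s)
      + (B ε * C ε * fhnTau w (ε, f, m, r, s) ^ 2) • fhnU fhnO (ε, f, m, r, s)
      + (B ε * fhnTau w (ε, f, m, r, s) ^ 3) • fhnJ (fhnQ fhnO w A (ε, f, m, r, s))) := g1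
  refine ⟨dU, ?_, dJ⟩
  have hP : fhnP f = f := by
    rw [← g1] at *
    clear hU hV
    generalize fhnU fhnO (ε, f, m, r, s) = U at *
    generalize fhnV fhnO (ε, f, m, r, s) = V at *
    generalize fhnQ fhnO w A (ε, f, m, r, s) = Q at *
    generalize fhnTau w (ε, f, m, r, s) = τ at *
    have i1 : fhnI (V * fhnP f) = 0 := by
      have h := fhnI_deriv ((1 / 2 : ℝ) • (V ^ 2 + (U - m • (1 : FhnE)) ^ 2)) (ε • (V * fhnP f))
        fun θ => by
          refine HasDerivAt.congr_deriv ((((dV θ).pow 2).add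
            (((dU θ).sub_const (m * 1)).pow 2)).const_mul (1 / 2)) ?_
          simp only [ContinuousMap.smul_apply, ContinuousMap.mul_apply, smul_eq_mul]
          push_cast
          ring
      rw [map_smul, smul_eq_mul] at h
      exact (mul_eq_zero.mp h).resolve_left hε
    have i2 : fhnI (V * f) = 0 := by
      have h := fhnI_deriv ((-(2 * s + ε * s ^ 2) / 2) • U ^ 2
        + (τ ^ 2) • ((A ε / 2) • U ^ 2 - ((1 - w ^ 2 + ε * A ε) / 3) • U ^ 3 + (ε / 4) • U ^ 4)
        + (ε * (B ε * C ε * τ ^ 2) / 2) • U ^ 2 + (ε * (B ε * τ ^ 3)) • (U * fhnJ Q))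
        (V * f - (ε * K ε * τ) • V ^ 2 + (ε * (B ε * τ ^ 3)) • (U * Q)) fun θ => by
          refine HasDerivAt.congr_deriv ((((((dU θ).pow 2).const_mul _).add
            ((((((dU θ).pow 2).const_mul _).sub (((dU θ).pow 3).const_mul _)).add
              (((dU θ).pow 4).const_mul _)).const_mul _)).add
            (((dU θ).pow 2).const_mul _)).add (((dU θ).mul (dJ θ)).const_mul _)) ?_
          have hNθ := congrArg (fun F : FhnE => F (θ : AddCircle (2 * Real.pi))) hN
          have hQθ := congrArg (fun F : FhnE => F (θ : AddCircle (2 * Real.pi))) hQ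
          simp only [ContinuousMap.smul_apply, ContinuousMap.mul_apply, smul_eq_mul,
            ContinuousMap.add_apply, ContinuousMap.sub_apply, ContinuousMap.pow_apply] at hNθ hQθ ⊢
          rw [hNθ]
          push_cast
          linear_combination (- τ ^ 2 * V (θ : AddCircle (2 * Real.pi))) * hQθ
      simp only [map_add, map_sub, map_smul, smul_eq_mul] at h
      linear_combination h + ε * τ * g4
    have i3 : V * fhnP f = V * f - (2 * fhnI (fhnSi * f)) • (V * fhnSi) := by
      rw [fhnP_apply]; simp only [Algebra.smul_def]; ring
    rw [i3, map_sub, map_smul, i2, zero_sub, neg_eq_zero, smul_eq_mul] at i1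
    rw [fhnP_apply, (mul_eq_zero.mp i1).resolve_right hne, zero_smul, sub_zero]
  intro θ
  have := dV θ
  rw [hP] at this
  rw [← g1]
  exact this

noncomputable def fhnY (w : ℝ) (A B C : ℝ → ℝ) (p : ℝ × FhnE × ℝ × ℝ × ℝ) : FhnE :=
  p.1 • ((p.2.2.1 * (fhnTau w p)⁻¹ ^ 2) • (1 : FhnE)
    - (p.1 * B p.1 * (fhnTau w p)⁻¹) • fhnV fhnO p
    + (p.1 ^ 2 * (B p.1 * C p.1)) • fhnU fhnO p
    + (p.1 ^ 2 * B p.1 * fhnTau w p) • fhnJ (fhnQ fhnO w A p))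

theorem fhn_small (w : ℝ) (hw : 0 < w) (A B C : ℝ → ℝ) (hA : ContDiff ℝ 1 A)
    (hB : ContDiff ℝ 1 B) (hC : ContDiff ℝ 1 C) (x₀ : FhnE × ℝ × ℝ × ℝ)
    (ψ : ℝ → FhnE × ℝ × ℝ × ℝ) (hψ : Tendsto ψ (𝓝 0) (𝓝 x₀)) (δ : ℝ) (hδ : 0 < δ) :
    ∀ᶠ ε in 𝓝 0, 0 < fhnTau w (ε, ψ ε) ∧ ‖ε • fhnU fhnO (ε, ψ ε)‖ < δ ∧
      ‖fhnY w A B C (ε, ψ ε)‖ < δ ∧ ‖(ε * (fhnTau w (ε, ψ ε))⁻¹) • fhnV fhnO (ε, ψ ε)‖ < δ := by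
  have hp : Tendsto (fun ε => (ε, ψ ε)) (𝓝 (0 : ℝ)) (𝓝 ((0 : ℝ), x₀)) :=
    tendsto_id.prodMk_nhds hψ
  have cU := (fhnU_contDiff fhnO).continuous.continuousAt (x := ((0 : ℝ), x₀))
  have cV := (fhnV_contDiff fhnO).continuous.continuousAt (x := ((0 : ℝ), x₀))
  have cT := (fhnTau_contDiff (E := FhnE) w).continuous.continuousAt (x := ((0 : ℝ), x₀))
  have cQ := (fhnQ_contDiff fhnO w A hA).continuous.continuousAt (x := ((0 : ℝ), x₀))
  have cJ : ContinuousAt (fun p => fhnJ (fhnQ fhnO w A p)) ((0 : ℝ), x₀) :=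
    fhnJ.continuous.continuousAt.comp cQ
  have cB : ContinuousAt (fun p : ℝ × FhnE × ℝ × ℝ × ℝ => B p.1) ((0 : ℝ), x₀) :=
    (hB.continuous.comp continuous_fst).continuousAt
  have cC : ContinuousAt (fun p : ℝ × FhnE × ℝ × ℝ × ℝ => C p.1) ((0 : ℝ), x₀) :=
    (hC.continuous.comp continuous_fst).continuousAt
  have hT0 : fhnTau w ((0 : ℝ), x₀) = w⁻¹ := by simp [fhnTau]
  have cTi : ContinuousAt (fun p : ℝ × FhnE × ℝ × ℝ × ℝ => (fhnTau w p)⁻¹) ((0 : ℝ), x₀) :=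
    cT.inv₀ (by rw [hT0]; positivity)
  have c1 : ContinuousAt (fun p : ℝ × FhnE × ℝ × ℝ × ℝ => p.1) ((0 : ℝ), x₀) := continuousAt_fst
  have c2 : ContinuousAt (fun p : ℝ × FhnE × ℝ × ℝ × ℝ => p.2.2.1) ((0 : ℝ), x₀) := by fun_prop
  have key : ∀ g : ℝ × FhnE × ℝ × ℝ × ℝ → FhnE, ContinuousAt g ((0 : ℝ), x₀) →
      g ((0 : ℝ), x₀) = 0 → ∀ᶠ ε in 𝓝 0, ‖g (ε, ψ ε)‖ < δ := by
    intro g hg h0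
    have h := (hg.norm.tendsto.comp hp)
    simp only [h0, norm_zero] at h
    exact h.eventually (gt_mem_nhds hδ)
  have e1 := key (fun p => p.1 • fhnU fhnO p) (c1.smul cU) (by simp)
  have e2 := key (fun p => (p.1 * (fhnTau w p)⁻¹) • fhnV fhnO p) ((c1.mul cTi).smul cV) (by simp)
  have e3 := key (fhnY w A B C) (by
    unfold fhnY
    exact c1.smul ((((c2.mul (cTi.pow 2)).smul continuousAt_const).sub
      (((c1.mul cB).mul cTi).smul cV)).add (((c1.pow 2).mul (cB.mul cC)).smul cU) |>.add
      ((((c1.pow 2).mul cB).mul cT).smul cJ))) (by simp [fhnY])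
  have e4 : ∀ᶠ ε in 𝓝 0, 0 < fhnTau w (ε, ψ ε) := by
    have h := cT.tendsto.comp hp
    rw [hT0] at h
    exact h.eventually (lt_mem_nhds (inv_pos.mpr hw))
  filter_upwards [e1, e2, e3, e4] with ε h1 h2 h3 h4
  exact ⟨h4, h1, h3, h2⟩

theorem fhn_ne (x₀ : FhnE × ℝ × ℝ × ℝ) (hx : x₀.2.2.1 ≠ 0)
    (ψ : ℝ → FhnE × ℝ × ℝ × ℝ) (hψ : Tendsto ψ (𝓝 0) (𝓝 x₀)) :
    ∀ᶠ ε in 𝓝 0, fhnI (fhnV fhnO (ε, ψ ε) * fhnSi) ≠ 0 := by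
  have hp : Tendsto (fun ε => (ε, ψ ε)) (𝓝 (0 : ℝ)) (𝓝 ((0 : ℝ), x₀)) :=
    tendsto_id.prodMk_nhds hψ
  have cV := (fhnV_contDiff fhnO).continuous
  have hc : Continuous fun p : ℝ × FhnE × ℝ × ℝ × ℝ => fhnI (fhnV fhnO p * fhnSi) :=
    fhnI.continuous.comp (cV.mul continuous_const)
  have h := hc.continuousAt.tendsto.comp hp
  refine h.eventually_ne ?_
  have : fhnV fhnO ((0 : ℝ), x₀) * fhnSi = (- x₀.2.2.1) • fhnSi ^ 2 := by
    have : fhnV fhnO ((0 : ℝ), x₀) = (0 : ℝ) • fhnS' x₀.1 - x₀.2.2.1 • fhnSi := rfl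
    rw [this]; simp only [Algebra.smul_def, map_neg, map_zero]; ring
  rw [this, map_smul, fhnI_si2, smul_eq_mul]
  simpa using hx

theorem fhn_final (w : ℝ) (hw : 0 < w) (A B C K : ℝ → ℝ) (ε : ℝ) (x : FhnE × ℝ × ℝ × ℝ)
    (hε : ε ≠ 0) (hG : fhnG fhnO w A B C K (ε, x) = 0)
    (hne : fhnI (fhnV fhnO (ε, x) * fhnSi) ≠ 0) (hK : C ε - B ε = ε * K ε)
    (δ : ℝ) (hτ : 0 < fhnTau w (ε, x)) (hX : ‖ε • fhnU fhnO (ε, x)‖ < δ)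
    (hY : ‖fhnY w A B C (ε, x)‖ < δ)
    (hZ : ‖(ε * (fhnTau w (ε, x))⁻¹) • fhnV fhnO (ε, x)‖ < δ)
    (a b c d : ℝ) (ha : a = - w ^ 2 + ε * A ε) (hb : b = w ^ 2 * (ε * B ε)) (hc : c = ε * C ε)
    (hd : d = 1 / w ^ 2) :
    ∃ (φ : ℝ → ℝ × ℝ × ℝ) (T : ℝ), 0 < T ∧
        (∀ t, HasDerivAt φ
          ((φ t).2.2,
           b * ((φ t).1 - d * (φ t).2.1),
           ((φ t).1 - a) * ((φ t).1 - 1) * (φ t).1 + (φ t).2.1 + c * (φ t).2.2) t) ∧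
        (∀ t, φ (t + T) = φ t) ∧
        (∃ t s, φ t ≠ φ s) ∧
        (∀ t, ‖φ t‖ < δ) := by
  obtain ⟨f, m, r, s⟩ := x
  obtain ⟨dU, dV, dJ⟩ := fhn_solve w A B C K ε f m r s hε hG hne
  have hQ : fhnQ fhnO w A (ε, f, m, r, s) = A ε • fhnU fhnO (ε, f, m, r, s)
    - (1 - w ^ 2 + ε * A ε) • fhnU fhnO (ε, f, m, r, s) ^ 2
    + ε • fhnU fhnO (ε, f, m, r, s) ^ 3 := rfl
  have hN : fhnN fhnO w A B C K (ε, f, m, r, s)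
    = (fhnTau w (ε, f, m, r, s) ^ 2) • fhnQ fhnO w A (ε, f, m, r, s)
    - (2 * s + ε * s ^ 2) • fhnU fhnO (ε, f, m, r, s)
    + ε • ((K ε * fhnTau w (ε, f, m, r, s)) • fhnV fhnO (ε, f, m, r, s)
      + (B ε * C ε * fhnTau w (ε, f, m, r, s) ^ 2) • fhnU fhnO (ε, f, m, r, s)
      + (B ε * fhnTau w (ε, f, m, r, s) ^ 3) • fhnJ (fhnQ fhnO w A (ε, f, m, r, s))) := rfl
  have hτw : fhnTau w (ε, f, m, r, s) * w = 1 + ε * s := by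
    simp only [fhnTau]; field_simp
  have hYd : fhnY w A B C (ε, f, m, r, s) =
    ε • ((m * (fhnTau w (ε, f, m, r, s))⁻¹ ^ 2) • (1 : FhnE)
    - (ε * B ε * (fhnTau w (ε, f, m, r, s))⁻¹) • fhnV fhnO (ε, f, m, r, s)
    + (ε ^ 2 * (B ε * C ε)) • fhnU fhnO (ε, f, m, r, s)
    + (ε ^ 2 * B ε * fhnTau w (ε, f, m, r, s)) • fhnJ (fhnQ fhnO w A (ε, f, m, r, s))) := rfl
  generalize fhnY w A B C (ε, f, m, r, s) = Y at *
  generalize fhnN fhnO w A B C K (ε, f, m, r, s) = N at *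
  generalize fhnU fhnO (ε, f, m, r, s) = U at *
  generalize fhnV fhnO (ε, f, m, r, s) = V at *
  generalize fhnQ fhnO w A (ε, f, m, r, s) = Q at *
  generalize fhnTau w (ε, f, m, r, s) = τ at *
  obtain ⟨ρ, hρ⟩ : ∃ ρ, ρ = τ⁻¹ := ⟨_, rfl⟩
  have hρτ : ρ * τ = 1 := by rw [hρ]; field_simp
  have hρ0 : ρ ≠ 0 := left_ne_zero_of_mul_eq_one hρτ
  rw [← hρ] at hYd hZ
  have hlin : ∀ t : ℝ, HasDerivAt (fun t : ℝ => ρ * t) ρ t := fun t => by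
    simpa using (hasDerivAt_id t).const_mul ρ
  -- the rescaled second derivative
  have hNe : ∀ y : AddCircle (2 * Real.pi), ρ ^ 2 * (m - U y + ε * N y)
      = m * ρ ^ 2 - w ^ 2 * U y + ε * Q y
        + ε ^ 2 * (K ε * ρ * V y + B ε * C ε * U y + B ε * τ * fhnJ Q y) := by
    intro y
    have h := congrArg (fun F : FhnE => F y) hN
    simp only [ContinuousMap.smul_apply, smul_eq_mul,
            ContinuousMap.add_apply, ContinuousMap.sub_apply] at h
    rw [h]
    have h2 : ρ ^ 2 * τ ^ 2 = 1 := by rw [← mul_pow, hρτ, one_pow]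
    have h3 : ρ ^ 2 * (1 + ε * (2 * s + ε * s ^ 2)) = w ^ 2 := by
      have : 1 + ε * (2 * s + ε * s ^ 2) = (τ * w) ^ 2 := by rw [hτw]; ring
      rw [this, mul_pow, ← mul_assoc, h2, one_mul]
    linear_combination (- U y) * h3
      + (ε * Q y + ε ^ 2 * B ε * C ε * U y + ε ^ 2 * B ε * τ * fhnJ Q y) * h2
      + (ε ^ 2 * K ε * ρ * V y) * hρτ
  have hQe : ∀ y : AddCircle (2 * Real.pi), Q y = A ε * U y - (1 - w ^ 2 + ε * A ε) * U y ^ 2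
      + ε * U y ^ 3 := by
    intro y
    have h := congrArg (fun F : FhnE => F y) hQ
    simpa only [ContinuousMap.smul_apply, smul_eq_mul, ContinuousMap.pow_apply,
            ContinuousMap.add_apply, ContinuousMap.sub_apply] using h
  have hYe : ∀ y : AddCircle (2 * Real.pi), Y y = ε * (m * ρ ^ 2 - ε * B ε * ρ * V y
      + ε ^ 2 * (B ε * C ε) * U y + ε ^ 2 * B ε * τ * fhnJ Q y) := by
    intro y
    have h := congrArg (fun F : FhnE => F y) hYd
    simpa only [ContinuousMap.smul_apply, smul_eq_mul, ContinuousMap.one_apply, mul_one,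
            ContinuousMap.add_apply, ContinuousMap.sub_apply] using h
  have dX : ∀ t : ℝ, HasDerivAt
      (fun t : ℝ => (ε • U) ((ρ * t : ℝ) : AddCircle (2 * Real.pi)))
      (((ε * ρ) • V) ((ρ * t : ℝ) : AddCircle (2 * Real.pi))) t := by
    intro t
    refine HasDerivAt.congr_deriv (((dU (ρ * t)).comp t (hlin t)).const_mul ε) ?_
    simp only [ContinuousMap.smul_apply, smul_eq_mul]; ring
  refine ⟨fun t => ((ε • U) ((ρ * t : ℝ) : AddCircle (2 * Real.pi)),
    Y ((ρ * t : ℝ) : AddCircle (2 * Real.pi)),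
    ((ε * ρ) • V) ((ρ * t : ℝ) : AddCircle (2 * Real.pi))), 2 * Real.pi * τ, by positivity,
    ?_, ?_, ?_, ?_⟩
  · intro t
    refine (dX t).prodMk (HasDerivAt.prodMk ?_ ?_)
    · have hfun : (fun t : ℝ => Y ((ρ * t : ℝ) : AddCircle (2 * Real.pi))) = fun t : ℝ =>
        ε * (m * ρ ^ 2 - ε * B ε * ρ * V ((ρ * t : ℝ) : AddCircle (2 * Real.pi))
      + ε ^ 2 * (B ε * C ε) * U ((ρ * t : ℝ) : AddCircle (2 * Real.pi))
      + ε ^ 2 * B ε * τ * fhnJ Q ((ρ * t : ℝ) : AddCircle (2 * Real.pi))) :=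
        funext fun t => hYe _
      rw [hfun]
      refine HasDerivAt.congr_deriv ((((((dV (ρ * t)).comp t (hlin t)).const_mul
        (ε * B ε * ρ)).const_sub (m * ρ ^ 2)).add
        (((dU (ρ * t)).comp t (hlin t)).const_mul (ε ^ 2 * (B ε * C ε)))).add
        (((dJ (ρ * t)).comp t (hlin t)).const_mul (ε ^ 2 * B ε * τ)) |>.const_mul ε) ?_
      simp only [ContinuousMap.smul_apply, smul_eq_mul]
      generalize ((ρ * t : ℝ) : AddCircle (2 * Real.pi)) = y
      have h1 := hNe y
      rw [hYe]
      have hbd : b * d = ε * B ε := by rw [hb, hd]; field_simp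
      rw [mul_sub, ← mul_assoc b d, hbd, hb]
      linear_combination (-ε ^ 2 * B ε) * h1 + (ε ^ 3 * B ε * Q y) * hρτ
        + (ε ^ 3 * B ε * ρ * V y) * hK
    · refine HasDerivAt.congr_deriv (((dV (ρ * t)).comp t (hlin t)).const_mul (ε * ρ)) ?_
      simp only [ContinuousMap.smul_apply, smul_eq_mul]
      generalize ((ρ * t : ℝ) : AddCircle (2 * Real.pi)) = y
      have h1 := hNe y
      rw [hYe, ha, hc]
      have h2 := hQe y
      linear_combination ε * h1 + ε ^ 2 * h2 - (ε ^ 2 * ρ * V y) * hK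
  · intro t
    have : ((ρ * (t + 2 * Real.pi * τ) : ℝ) : AddCircle (2 * Real.pi)) = ((ρ * t : ℝ) :) := by
      have : ρ * (t + 2 * Real.pi * τ) = ρ * t + 2 * Real.pi := by
        linear_combination (2 * Real.pi) * hρτ
      rw [this, AddCircle.coe_add_period]
    simp only [this]
  · by_contra hcon
    push Not at hcon
    apply hne
    have hV0 : V = 0 := by
      ext y
      induction y using QuotientAddGroup.induction_on with
      | H θ =>
        have hconst : (fun t : ℝ => (ε • U) ((ρ * t : ℝ) : AddCircle (2 * Real.pi)))
            = fun _ => (ε • U) ((ρ * 0 : ℝ) : AddCircle (2 * Real.pi)) :=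
          funext fun t => congrArg Prod.fst (hcon t 0)
        have h1 := dX (ρ⁻¹ * θ)
        rw [hconst] at h1
        have h2 := h1.unique (hasDerivAt_const _ _)
        rw [mul_inv_cancel_left₀ hρ0, ContinuousMap.smul_apply, smul_eq_mul] at h2
        exact (mul_eq_zero.mp h2).resolve_left (mul_ne_zero hε hρ0)
    rw [hV0, zero_mul, map_zero]
  · intro t
    rw [Prod.norm_mk, Prod.norm_mk]
    exact max_lt (((ε • U).norm_coe_le_norm _).trans_lt hX)
      (max_lt ((Y.norm_coe_le_norm _).trans_lt hY)
        ((((ε * ρ) • V).norm_coe_le_norm _).trans_lt hZ))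
end FHN2


/-- **Theorem B, Class B1 (Q1).** For Family B parameters with `d = 1/w²`,
`β₁ = γ₁w²`, `γ₁(w² - 1) > 0` and `k₀ > 0`, for every `δ > 0` and all
sufficiently small `ε ≠ 0` the FitzHugh–Nagumo system has a nonconstant
periodic solution contained in the ball of radius `δ` about the origin. -/
theorem fhn_classB1_periodic_solution
    (w d α₁ α₂ α₃ α₄ α₅ β₁ β₂ β₃ β₄ β₅ γ₁ γ₂ γ₃ γ₄ γ₅ : ℝ) (hw : 0 < w)
    (hd : d = 1 / w ^ 2) (hβ₁ : β₁ = γ₁ * w ^ 2)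
    (hγ : γ₁ * (w ^ 2 - 1) > 0)
    (k₀ : ℝ) (hk₀ : k₀ = (γ₁ * α₁ - w ^ 2 * γ₂ + β₂) * (γ₁ * α₁ + w ^ 2 * γ₂ - β₂))
    (hk : k₀ > 0)
    (a b c : ℝ → ℝ)
    (ha : ∀ ε, a ε = -w ^ 2 + ε * α₁ + ε ^ 2 * α₂ + ε ^ 3 * α₃ + ε ^ 4 * α₄ + ε ^ 5 * α₅)
    (hb : ∀ ε, b ε = ε * β₁ + ε ^ 2 * β₂ + ε ^ 3 * β₃ + ε ^ 4 * β₄ + ε ^ 5 * β₅)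
    (hc : ∀ ε, c ε = ε * γ₁ + ε ^ 2 * γ₂ + ε ^ 3 * γ₃ + ε ^ 4 * γ₄ + ε ^ 5 * γ₅) :
    ∀ δ > 0, ∃ ε₀ > 0, ∀ ε : ℝ, 0 < |ε| → |ε| < ε₀ →
      ∃ (φ : ℝ → ℝ × ℝ × ℝ) (T : ℝ), 0 < T ∧
        (∀ t, HasDerivAt φ
          ((φ t).2.2,
           b ε * ((φ t).1 - d * (φ t).2.1),
           ((φ t).1 - a ε) * ((φ t).1 - 1) * (φ t).1 + (φ t).2.1 + c ε * (φ t).2.2) t) ∧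
        (∀ t, φ (t + T) = φ t) ∧
        (∃ t s, φ t ≠ φ s) ∧
        (∀ t, ‖φ t‖ < δ) := by
  intro δ hδ
  have hw0 : w ≠ 0 := hw.ne'
  have hγ1 : γ₁ ≠ 0 := left_ne_zero_of_mul hγ.ne'
  have hw1 : 1 - w ^ 2 ≠ 0 := by
    have := right_ne_zero_of_mul hγ.ne'
    intro h
    apply this
    linarith
  have hdw : d * w ^ 2 = 1 := by rw [hd]; field_simp
  obtain ⟨A, hA⟩ : ∃ A : ℝ → ℝ, A = fun ε =>
    α₁ + ε * α₂ + ε ^ 2 * α₃ + ε ^ 3 * α₄ + ε ^ 4 * α₅ := ⟨_, rfl⟩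
  obtain ⟨B, hB⟩ : ∃ B : ℝ → ℝ, B = fun ε =>
    d * (β₁ + ε * β₂ + ε ^ 2 * β₃ + ε ^ 3 * β₄ + ε ^ 4 * β₅) := ⟨_, rfl⟩
  obtain ⟨C, hC⟩ : ∃ C : ℝ → ℝ, C = fun ε =>
    γ₁ + ε * γ₂ + ε ^ 2 * γ₃ + ε ^ 3 * γ₄ + ε ^ 4 * γ₅ := ⟨_, rfl⟩
  obtain ⟨K, hK⟩ : ∃ K : ℝ → ℝ, K = fun ε =>
    (γ₂ - d * β₂) + ε * (γ₃ - d * β₃) + ε ^ 2 * (γ₄ - d * β₄) + ε ^ 3 * (γ₅ - d * β₅) := ⟨_, rfl⟩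
  have cA : ContDiff ℝ 1 A := by rw [hA]; fun_prop
  have cB : ContDiff ℝ 1 B := by rw [hB]; fun_prop
  have cC : ContDiff ℝ 1 C := by rw [hC]; fun_prop
  have cK : ContDiff ℝ 1 K := by rw [hK]; fun_prop
  have hB0 : B 0 = γ₁ := by
    rw [hB, hβ₁]; simp only []; linear_combination γ₁ * hdw
  have hA0 : A 0 = α₁ := by rw [hA]; simp
  have hK0 : w ^ 2 * K 0 = w ^ 2 * γ₂ - β₂ := by
    rw [hK]; simp only []; linear_combination (- β₂) * hdw
  obtain ⟨x₀, ψ, hx₀, hψ, hG⟩ := fhn_ift fhnO w A B C K cA cB cC cK hw hw1 (by rwa [hB0]) (by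
    rw [hB0, hA0, hK0]
    rw [hk₀] at hk
    convert hk using 1
    ring)
  have hall := (hG.and (fhn_ne x₀ hx₀ ψ hψ)).and (fhn_small w hw A B C cA cB cC x₀ ψ hψ δ hδ)
  obtain ⟨ε₀, hε₀, h⟩ := Metric.eventually_nhds_iff.mp hall
  refine ⟨ε₀, hε₀, fun ε hε hlt => ?_⟩
  obtain ⟨⟨g1, g2⟩, g3, g4, g5, g6⟩ := h (y := ε) (by simpa [Real.dist_eq] using hlt)
  refine fhn_final w hw A B C K ε (ψ ε) (abs_pos.mp hε) g1 g2 ?_ δ g3 g4 g5 g6 (a ε) (b ε) (c ε) d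
    ?_ ?_ ?_ hd
  · rw [hC, hB, hK, hβ₁]
    simp only []
    linear_combination (- γ₁) * hdw
  · rw [ha, hA]; ring
  · rw [hb, hB]
    simp only []
    linear_combination (- ε * (β₁ + ε * β₂ + ε ^ 2 * β₃ + ε ^ 3 * β₄ + ε ^ 4 * β₅)) * hdw
  · rw [hc, hC]; ring
end
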